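/- arXiv:1801.05202 — 12 statements merged into one kernel-verified Lean document; each statement's English description precedes it below -/
import Mathlib

section
/- There exists a constant c > 0 such that for every sufficiently large integer n there is a graph on n vertices whose edge set can be partitioned into ⌊n/3⌋ pairwise disjoint induced matchings, each of size at least n/2^{c·√(log₂ n)} (i.e., the graph is an (r,t)-graph with r ≥ n/2^{c·√(log₂ n)} and t = ⌊n/3⌋). -/
/-- Numerical comparison turning the Behrend-type bound for `n / 9` into the required form. -/
lemma div_two_rpow_le_rothNumberNat {n : ℕ} (hn : 90 ≤ n) :
    (n : ℝ) / 2 ^ (12 * Real.sqrt (Real.logb 2 n)) ≤ (rothNumberNat (n / 9) : ℝ) := by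
  have hn' : (90 : ℝ) ≤ n := by exact_mod_cast hn
  have hdiv : (n : ℝ) / 10 ≤ ((n / 9 : ℕ) : ℝ) := by
    have h : n ≤ 9 * (n / 9) + 8 := by omega
    have h' : (n : ℝ) ≤ 9 * ((n / 9 : ℕ) : ℝ) + 8 := by exact_mod_cast h
    linarith
  have hpos : (0 : ℝ) < ((n / 9 : ℕ) : ℝ) := by linarith
  have hlog2 := Real.log_two_gt_d9
  have hlog2' := Real.log_two_lt_d9
  have hlog_le : Real.log n ≤ Real.logb 2 n := by
    rw [Real.logb, le_div_iff₀ (by linarith)]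
    nlinarith [Real.log_nonneg (by linarith : (1 : ℝ) ≤ n)]
  have hs : 1 ≤ Real.sqrt (Real.logb 2 n) := by
    rw [Real.one_le_sqrt, Real.logb, le_div_iff₀ (by linarith), one_mul]
    exact Real.log_le_log (by norm_num) (by linarith)
  have hsqrt : Real.sqrt (Real.log ((n / 9 : ℕ) : ℝ)) ≤ Real.sqrt (Real.logb 2 n) := by
    refine Real.sqrt_le_sqrt (le_trans (Real.log_le_log hpos ?_) hlog_le)
    exact_mod_cast Nat.div_le_self n 9
  have hlog10 : Real.log 10 ≤ 4 * Real.log 2 := by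
    rw [← Real.log_rpow (by norm_num)]
    exact Real.log_le_log (by norm_num) (by norm_num)
  set s := Real.sqrt (Real.logb 2 n)
  set u := Real.sqrt (Real.log ((n / 9 : ℕ) : ℝ))
  calc (n : ℝ) / 2 ^ (12 * s) = n * Real.exp (-(Real.log 2 * (12 * s))) := by
        rw [Real.rpow_def_of_pos (by norm_num), Real.exp_neg, div_eq_mul_inv]
    _ ≤ n * Real.exp (-Real.log 10 + -4 * u) := by
        gcongr
        nlinarith
    _ = n / 10 * Real.exp (-4 * u) := by
        rw [Real.exp_add, Real.exp_neg, Real.exp_log (by norm_num)]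
        ring
    _ ≤ ((n / 9 : ℕ) : ℝ) * Real.exp (-4 * u) := by gcongr
    _ ≤ (rothNumberNat (n / 9) : ℝ) := Behrend.roth_lower_bound

/-- **(r,t)-graphs (Ruzsa–Szemerédi).**  There is a constant `c > 0` such that for every
sufficiently large `n` there is a graph on `n` vertices (given by its edge set, the union of
the `F k`) whose edge set is partitioned into `⌊n/3⌋` pairwise disjoint induced matchings,
each of size at least `n / 2 ^ (c·√(log₂ n))`. -/
theorem stmt0 :
    ∃ c : ℝ, 0 < c ∧ ∀ᶠ n : ℕ in Filter.atTop,
      ∃ F : Fin (n / 3) → Finset (Sym2 (Fin n)),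
        -- the matchings are pairwise disjoint
        (∀ k l, k ≠ l → Disjoint (F k) (F l)) ∧
        -- each `F k` consists of genuine edges (no loops) …
        (∀ k, ∀ e ∈ F k, ¬ e.IsDiag) ∧
        -- … which are pairwise vertex-disjoint (a matching)
        (∀ k, ∀ e ∈ F k, ∀ f ∈ F k, e ≠ f → ∀ v : Fin n, v ∈ e → v ∉ f) ∧
        -- each matching is induced: any edge of the graph both of whose endpoints are
        -- endpoints of edges of `F k` belongs to `F k`
        (∀ k, ∀ e ∈ Finset.univ.biUnion F,
            (∀ v ∈ e, ∃ f ∈ F k, v ∈ f) → e ∈ F k) ∧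
        -- each matching has size at least `n / 2 ^ (c·√(log₂ n))`
        (∀ k, (n : ℝ) / 2 ^ (c * Real.sqrt (Real.logb 2 n)) ≤ ((F k).card : ℝ)) := by
  refine ⟨12, by norm_num, Filter.eventually_atTop.2 ⟨90, fun n hn => ?_⟩⟩
  obtain ⟨A, hA, hcard, hfree⟩ := rothNumberNat_spec (n / 9)
  replace hA : ∀ a ∈ A, a < n / 9 := fun a ha => Finset.mem_range.1 (hA ha)
  have hbound : ∀ k : Fin (n / 3), ∀ a ∈ A,
      (k : ℕ) + a < n / 3 + n / 9 ∧ n / 3 + n / 9 + (k + 2 * a) < n := by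
    intro k a ha
    have := hA a ha
    have := k.2
    omega
  let x : Fin (n / 3) → A → Fin n := fun k a =>
    ⟨k + a, by have := hbound k a a.2; omega⟩
  let y : Fin (n / 3) → A → Fin n := fun k a =>
    ⟨n / 3 + n / 9 + (k + 2 * a), (hbound k a a.2).2⟩
  have hxy : ∀ k l a b, x k a ≠ y l b := by
    intro k l a b h
    have := congrArg Fin.val h
    have := hbound k a a.2
    simp only [x, y] at *
    omega
  have hx : ∀ k l a b, x k a = x l b → (k : ℕ) + a = l + b := fun k l a b h =>
    congrArg Fin.val h
  have hy : ∀ k l a b, y k a = y l b → (k : ℕ) + 2 * a = l + 2 * b := fun k l a b h =>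
    Nat.add_left_cancel (congrArg Fin.val h)
  have hedge : ∀ k l a b, s(x k a, y k a) = s(x l b, y l b) → k = l ∧ a = b := by
    intro k l a b h
    rcases Sym2.eq_iff.1 h with ⟨h₁, h₂⟩ | ⟨h₁, -⟩
    · have := hx _ _ _ _ h₁
      have := hy _ _ _ _ h₂
      exact ⟨Fin.ext (by omega), Subtype.ext (by omega)⟩
    · exact absurd h₁ (hxy _ _ _ _)
  refine ⟨fun k => Finset.univ.image fun a => s(x k a, y k a), ?_, ?_, ?_, ?_, ?_⟩
  · intro k l hkl
    rw [Finset.disjoint_left]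
    intro e he he'
    simp only [Finset.mem_image, Finset.mem_univ, true_and] at he he'
    obtain ⟨a, rfl⟩ := he
    obtain ⟨b, hb⟩ := he'
    exact hkl (hedge _ _ _ _ hb).1.symm
  · intro k e he
    simp only [Finset.mem_image, Finset.mem_univ, true_and] at he
    obtain ⟨a, rfl⟩ := he
    exact hxy k k a a
  · intro k e he f hf hef v hve hvf
    simp only [Finset.mem_image, Finset.mem_univ, true_and] at he hf
    obtain ⟨a, rfl⟩ := he
    obtain ⟨b, rfl⟩ := hf
    have hab : a ≠ b := fun h => hef (by rw [h])
    rcases Sym2.mem_iff.1 hve with rfl | rfl <;> rcases Sym2.mem_iff.1 hvf with h | h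
    · exact hab (Subtype.ext (by have := hx _ _ _ _ h; omega))
    · exact hxy _ _ _ _ h
    · exact hxy _ _ _ _ h.symm
    · exact hab (Subtype.ext (by have := hy _ _ _ _ h; omega))
  · intro k e he hends
    simp only [Finset.mem_biUnion, Finset.mem_image, Finset.mem_univ, true_and] at he hends ⊢
    obtain ⟨l, c, rfl⟩ := he
    obtain ⟨_, ⟨a, rfl⟩, ha⟩ := hends _ (Sym2.mem_mk_left _ _)
    obtain ⟨_, ⟨b, rfl⟩, hb⟩ := hends _ (Sym2.mem_mk_right _ _)
    replace ha := hx _ _ _ _ ((Sym2.mem_iff.1 ha).resolve_right (hxy _ _ _ _))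
    replace hb := hy _ _ _ _ ((Sym2.mem_iff.1 hb).resolve_left (hxy _ _ _ _).symm)
    have hcb : (c : ℕ) = b := hfree c.2 b.2 a.2 (by omega)
    have hkl : k = l := Fin.ext (by omega)
    exact ⟨c, by rw [hkl]⟩
  · intro k
    rw [Finset.card_image_of_injective _ fun a b h => (hedge _ _ _ _ h).2, Finset.card_univ,
      Fintype.card_coe, hcard]
    exact div_two_rpow_le_rothNumberNat hn
end

section
/- Let H be a graph on vertex set [n] whose edge set is partitioned into pairwise disjoint induced matchings M_1, …, M_t. Define a tripartite graph G with parts A = {a_1,…,a_n}, B = {b_1,…,b_t}, C = {c_1,…,c_n}, where for every k ∈ [t] and every edge {i,j} ∈ M_k the graph G has the edges (a_i,b_k), (b_k,c_j), (a_j,b_k) and (b_k,c_i). Then for every k ∈ [t] and every edge {i,j} ∈ M_k, the vertex b_k is the unique vertex of B adjacent in G to both a_i and c_j; that is, there is a unique path between a_i and c_j through B in G. -/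
/-- Let `H` be a graph on `[n]` whose edge set is partitioned into pairwise disjoint induced
matchings `M 1, …, M t`.  Form the tripartite graph `G` with parts
`A = {a_1,…,a_n}`, `B = {b_1,…,b_t}`, `C = {c_1,…,c_n}` in which, for every `k` and every
edge `{i,j} ∈ M k`, the pairs `(a_i,b_k)`, `(b_k,c_j)`, `(a_j,b_k)`, `(b_k,c_i)` are edges;
thus `a_i` is adjacent to `b_k` iff `∃ j', {i,j'} ∈ M k`, and `b_k` is adjacent to `c_j` iff
`∃ i', {i',j} ∈ M k`.  Then for every `k` and every `{i,j} ∈ M k`, the vertex `b_k` is the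
unique vertex of `B` adjacent to both `a_i` and `c_j`: there is a unique path from `a_i` to
`c_j` through `B`. -/
theorem stmt1 (n t : ℕ) (M : Fin t → Finset (Sym2 (Fin n)))
    -- the matchings are pairwise disjoint
    (hdisj : ∀ k l, k ≠ l → Disjoint (M k) (M l))
    -- each `M k` consists of genuine edges (no loops) …
    (hdiag : ∀ k, ∀ e ∈ M k, ¬ e.IsDiag)
    -- … which are pairwise vertex-disjoint (a matching)
    (hmatch : ∀ k, ∀ e ∈ M k, ∀ f ∈ M k, e ≠ f → ∀ v : Fin n, v ∈ e → v ∉ f)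
    -- each matching is induced in `H` (whose edge set is the union of the `M k`)
    (hind : ∀ k, ∀ e ∈ Finset.univ.biUnion M,
        (∀ v ∈ e, ∃ f ∈ M k, v ∈ f) → e ∈ M k)
    (k : Fin t) (i j : Fin n) (hij : s(i, j) ∈ M k) :
    ∀ b : Fin t, ((∃ j' : Fin n, s(i, j') ∈ M b) ∧ (∃ i' : Fin n, s(i', j) ∈ M b)) ↔ b = k := by
  refine fun b => ⟨?_, ?_⟩
  · rintro ⟨⟨j', hj'⟩, i', hi'⟩
    have hb : s(i, j) ∈ M b := by
      refine hind b _ (Finset.mem_biUnion.2 ⟨k, Finset.mem_univ k, hij⟩) fun v hv => ?_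
      rcases Sym2.mem_iff.1 hv with rfl | rfl
      · exact ⟨_, hj', Sym2.mem_mk_left _ _⟩
      · exact ⟨_, hi', Sym2.mem_mk_right _ _⟩
    by_contra hne
    exact Finset.disjoint_left.1 (hdisj b k hne) hb hij
  · rintro rfl
    exact ⟨⟨j, hij⟩, i, hij⟩
end

section
/- Let P ∈ {0,1}^{A×B} and Q ∈ {0,1}^{B×C}, write Γ(a) = {b ∈ B : P_{a,b} = 1}, and assume |Γ(a)| ≥ 2 for every a ∈ A. If W is a correct witness for the Boolean matrix product P × Q, then for each a ∈ A there exist ℓ ≥ 1 and subintervals K_1, …, K_ℓ ⊆ C with C = K_1 ∪ … ∪ K_ℓ such that for each i ∈ [ℓ] there is a union gate in W whose output is (Γ(a), K_i, row(Q_{Γ(a)})|_{K_i}). -/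
open scoped Classical

/-- The kind of a gate in a witness circuit: an input gate assigned some `b ∈ B`; a
partition gate with its predecessor and an assigned subinterval `K'` (given by its start
and length in `C`); a union gate with its two predecessors; or a concatenation gate with
its two predecessors. -/
inductive Gk (nB N : ℕ) where
  | input : Fin nB → Gk nB N
  | partition : Fin N → ℕ → ℕ → Gk nB N
  | union : Fin N → Fin N → Gk nB N
  | concat : Fin N → Fin N → Gk nB N

/-- The predecessors of a gate of the given kind. -/
def Gk.preds {nB N : ℕ} : Gk nB N → List (Fin N)
  | .input _ => []
  | .partition p _ _ => [p]
  | .union l r => [l, r]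
  | .concat l r => [l, r]

/-- A witness circuit over `B = Fin nB`: a finite DAG of gates (indexed by `Fin N`,
predecessors of a gate having smaller index).  Each gate `g` outputs a triple
`(S, K, v)`, where `S = wset g ⊆ B` indexes a set of rows of `Q`, `K` is the subinterval
of `C` consisting of the `ln g` columns starting at `st g`, and
`v = row(Q_S)|_K` is determined by `(S, K)`. -/
structure WitnessCircuit (nB : ℕ) where
  N : ℕ
  kind : Fin N → Gk nB N
  wset : Fin N → Finset (Fin nB)
  st : Fin N → ℕ
  ln : Fin N → ℕ
  hacyc : ∀ g : Fin N, ∀ h ∈ (kind g).preds, h < g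

/-- Every gate's output is defined, with `C = Fin nC`: input gates output `({b}, C, Q_b)`;
a partition gate with assigned subinterval `K'` requires `K' ⊆ K` and restricts to `K'`;
a union gate requires its two inputs to carry the same subinterval and outputs the union of
the row sets; a concatenation gate requires the same row set on both sides, with
`min K_L ≤ min K_R`, `max K_L + 1 ≥ min K_R` and `max K_L ≤ max K_R`, and outputs
`(S, K_L ∪ K_R, ·)`. -/
def WitnessCircuit.Defined {nB : ℕ} (nC : ℕ) (W : WitnessCircuit nB) : Prop :=
  (∀ g, 1 ≤ W.ln g ∧ W.st g + W.ln g ≤ nC) ∧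
  ∀ g, match W.kind g with
    | .input b => W.wset g = {b} ∧ W.st g = 0 ∧ W.ln g = nC
    | .partition p s l => 1 ≤ l ∧ W.st p ≤ s ∧ s + l ≤ W.st p + W.ln p ∧
        W.wset g = W.wset p ∧ W.st g = s ∧ W.ln g = l
    | .union l r => W.st l = W.st r ∧ W.ln l = W.ln r ∧
        W.wset g = W.wset l ∪ W.wset r ∧ W.st g = W.st l ∧ W.ln g = W.ln l
    | .concat l r => W.wset l = W.wset r ∧
        W.st l ≤ W.st r ∧ W.st r ≤ W.st l + W.ln l ∧
        W.st l + W.ln l ≤ W.st r + W.ln r ∧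
        W.wset g = W.wset l ∧ W.st g = W.st l ∧
        W.st g + W.ln g = W.st r + W.ln r

/-- The circuit is structured: union gates do not send values into partition gates, and
concatenation gates do not send values into partition or union gates. -/
def WitnessCircuit.Structured {nB : ℕ} (W : WitnessCircuit nB) : Prop :=
  ∀ g, match W.kind g with
    | .input _ => True
    | .partition p _ _ => ∀ x y : Fin W.N,
        W.kind p ≠ Gk.union x y ∧ W.kind p ≠ Gk.concat x y
    | .union l r => ∀ x y : Fin W.N,
        W.kind l ≠ Gk.concat x y ∧ W.kind r ≠ Gk.concat x y
    | .concat _ _ => True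

/-- A correct witness for `P × Q`: a structured witness circuit, all of whose gates are
defined, such that for every `a ∈ A` some gate outputs `(Γ(a), C, row(Q_{Γ(a)}))`, where
`Γ(a) = {b ∈ B : P a b = 1}`. -/
def WitnessCircuit.Correct {nA nB : ℕ} (nC : ℕ) (P : Fin nA → Fin nB → Bool)
    (W : WitnessCircuit nB) : Prop :=
  W.Defined nC ∧ W.Structured ∧
  ∀ a : Fin nA, ∃ g, W.wset g = (Finset.univ.filter fun b => P a b = true) ∧
    W.st g = 0 ∧ W.ln g = nC

/-- In a structured circuit, a gate that is neither a union nor a concatenation gate carries a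
single row. -/
theorem WitnessCircuit.card_wset_eq_one {nB nC : ℕ} {W : WitnessCircuit nB}
    (hD : W.Defined nC) (hS : W.Structured) (g : Fin W.N)
    (hg : ∀ x y : Fin W.N, W.kind g ≠ Gk.union x y ∧ W.kind g ≠ Gk.concat x y) :
    (W.wset g).card = 1 := by
  induction g using WellFoundedLT.induction with
  | ind g ih =>
    have hd := hD.2 g
    have hs := hS g
    have ha := W.hacyc g
    cases hk : W.kind g with
    | input b =>
      simp only [hk] at hd
      simp [hd.1]
    | partition p s l =>
      simp only [hk] at hd hs
      simp only [hk, Gk.preds, List.mem_singleton, forall_eq] at ha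
      rw [hd.2.2.2.1]
      exact ih p ha hs
    | union l r => exact absurd hk (hg l r).1
    | concat l r => exact absurd hk (hg l r).2

/-- Every column of a gate carrying at least two rows lies in the subinterval of some union gate
with the same row set. -/
theorem WitnessCircuit.exists_union_of_two_le_card {nB nC : ℕ} {W : WitnessCircuit nB}
    (hD : W.Defined nC) (hS : W.Structured) (g : Fin W.N) (hg : 2 ≤ (W.wset g).card)
    (c : ℕ) (h₁ : W.st g ≤ c) (h₂ : c < W.st g + W.ln g) :
    ∃ u x y : Fin W.N, W.kind u = Gk.union x y ∧ W.wset u = W.wset g ∧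
      W.st u ≤ c ∧ c < W.st u + W.ln u := by
  induction g using WellFoundedLT.induction with
  | ind g ih =>
    have hd := hD.2 g
    have ha := W.hacyc g
    have hone := W.card_wset_eq_one hD hS g
    cases hk : W.kind g with
    | input b =>
      have := hone (by simp [hk])
      omega
    | partition p s l =>
      have := hone (by simp [hk])
      omega
    | union l r => exact ⟨g, l, r, hk, rfl, h₁, h₂⟩
    | concat l r =>
      simp only [hk] at hd
      obtain ⟨hlr, -, hgap, -, hgl, hst, hend⟩ := hd
      rw [hgl] at hg ⊢
      by_cases hc : c < W.st l + W.ln l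
      · exact ih l (ha l (by simp [hk, Gk.preds])) hg (by omega) hc
      · rw [hlr] at hg ⊢
        exact ih r (ha r (by simp [hk, Gk.preds])) hg (by omega) (by omega)

/-- If `W` is a correct witness for `P × Q` (with `|Γ(a)| ≥ 2` for all `a`), then for each
`a ∈ A` there are `ℓ ≥ 1` subintervals `K_1, …, K_ℓ` of `C` covering `C` such that for each
`i` some union gate of `W` outputs `(Γ(a), K_i, row(Q_{Γ(a)})|_{K_i})`. -/
theorem stmt2 (nA nB nC : ℕ) (hC : 1 ≤ nC)
    (P : Fin nA → Fin nB → Bool) (Q : Fin nB → Fin nC → Bool)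
    (hGamma : ∀ a : Fin nA, 2 ≤ (Finset.univ.filter fun b => P a b = true).card)
    (W : WitnessCircuit nB) (hW : W.Correct nC P) (a : Fin nA) :
    ∃ l : ℕ, 1 ≤ l ∧ ∃ ks kl : Fin l → ℕ,
      (∀ i, 1 ≤ kl i ∧ ks i + kl i ≤ nC) ∧
      (∀ c : ℕ, c < nC → ∃ i, ks i ≤ c ∧ c < ks i + kl i) ∧
      (∀ i, ∃ (g : Fin W.N) (x y : Fin W.N), W.kind g = Gk.union x y ∧
        W.wset g = (Finset.univ.filter fun b => P a b = true) ∧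
        W.st g = ks i ∧ W.ln g = kl i) := by
  obtain ⟨hD, hS, hA⟩ := hW
  obtain ⟨g, hg, hst, hln⟩ := hA a
  have hcard : 2 ≤ (W.wset g).card := hg ▸ hGamma a
  have key (c : Fin nC) := W.exists_union_of_two_le_card hD hS g hcard c (by omega) (by omega)
  choose u x y hk hw hle hlt using key
  exact ⟨nC, hC, fun c => W.st (u c), fun c => W.ln (u c), fun c => hD.1 (u c),
    fun c hc => ⟨⟨c, hc⟩, hle ⟨c, hc⟩, hlt ⟨c, hc⟩⟩,
    fun c => ⟨u c, x c, y c, hk c, (hw c).trans hg, rfl, rfl⟩⟩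
end

section
/- Let n be a sufficiently large integer, G a tripartite graph with parts A, B, C where |A| = n, with adjacency matrices P ∈ {0,1}^{A×B} and Q ∈ {0,1}^{B×C}, and let G̃ be obtained from G by deleting some A–B edges, with A–B adjacency matrix P̃. Assume: (i) for every a ∈ A, every b ∈ B adjacent to a in G̃ is the middle vertex of some c ∈ C that is unique for a in G; (ii) P̃ has at least m ones; (iii) every row Q_b of Q has at least r ones; and (iv) G̃ is (k,ℓ)-unhelpful on C, for some integers k, ℓ ≥ 1. Then every correct union-only witness for P̃ × Q has cost at least mr/(2kℓ) − nr/k. -/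
open scoped Classical

/-- A union circuit over `B = Fin nB`. -/
structure UnionCircuit (nB : ℕ) where
  N : ℕ
  inp : Fin N → Bool
  left : Fin N → Fin N
  right : Fin N → Fin N
  wset : Fin N → Finset (Fin nB)
  hacyc : ∀ g, inp g = false → left g < g ∧ right g < g
  hwset : ∀ g, inp g = false → wset g = wset (left g) ∪ wset (right g)

/-- `row Q S = ⋁_{b ∈ S} Q_b`. -/
noncomputable def rowOr {nB nC : ℕ} (Q : Fin nB → Fin nC → Bool) (S : Finset (Fin nB)) :
    Fin nC → Bool :=
  fun c => S.sup fun b => Q b c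

/-- The number of ones of a Boolean vector. -/
def weight {nC : ℕ} (v : Fin nC → Bool) : ℕ :=
  (Finset.univ.filter fun c => v c = true).card

/-- The row-class of a binary gate `g`. -/
noncomputable def rowClass {nB nC : ℕ} (Q : Fin nB → Fin nC → Bool) (W : UnionCircuit nB)
    (g : Fin W.N) : Finset (Fin nC → Bool) :=
  {rowOr Q (W.wset g), rowOr Q (W.wset (W.left g)), rowOr Q (W.wset (W.right g))}

/-- The cost of a union circuit with respect to `Q`: its number of gates plus the sum, over
all distinct row-classes `T` of its binary gates, of `min_{v ∈ T} |v|`. -/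
noncomputable def unionCost {nB nC : ℕ} (Q : Fin nB → Fin nC → Bool)
    (W : UnionCircuit nB) : ℝ :=
  (W.N : ℝ) +
    ∑ T ∈ (Finset.univ.filter fun g : Fin W.N => W.inp g = false).image (rowClass Q W),
      ((sInf (weight '' (T : Set (Fin nC → Bool))) : ℕ) : ℝ)

/-- `c ∈ C` is unique for `a ∈ A` in the tripartite graph `G = (P, Q)` if there is exactly
one `b ∈ B` (its middle vertex) with `P a b = 1` and `Q b c = 1`. -/
def UniqueFor {nA nB nC : ℕ} (P : Fin nA → Fin nB → Bool) (Q : Fin nB → Fin nC → Bool)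
    (a : Fin nA) (c : Fin nC) : Prop :=
  ∃! b : Fin nB, P a b = true ∧ Q b c = true

/-- `C[a]_G`: the set of vertices of `C` unique for `a` in `G = (P, Q)`. -/
noncomputable def uniqueSet {nA nB nC : ℕ} (P : Fin nA → Fin nB → Bool)
    (Q : Fin nB → Fin nC → Bool) (a : Fin nA) : Finset (Fin nC) :=
  Finset.univ.filter fun c => UniqueFor P Q a c

/-- `β'_{a,G̃}(S)`: the set of middle vertices `b` of vertices `c ∈ S` unique for `a` in `G`
such that the edge `(a,b)` is present in `G̃` (adjacency matrix `P'`). -/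
noncomputable def beta' {nA nB nC : ℕ} (P P' : Fin nA → Fin nB → Bool)
    (Q : Fin nB → Fin nC → Bool) (a : Fin nA) (S : Finset (Fin nC)) : Finset (Fin nB) :=
  Finset.univ.filter fun b => P' a b = true ∧
    ∃ c ∈ S, UniqueFor P Q a c ∧ P a b = true ∧ Q b c = true

/-- `S ⊆ B` is helpful for `a` on `K`: there is `S' ⊆ β'_{a,G̃}(K)` with `|S| ≤ |S'|` and
`C[a]_G ∩ K|_{row(Q_S)} = C[a]_G ∩ K|_{row(Q_{S'})}`. -/
def Helpful {nA nB nC : ℕ} (P P' : Fin nA → Fin nB → Bool) (Q : Fin nB → Fin nC → Bool)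
    (a : Fin nA) (K : Finset (Fin nC)) (S : Finset (Fin nB)) : Prop :=
  ∃ S' ⊆ beta' P P' Q a K, S.card ≤ S'.card ∧
    uniqueSet P Q a ∩ (K.filter fun c => rowOr Q S c = true) =
      uniqueSet P Q a ∩ (K.filter fun c => rowOr Q S' c = true)

/-- `G̃` is `(k,ℓ)`-unhelpful on `K` if every `S ⊆ B` with `|S| ≥ ℓ` is helpful on `K` for
at most `k` vertices `a ∈ A`. -/
def Unhelpful {nA nB nC : ℕ} (P P' : Fin nA → Fin nB → Bool) (Q : Fin nB → Fin nC → Bool)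
    (K : Finset (Fin nC)) (k l : ℝ) : Prop :=
  ∀ S : Finset (Fin nB), l ≤ (S.card : ℝ) →
    ((Finset.univ.filter fun a : Fin nA => Helpful P P' Q a K S).card : ℝ) ≤ k

/-- The neighbourhood of `a` in the bipartite graph with adjacency matrix `P`. -/
def nbr {nA nB : ℕ} (P : Fin nA → Fin nB → Bool) (a : Fin nA) : Finset (Fin nB) :=
  Finset.univ.filter fun b => P a b = true

/-- The binary gates whose set has at least `l` elements and is contained in `S`. -/
noncomputable def UnionCircuit.largeGates {nB : ℕ} (W : UnionCircuit nB) (l : ℕ)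
    (S : Finset (Fin nB)) : Finset (Fin W.N) :=
  Finset.univ.filter fun g => W.inp g = false ∧ W.wset g ⊆ S ∧ l ≤ (W.wset g).card

theorem UnionCircuit.mem_largeGates {nB : ℕ} {W : UnionCircuit nB} {l : ℕ}
    {S : Finset (Fin nB)} {g : Fin W.N} :
    g ∈ W.largeGates l S ↔ W.inp g = false ∧ W.wset g ⊆ S ∧ l ≤ (W.wset g).card := by
  simp [UnionCircuit.largeGates]

theorem rowOr_eq_true {nB nC : ℕ} {Q : Fin nB → Fin nC → Bool} {S : Finset (Fin nB)}
    {c : Fin nC} : rowOr Q S c = true ↔ ∃ b ∈ S, Q b c = true := by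
  unfold rowOr
  induction S using Finset.induction_on with
  | empty => simp
  | insert b S hb ih => simp [Finset.sup_insert, ih]

theorem rowOr_mono {nB nC : ℕ} (Q : Fin nB → Fin nC → Bool) {S T : Finset (Fin nB)}
    (h : S ⊆ T) : rowOr Q S ≤ rowOr Q T :=
  fun _ => Finset.sup_mono h

theorem mem_rowClass {nB nC : ℕ} {Q : Fin nB → Fin nC → Bool} {W : UnionCircuit nB}
    {g : Fin W.N} {v : Fin nC → Bool} :
    v ∈ rowClass Q W g ↔ v = rowOr Q (W.wset g) ∨ v = rowOr Q (W.wset (W.left g)) ∨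
      v = rowOr Q (W.wset (W.right g)) := by
  simp [rowClass]

theorem le_rowOr_wset_of_mem_rowClass {nB nC : ℕ} {Q : Fin nB → Fin nC → Bool}
    {W : UnionCircuit nB} {g : Fin W.N} (hg : W.inp g = false) {v : Fin nC → Bool}
    (hv : v ∈ rowClass Q W g) : v ≤ rowOr Q (W.wset g) := by
  rcases mem_rowClass.1 hv with rfl | rfl | rfl
  · exact le_rfl
  · exact rowOr_mono Q (W.hwset g hg ▸ Finset.subset_union_left)
  · exact rowOr_mono Q (W.hwset g hg ▸ Finset.subset_union_right)

/-- A row-class determines the row of its gate, as the largest element. -/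
theorem rowOr_wset_eq_of_rowClass_eq {nB nC : ℕ} {Q : Fin nB → Fin nC → Bool}
    {W : UnionCircuit nB} {g h : Fin W.N} (hg : W.inp g = false) (hh : W.inp h = false)
    (e : rowClass Q W g = rowClass Q W h) : rowOr Q (W.wset g) = rowOr Q (W.wset h) :=
  le_antisymm
    (le_rowOr_wset_of_mem_rowClass hh (e ▸ mem_rowClass.2 (Or.inl rfl)))
    (le_rowOr_wset_of_mem_rowClass hg (e.symm ▸ mem_rowClass.2 (Or.inl rfl)))

theorem UnionCircuit.wset_nonempty {nB : ℕ} {W : UnionCircuit nB}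
    (hin : ∀ g, W.inp g = true → ∃ b, W.wset g = {b}) (g : Fin W.N) :
    (W.wset g).Nonempty := by
  induction g using WellFoundedLT.induction with
  | ind g ih =>
    cases hg : W.inp g with
    | true =>
      obtain ⟨b, hb⟩ := hin g hg
      simp [hb]
    | false =>
      rw [W.hwset g hg]
      exact (ih _ (W.hacyc g hg).1).mono Finset.subset_union_left

theorem le_weight_rowOr {nB nC r : ℕ} {Q : Fin nB → Fin nC → Bool}
    (hr : ∀ b : Fin nB, r ≤ (Finset.univ.filter fun c => Q b c = true).card)
    {S : Finset (Fin nB)} (hS : S.Nonempty) : r ≤ weight (rowOr Q S) := by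
  obtain ⟨b, hb⟩ := hS
  refine (hr b).trans (Finset.card_le_card fun c hc => ?_)
  simp only [Finset.mem_filter, Finset.mem_univ, true_and] at hc ⊢
  exact rowOr_eq_true.2 ⟨b, hb, hc⟩

/-- The cost is at least `r` times the number of row-classes. -/
theorem card_mul_le_unionCost {nB nC r : ℕ} {Q : Fin nB → Fin nC → Bool}
    {W : UnionCircuit nB} (hin : ∀ g, W.inp g = true → ∃ b, W.wset g = {b})
    (hr : ∀ b : Fin nB, r ≤ (Finset.univ.filter fun c => Q b c = true).card) :
    (((Finset.univ.filter fun g : Fin W.N => W.inp g = false).image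
      (rowClass Q W)).card : ℝ) * r ≤ unionCost Q W := by
  unfold unionCost
  refine le_add_of_nonneg_of_le (Nat.cast_nonneg _) ?_
  rw [← nsmul_eq_mul]
  refine Finset.card_nsmul_le_sum _ _ _ fun T hT => ?_
  obtain ⟨g, -, rfl⟩ := Finset.mem_image.1 hT
  obtain ⟨v, hv, e⟩ := Nat.sInf_mem (s := weight '' (rowClass Q W g : Set (Fin nC → Bool)))
    ⟨_, _, Finset.mem_coe.2 (mem_rowClass.2 (Or.inl rfl)), rfl⟩
  rw [← e, Nat.cast_le]
  rcases mem_rowClass.1 (Finset.mem_coe.1 hv) with rfl | rfl | rfl <;>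
    exact le_weight_rowOr hr (UnionCircuit.wset_nonempty hin _)

/-- If every neighbour of `a` in `Pt` is the middle vertex of a unique vertex, then the map
`S ↦ row Q S` is injective on sets of such neighbours. -/
theorem subset_of_rowOr_le {nA nB nC : ℕ} {P Pt : Fin nA → Fin nB → Bool}
    {Q : Fin nB → Fin nC → Bool} {a : Fin nA} (hsub : ∀ b, Pt a b = true → P a b = true)
    (hmid : ∀ b, Pt a b = true → ∃ c, UniqueFor P Q a c ∧ P a b = true ∧ Q b c = true)
    {S T : Finset (Fin nB)} (hS : S ⊆ nbr Pt a) (hT : T ⊆ nbr Pt a)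
    (h : rowOr Q S = rowOr Q T) : S ⊆ T := by
  intro b hb
  obtain ⟨c, hc, hPb, hQb⟩ := hmid b (by simpa [nbr] using hS hb)
  obtain ⟨b', hb', hQ'⟩ := rowOr_eq_true.1 (h ▸ rowOr_eq_true.2 ⟨b, hb, hQb⟩)
  have hP' : P a b' = true := hsub b' (by simpa [nbr] using hT hb')
  rwa [hc.unique ⟨hPb, hQb⟩ ⟨hP', hQ'⟩]

theorem eq_of_rowOr_eq {nA nB nC : ℕ} {P Pt : Fin nA → Fin nB → Bool}
    {Q : Fin nB → Fin nC → Bool} {a : Fin nA} (hsub : ∀ b, Pt a b = true → P a b = true)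
    (hmid : ∀ b, Pt a b = true → ∃ c, UniqueFor P Q a c ∧ P a b = true ∧ Q b c = true)
    {S T : Finset (Fin nB)} (hS : S ⊆ nbr Pt a) (hT : T ⊆ nbr Pt a)
    (h : rowOr Q S = rowOr Q T) : S = T :=
  (subset_of_rowOr_le hsub hmid hS hT h).antisymm (subset_of_rowOr_le hsub hmid hT hS h.symm)

/-- A set with the same row as a set of neighbours of `a`, and of no larger size, is helpful
for `a`. -/
theorem helpful_of_rowOr_eq {nA nB nC : ℕ} {P Pt : Fin nA → Fin nB → Bool}
    {Q : Fin nB → Fin nC → Bool} {a : Fin nA}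
    (hmid : ∀ b, Pt a b = true → ∃ c, UniqueFor P Q a c ∧ P a b = true ∧ Q b c = true)
    {S T : Finset (Fin nB)} (hT : T ⊆ nbr Pt a) (hcard : S.card ≤ T.card)
    (h : rowOr Q S = rowOr Q T) : Helpful P Pt Q a Finset.univ S := by
  refine ⟨T, fun b hb => ?_, hcard, by rw [h]⟩
  have hPt : Pt a b = true := by simpa [nbr] using hT hb
  obtain ⟨c, hc⟩ := hmid b hPt
  exact Finset.mem_filter.2 ⟨Finset.mem_univ _, hPt, c, Finset.mem_univ _, hc⟩

/-- Each row-class is the row-class of a large gate below the neighbourhood of `a` for at most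
`k` vertices `a`. -/
theorem card_filter_mem_image_rowClass_le {nA nB nC k l : ℕ} {P Pt : Fin nA → Fin nB → Bool}
    {Q : Fin nB → Fin nC → Bool} {W : UnionCircuit nB}
    (hmid : ∀ a b, Pt a b = true → ∃ c, UniqueFor P Q a c ∧ P a b = true ∧ Q b c = true)
    (hun : Unhelpful P Pt Q Finset.univ (k : ℝ) (l : ℝ)) (T : Finset (Fin nC → Bool)) :
    (Finset.univ.filter fun a : Fin nA =>
      T ∈ (W.largeGates l (nbr Pt a)).image (rowClass Q W)).card ≤ k := by
  set G : Finset (Fin W.N) := Finset.univ.filter fun g =>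
    rowClass Q W g = T ∧ ∃ a, g ∈ W.largeGates l (nbr Pt a)
  rcases G.eq_empty_or_nonempty with hempty | hne
  · rw [Finset.filter_false_of_mem, Finset.card_empty]
    · exact Nat.zero_le k
    · intro a _ ha
      obtain ⟨g, hg, e⟩ := Finset.mem_image.1 ha
      have : g ∈ G := Finset.mem_filter.2 ⟨Finset.mem_univ _, e, a, hg⟩
      simp [hempty] at this
  · obtain ⟨g, hg, hmin⟩ := Finset.exists_min_image G (fun g => (W.wset g).card) hne
    obtain ⟨-, e, a₀, hga₀⟩ := Finset.mem_filter.1 hg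
    obtain ⟨hbin, -, hl⟩ := UnionCircuit.mem_largeGates.1 hga₀
    have hk := hun (W.wset g) (by exact_mod_cast hl)
    refine le_trans (Finset.card_le_card fun a ha => ?_) (by exact_mod_cast hk)
    obtain ⟨h, hh, e'⟩ := Finset.mem_image.1 (Finset.mem_filter.1 ha).2
    obtain ⟨hbin', hsub', -⟩ := UnionCircuit.mem_largeGates.1 hh
    exact Finset.mem_filter.2 ⟨Finset.mem_univ _, helpful_of_rowOr_eq (hmid a) hsub'
      (hmin h (Finset.mem_filter.2 ⟨Finset.mem_univ _, e', a, hh⟩))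
      (rowOr_wset_eq_of_rowClass_eq hbin hbin' (e.trans e'.symm))⟩

/-- If the neighbourhood of `a` is computed, the large gates below it have many row-classes. -/
theorem card_nbr_le {nA nB nC l : ℕ} {P Pt : Fin nA → Fin nB → Bool}
    {Q : Fin nB → Fin nC → Bool} {W : UnionCircuit nB} {a : Fin nA} (hl : 1 ≤ l)
    (hsub : ∀ b, Pt a b = true → P a b = true)
    (hmid : ∀ b, Pt a b = true → ∃ c, UniqueFor P Q a c ∧ P a b = true ∧ Q b c = true)
    (hin : ∀ g, W.inp g = true → ∃ b, W.wset g = {b})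
    (hout : ∃ g, W.wset g = nbr Pt a) :
    (nbr Pt a).card ≤
      2 * l * ((W.largeGates l (nbr Pt a)).image (rowClass Q W)).card + l := by
  set G := W.largeGates l (nbr Pt a)
  set R := G.image (rowClass Q W)
  obtain ⟨t, ht⟩ := hout
  have : Nonempty (Fin W.N) := ⟨t⟩
  have hex : ∀ T ∈ R, ∃ g ∈ G, rowClass Q W g = T ∧ ∀ h ∈ G, rowClass Q W h = T → g ≤ h := by
    intro T hT
    obtain ⟨g₀, hg₀, e₀⟩ := Finset.mem_image.1 hT
    obtain ⟨g, hg, hmin⟩ := Finset.exists_min_image (G.filter fun g => rowClass Q W g = T) id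
      ⟨g₀, Finset.mem_filter.2 ⟨hg₀, e₀⟩⟩
    exact ⟨g, (Finset.mem_filter.1 hg).1, (Finset.mem_filter.1 hg).2,
      fun h hh e => hmin h (Finset.mem_filter.2 ⟨hh, e⟩)⟩
  choose! γ hγG hγT hγmin using hex
  let low : Fin W.N → Finset (Fin nB) := fun h => if (W.wset h).card ≤ l then W.wset h else ∅
  have hlow : ∀ h, (low h).card ≤ l := by
    intro h
    by_cases hc : (W.wset h).card ≤ l <;> simp [low, hc]
  let U : Finset (Fin nB) := R.biUnion fun T => low (W.left (γ T)) ∪ low (W.right (γ T))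
  have hU : U.card ≤ R.card * (2 * l) := by
    refine Finset.card_biUnion_le_card_mul _ _ _ fun T _ => ?_
    have := Finset.card_union_le (low (W.left (γ T))) (low (W.right (γ T)))
    have := hlow (W.left (γ T))
    have := hlow (W.right (γ T))
    omega
  have hcover : ∀ h, W.wset h ⊆ nbr Pt a → (W.wset h).card ≤ l ∨ W.wset h ⊆ U := by
    intro h
    induction h using WellFoundedLT.induction with
    | ind h ih =>
      intro hh
      refine or_iff_not_imp_left.2 fun hc => ?_
      have hbin : W.inp h = false := by
        by_contra hne
        obtain ⟨b, hb⟩ := hin h (by simpa using hne)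
        exact hc (by simpa [hb] using hl)
      have hhG : h ∈ G := UnionCircuit.mem_largeGates.2 ⟨hbin, hh, (not_le.1 hc).le⟩
      have hTR : rowClass Q W h ∈ R := Finset.mem_image_of_mem _ hhG
      obtain ⟨hbin', hsub', -⟩ := UnionCircuit.mem_largeGates.1 (hγG _ hTR)
      have hle := hγmin _ hTR h hhG rfl
      have hset : W.wset h = W.wset (γ (rowClass Q W h)) :=
        eq_of_rowOr_eq hsub hmid hh hsub'
          (rowOr_wset_eq_of_rowClass_eq hbin hbin' (hγT _ hTR).symm)
      have hchild : ∀ x < h, W.wset x ⊆ nbr Pt a →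
          low x ⊆ low (W.left (γ (rowClass Q W h))) ∪ low (W.right (γ (rowClass Q W h))) →
          W.wset x ⊆ U := by
        intro x hx hxs hxl
        by_cases hxc : (W.wset x).card ≤ l
        · have hlx : low x = W.wset x := if_pos hxc
          rw [← hlx]
          exact hxl.trans (Finset.subset_biUnion_of_mem
            (fun T => low (W.left (γ T)) ∪ low (W.right (γ T))) hTR)
        · exact (ih x hx hxs).resolve_left hxc
      have hunion := W.hwset _ hbin'
      obtain ⟨hleft, hright⟩ := W.hacyc _ hbin'
      rw [hset, hunion]
      rw [hunion] at hsub'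
      exact Finset.union_subset
        (hchild _ (hleft.trans_le hle) (Finset.union_subset_left hsub') Finset.subset_union_left)
        (hchild _ (hright.trans_le hle) (Finset.union_subset_right hsub')
          Finset.subset_union_right)
  rw [← ht]
  rcases hcover t ht.subset with h | h
  · exact h.trans (Nat.le_add_left _ _)
  · calc (W.wset t).card ≤ U.card := Finset.card_le_card h
      _ ≤ R.card * (2 * l) := hU
      _ ≤ 2 * l * R.card + l := by rw [mul_comm]; exact Nat.le_add_right _ _

theorem card_edges_eq_sum_card_nbr {nA nB : ℕ} (P : Fin nA → Fin nB → Bool) :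
    (Finset.univ.filter fun p : Fin nA × Fin nB => P p.1 p.2 = true).card =
      ∑ a, (nbr P a).card := by
  simp only [nbr, Finset.card_filter, Fintype.sum_prod_type]

/-- **Lemma (union circuits).**  Let `n` be sufficiently large, `G` a tripartite graph with
parts `A, B, C`, `|A| = n`, with matrices `P, Q`, and `G̃ ⊆ G` (matrix `P̃ ≤ P`, same `Q`).
Assume every `b` adjacent in `G̃` to `a` is the middle vertex of some `c` unique for `a` in
`G`; `P̃` has at least `m` ones; every row of `Q` has at least `r` ones; and `G̃` is
`(k,ℓ)`-unhelpful on `C`.  Then every correct union-only witness for `P̃ × Q` has cost at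
least `mr/(2kℓ) − nr/k`. -/
theorem stmt4 :
    ∀ᶠ n : ℕ in Filter.atTop, ∀ (nB nC : ℕ)
      (P Pt : Fin n → Fin nB → Bool) (Q : Fin nB → Fin nC → Bool),
      (∀ a b, Pt a b = true → P a b = true) →
      (∀ a b, Pt a b = true →
        ∃ c : Fin nC, UniqueFor P Q a c ∧ P a b = true ∧ Q b c = true) →
      ∀ (m r k l : ℕ), 1 ≤ k → 1 ≤ l →
        m ≤ (Finset.univ.filter fun p : Fin n × Fin nB => Pt p.1 p.2 = true).card →
        (∀ b : Fin nB, r ≤ (Finset.univ.filter fun c => Q b c = true).card) →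
        Unhelpful P Pt Q Finset.univ (k : ℝ) (l : ℝ) →
        ∀ W : UnionCircuit nB,
          (∀ g, W.inp g = true → ∃ b, W.wset g = {b}) →
          (∀ a : Fin n, ∃ g, W.wset g = Finset.univ.filter fun b => Pt a b = true) →
          ((m : ℝ) * r) / (2 * k * l) - ((n : ℝ) * r) / k ≤ unionCost Q W := by
  refine Filter.Eventually.of_forall ?_
  intro n nB nC P Pt Q hsub hmid m r k l hk hl hm hr hun W hin hout
  set cls := (Finset.univ.filter fun g : Fin W.N => W.inp g = false).image (rowClass Q W)
    with hcls
  let R : Fin n → Finset (Finset (Fin nC → Bool)) := fun a =>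
    (W.largeGates l (nbr Pt a)).image (rowClass Q W)
  have hRcls : ∀ a, R a ⊆ cls := fun a => Finset.image_subset_image fun g hg =>
    Finset.mem_filter.2 ⟨Finset.mem_univ _, (UnionCircuit.mem_largeGates.1 hg).1⟩
  have hdouble : ∑ a, (R a).card ≤ cls.card * k := by
    calc ∑ a, (R a).card = ∑ a, (cls.filter fun T => T ∈ R a).card := by
          refine Finset.sum_congr rfl fun a _ => ?_
          rw [Finset.filter_mem_eq_inter, Finset.inter_eq_right.2 (hRcls a)]
      _ = ∑ T ∈ cls, (Finset.univ.filter fun a => T ∈ R a).card :=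
          Finset.sum_card_bipartiteAbove_eq_sum_card_bipartiteBelow fun a T => T ∈ R a
      _ ≤ cls.card * k := Finset.sum_le_card_nsmul _ _ _ fun T _ =>
          card_filter_mem_image_rowClass_le hmid hun T
  have hcount : m ≤ 2 * l * (cls.card * k) + n * l := by
    calc m ≤ ∑ a, (nbr Pt a).card := hm.trans (card_edges_eq_sum_card_nbr Pt).le
      _ ≤ ∑ a, (2 * l * (R a).card + l) := Finset.sum_le_sum fun a _ =>
          card_nbr_le hl (hsub a) (hmid a) hin (hout a)
      _ = 2 * l * ∑ a, (R a).card + n * l := by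
          simp [Finset.sum_add_distrib, Finset.mul_sum]
      _ ≤ 2 * l * (cls.card * k) + n * l := by gcongr
  refine le_trans ?_ (card_mul_le_unionCost hin hr)
  rw [← hcls]
  have hcount' : (m : ℝ) ≤ 2 * l * (cls.card * k) + n * l := by exact_mod_cast hcount
  have hk' : (0 : ℝ) < k := by exact_mod_cast hk
  have hl' : (0 : ℝ) < l := by exact_mod_cast hl
  rw [sub_le_iff_le_add, div_le_iff₀ (by positivity)]
  have hexpand : ((cls.card : ℝ) * r + n * r / k) * (2 * k * l) =
      (2 * l * (cls.card * k) + n * l) * r + n * l * r := by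
    field_simp
    ring
  rw [hexpand]
  have hmr := mul_le_mul_of_nonneg_right hcount' (Nat.cast_nonneg (α := ℝ) r)
  have : (0 : ℝ) ≤ n * l * r := by positivity
  linarith
end

section
/- Let c, d ≥ 4 be integers and n ≥ 2 a sufficiently large integer. Let G be any bipartite graph between vertex sets A and B with |A| = n and |B| ≤ n, and let G̃ be the random subgraph of G obtained by deleting each edge independently with probability 1/2. Then the probability that G̃ is (c·log₂ n, d·log₂ n)-diverse is at least 1 − n^{−(cd/2)·log₂ n}. -/
open scoped Classical

/-- A bipartite graph (adjacency matrix `P'`) between `A = Fin n` and `B = Fin m` is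
`(k,ℓ)`-diverse if for every `S ⊆ B` with `|S| ≥ ℓ`, fewer than `k` vertices of `A` are
adjacent to every vertex of `S`. -/
def Diverse {n m : ℕ} (P' : Fin n → Fin m → Bool) (k l : ℝ) : Prop :=
  ∀ S : Finset (Fin m), l ≤ (S.card : ℝ) →
    ((Finset.univ.filter fun a : Fin n => ∀ b ∈ S, P' a b = true).card : ℝ) < k

/-- Requiring a subgraph of `P` to contain all edges between `T` and `S` costs a factor of at
least `2 ^ (|T| * |S|)` in the number of subgraphs. -/
theorem card_subgraphs_complete_mul_le {α β : Type*} [Fintype α] [DecidableEq α] [Fintype β]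
    [DecidableEq β]
    (P : α → β → Bool) (T : Finset α) (S : Finset β) :
    (Finset.univ.filter fun P' : α → β → Bool =>
        (∀ a b, P' a b = true → P a b = true) ∧ ∀ a ∈ T, ∀ b ∈ S, P' a b = true).card *
        2 ^ (T.card * S.card) ≤
      (Finset.univ.filter fun P' : α → β → Bool =>
        ∀ a b, P' a b = true → P a b = true).card := by
  rw [← Finset.card_product, ← Finset.card_powerset, ← Finset.card_product]
  refine Finset.card_le_card_of_injOn
    (fun q a b => q.1 a b && !decide ((a, b) ∈ q.2)) ?_ ?_
  · rintro ⟨Q, X⟩ hq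
    simp only [Finset.coe_product, Set.mem_prod, Finset.mem_coe, Finset.mem_filter,
      Finset.mem_univ, true_and] at hq ⊢
    intro a b hab
    simp only [Bool.and_eq_true] at hab
    exact hq.1.1 a b hab.1
  · rintro ⟨Q, X⟩ hq ⟨Q', X'⟩ hq' heq
    simp only [Finset.coe_product, Set.mem_prod, Finset.mem_coe, Finset.mem_filter,
      Finset.mem_univ, true_and, Finset.mem_powerset] at hq hq'
    obtain ⟨⟨-, hQ⟩, hX⟩ := hq
    obtain ⟨⟨-, hQ'⟩, hX'⟩ := hq'
    have key : ∀ a b, (Q a b && !decide ((a, b) ∈ X)) = (Q' a b && !decide ((a, b) ∈ X')) :=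
      fun a b => congrFun (congrFun heq a) b
    have hmem : ∀ a b, Q a b = Q' a b ∧ ((a, b) ∈ X ↔ (a, b) ∈ X') := by
      intro a b
      have h := key a b
      by_cases hab : a ∈ T ∧ b ∈ S
      · have h1 := hQ a hab.1 b hab.2
        have h2 := hQ' a hab.1 b hab.2
        rw [h1, h2] at h
        refine ⟨h1.trans h2.symm, ?_⟩
        simpa using h
      · have h1 : (a, b) ∉ X := fun hx => hab (Finset.mem_product.1 (hX hx))
        have h2 : (a, b) ∉ X' := fun hx => hab (Finset.mem_product.1 (hX' hx))
        simpa [h1, h2] using h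
    refine Prod.ext (funext fun a => funext fun b => (hmem a b).1) (Finset.ext ?_)
    rintro ⟨a, b⟩
    exact (hmem a b).2

/-- A graph that is not diverse contains a complete bipartite subgraph with parts of sizes
`⌈k⌉₊` and `⌈l⌉₊`. -/
theorem exists_complete_of_not_diverse {n m : ℕ} {P' : Fin n → Fin m → Bool} {k l : ℝ}
    (h : ¬ Diverse P' k l) :
    ∃ T ∈ Finset.powersetCard ⌈k⌉₊ (Finset.univ : Finset (Fin n)),
      ∃ S ∈ Finset.powersetCard ⌈l⌉₊ (Finset.univ : Finset (Fin m)),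
        ∀ a ∈ T, ∀ b ∈ S, P' a b = true := by
  unfold Diverse at h
  push Not at h
  obtain ⟨S, hS, hT⟩ := h
  obtain ⟨T', hT', hTc⟩ := Finset.exists_subset_card_eq (Nat.ceil_le.2 hT)
  obtain ⟨S', hS', hSc⟩ := Finset.exists_subset_card_eq (Nat.ceil_le.2 hS)
  refine ⟨T', by simp [Finset.mem_powersetCard, hTc], S',
    by simp [Finset.mem_powersetCard, hSc], fun a ha b hb => ?_⟩
  exact (Finset.mem_filter.1 (hT' ha)).2 b (hS' hb)

/-- Union bound for the number of non-diverse subgraphs. -/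
theorem card_not_diverse_mul_le {n m : ℕ} (P : Fin n → Fin m → Bool) (k l : ℝ) :
    (Finset.univ.filter fun P' : Fin n → Fin m → Bool =>
        (∀ a b, P' a b = true → P a b = true) ∧ ¬ Diverse P' k l).card *
        2 ^ (⌈k⌉₊ * ⌈l⌉₊) ≤
      n ^ ⌈k⌉₊ * m ^ ⌈l⌉₊ *
      (Finset.univ.filter fun P' : Fin n → Fin m → Bool =>
        ∀ a b, P' a b = true → P a b = true).card := by
  set N := (Finset.univ.filter fun P' : Fin n → Fin m → Bool =>
        ∀ a b, P' a b = true → P a b = true).card with hN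
  set I := Finset.powersetCard ⌈k⌉₊ (Finset.univ : Finset (Fin n)) ×ˢ
    Finset.powersetCard ⌈l⌉₊ (Finset.univ : Finset (Fin m)) with hI
  let F : Finset (Fin n) × Finset (Fin m) → Finset (Fin n → Fin m → Bool) := fun q =>
    Finset.univ.filter fun P' =>
      (∀ a b, P' a b = true → P a b = true) ∧ ∀ a ∈ q.1, ∀ b ∈ q.2, P' a b = true
  have hsub : (Finset.univ.filter fun P' : Fin n → Fin m → Bool =>
        (∀ a b, P' a b = true → P a b = true) ∧ ¬ Diverse P' k l) ⊆ I.biUnion F := by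
    intro P' hP'
    obtain ⟨-, hle, hnd⟩ := Finset.mem_filter.1 hP'
    obtain ⟨T, hT, S, hS, hTS⟩ := exists_complete_of_not_diverse hnd
    exact Finset.mem_biUnion.2 ⟨(T, S), Finset.mem_product.2 ⟨hT, hS⟩,
      Finset.mem_filter.2 ⟨Finset.mem_univ _, hle, hTS⟩⟩
  have hIc : I.card ≤ n ^ ⌈k⌉₊ * m ^ ⌈l⌉₊ := by
    rw [hI, Finset.card_product, Finset.card_powersetCard, Finset.card_powersetCard,
      Finset.card_univ, Finset.card_univ, Fintype.card_fin, Fintype.card_fin]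
    exact Nat.mul_le_mul (Nat.choose_le_pow _ _) (Nat.choose_le_pow _ _)
  calc _ ≤ (∑ q ∈ I, (F q).card) * 2 ^ (⌈k⌉₊ * ⌈l⌉₊) :=
        Nat.mul_le_mul_right _ ((Finset.card_le_card hsub).trans Finset.card_biUnion_le)
    _ = ∑ q ∈ I, (F q).card * 2 ^ (⌈k⌉₊ * ⌈l⌉₊) := Finset.sum_mul _ _ _
    _ ≤ ∑ q ∈ I, N := by
        refine Finset.sum_le_sum fun q hq => ?_
        obtain ⟨h1, h2⟩ := Finset.mem_product.1 hq
        rw [← (Finset.mem_powersetCard.1 h1).2, ← (Finset.mem_powersetCard.1 h2).2]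
        refine (le_of_eq ?_).trans ((card_subgraphs_complete_mul_le P q.1 q.2).trans (le_of_eq ?_))
        · congr!
        · rw [hN]
          congr!
    _ = I.card * N := by rw [Finset.sum_const, smul_eq_mul]
    _ ≤ _ := Nat.mul_le_mul_right _ hIc

theorem exponent_bound {c d L x y : ℝ} (hc : 4 ≤ c) (hd : 4 ≤ d) (hL : 0 ≤ L)
    (hx : c * L ≤ x) (hy : d * L ≤ y) :
    L * (x + y) ≤ -(c * d / 2) * L * L + x * y := by
  have h1 : (c - 1) * L * ((d - 1) * L) ≤ (x - L) * (y - L) :=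
    mul_le_mul (by linarith) (by linarith) (mul_nonneg (by linarith) hL)
      (by nlinarith)
  have h2 : 0 ≤ (c * d / 2 - c - d) * (L * L) :=
    mul_nonneg (by nlinarith) (mul_nonneg hL hL)
  nlinarith

/-- Let `c, d ≥ 4` and let `n` be sufficiently large.  For any bipartite graph `P` between
`A` and `B` with `|A| = n`, `|B| = m ≤ n`, delete each edge independently with probability
`1/2` (equivalently, pick a uniformly random subgraph `P' ≤ P`).  Then the probability that
the resulting graph is `(c·log₂ n, d·log₂ n)`-diverse is at least
`1 − n^{−(cd/2)·log₂ n}`. -/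
theorem stmt5 (c d : ℕ) (hc : 4 ≤ c) (hd : 4 ≤ d) :
    ∀ᶠ n : ℕ in Filter.atTop, ∀ m : ℕ, m ≤ n →
      ∀ P : Fin n → Fin m → Bool,
        1 - (n : ℝ) ^ (-(((c : ℝ) * d) / 2) * Real.logb 2 n) ≤
          (((Finset.univ.filter fun P' : Fin n → Fin m → Bool =>
                (∀ a b, P' a b = true → P a b = true) ∧
                Diverse P' ((c : ℝ) * Real.logb 2 n) ((d : ℝ) * Real.logb 2 n)).card : ℝ) /
            ((Finset.univ.filter fun P' : Fin n → Fin m → Bool =>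
                ∀ a b, P' a b = true → P a b = true).card : ℝ)) := by
  filter_upwards [Filter.eventually_ge_atTop 1] with n hn m hm P
  set L := Real.logb 2 n with hL
  have hn1 : (1 : ℝ) ≤ n := by exact_mod_cast hn
  have hn0 : (0 : ℝ) < n := by linarith
  have hL0 : 0 ≤ L := Real.logb_nonneg one_lt_two hn1
  have hnL : (n : ℝ) = 2 ^ L := (Real.rpow_logb two_pos (by norm_num) hn0).symm
  set N := (Finset.univ.filter fun P' : Fin n → Fin m → Bool =>
    ∀ a b, P' a b = true → P a b = true).card with hN
  have hNpos : (0 : ℝ) < N := by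
    exact_mod_cast Finset.card_pos.2 ⟨P, by simp⟩
  have hsplit : (Finset.univ.filter fun P' : Fin n → Fin m → Bool =>
        (∀ a b, P' a b = true → P a b = true) ∧ Diverse P' (c * L) (d * L)).card +
      (Finset.univ.filter fun P' : Fin n → Fin m → Bool =>
        (∀ a b, P' a b = true → P a b = true) ∧ ¬ Diverse P' (c * L) (d * L)).card = N := by
    rw [hN, ← Finset.filter_filter, ← Finset.filter_filter]
    exact Finset.card_filter_add_card_filter_not _
  have hbad := card_not_diverse_mul_le P (c * L) (d * L)
  rw [← hN] at hbad
  set bad := (Finset.univ.filter fun P' : Fin n → Fin m → Bool =>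
    (∀ a b, P' a b = true → P a b = true) ∧ ¬ Diverse P' (c * L) (d * L)).card
  have hx := Nat.le_ceil ((c : ℝ) * L)
  have hy := Nat.le_ceil ((d : ℝ) * L)
  set x := ⌈(c : ℝ) * L⌉₊
  set y := ⌈(d : ℝ) * L⌉₊
  have hpow : (n : ℝ) ^ x * (n : ℝ) ^ y ≤
      (n : ℝ) ^ (-(((c : ℝ) * d) / 2) * L) * 2 ^ (x * y) := by
    have h2 : ((2 : ℝ) ^ (x * y)) = 2 ^ ((x : ℝ) * y) := by
      rw [← Nat.cast_mul, Real.rpow_natCast]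
    rw [← pow_add, ← Real.rpow_natCast, h2, hnL, ← Real.rpow_mul two_pos.le,
      ← Real.rpow_mul two_pos.le, ← Real.rpow_add two_pos]
    refine Real.rpow_le_rpow_of_exponent_le one_le_two ?_
    have := exponent_bound (c := c) (d := d) (by exact_mod_cast hc) (by exact_mod_cast hd)
      hL0 hx hy
    push_cast
    linarith
  have hbadR : (bad : ℝ) * 2 ^ (x * y) ≤ (n : ℝ) ^ x * (m : ℝ) ^ y * N := by
    exact_mod_cast hbad
  have hmy : (m : ℝ) ^ y ≤ (n : ℝ) ^ y :=
    pow_le_pow_left₀ (Nat.cast_nonneg _) (by exact_mod_cast hm) _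
  have hfin : (bad : ℝ) ≤ (n : ℝ) ^ (-(((c : ℝ) * d) / 2) * L) * N := by
    refine le_of_mul_le_mul_right ?_ (pow_pos two_pos (x * y) : (0 : ℝ) < 2 ^ (x * y))
    calc (bad : ℝ) * 2 ^ (x * y) ≤ (n : ℝ) ^ x * (m : ℝ) ^ y * N := hbadR
      _ ≤ (n : ℝ) ^ x * (n : ℝ) ^ y * N :=
        mul_le_mul_of_nonneg_right
          (mul_le_mul_of_nonneg_left hmy (pow_nonneg hn0.le _)) hNpos.le
      _ ≤ (n : ℝ) ^ (-(((c : ℝ) * d) / 2) * L) * 2 ^ (x * y) * N :=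
        mul_le_mul_of_nonneg_right hpow hNpos.le
      _ = _ := by ring
  rw [le_div_iff₀ hNpos]
  have hsplitR := congrArg (Nat.cast : ℕ → ℝ) hsplit
  push_cast at hsplitR
  linarith
end

section
/- Let c, d ≥ 4 be integers and n a sufficiently large integer. Let G be a tripartite graph with parts A, B, C where |A| = |C| = n and |B| ≤ n, with matrices P ∈ {0,1}^{A×B} and Q ∈ {0,1}^{B×C}, and let K be any subinterval of C. Let G̃ be the random graph obtained from G by deleting each A–B edge independently with probability 1/2 (keeping all B–C edges). Then the probability that G̃ is (c·log₂ n, d·log₂ n)-unhelpful on K is at least 1 − n^{−(cd/2)·log₂ n}. -/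
open scoped Classical

/-- The middle vertices, for `a`, of the vertices of `K` that are unique for `a` and lie in the
support of `rowOr Q S`. -/
noncomputable def middleSet {nA nB nC : ℕ} (P : Fin nA → Fin nB → Bool)
    (Q : Fin nB → Fin nC → Bool) (a : Fin nA) (K : Finset (Fin nC)) (S : Finset (Fin nB)) :
    Finset (Fin nB) :=
  Finset.univ.filter fun b => P a b = true ∧
    ∃ c ∈ K, UniqueFor P Q a c ∧ Q b c = true ∧ rowOr Q S c = true

lemma rowOr_eq_true_iff {nB nC : ℕ} (Q : Fin nB → Fin nC → Bool) (S : Finset (Fin nB))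
    (c : Fin nC) : rowOr Q S c = true ↔ ∃ b ∈ S, Q b c = true := by
  unfold rowOr
  induction S using Finset.induction_on with
  | empty => simp
  | insert a s _ ih => simp [Finset.sup_insert, ih]

/-- If `S` is helpful for `a`, then the set witnessing this is `middleSet P Q a K S`. -/
lemma Helpful.middleSet_spec {nA nB nC : ℕ} {P P' : Fin nA → Fin nB → Bool}
    {Q : Fin nB → Fin nC → Bool} {a : Fin nA} {K : Finset (Fin nC)} {S : Finset (Fin nB)}
    (h : Helpful P P' Q a K S) :
    S.card ≤ (middleSet P Q a K S).card ∧ ∀ b ∈ middleSet P Q a K S, P' a b = true := by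
  obtain ⟨S', hS', hcard, heq⟩ := h
  have key : ∀ c ∈ K, UniqueFor P Q a c → (rowOr Q S c = true ↔ rowOr Q S' c = true) := by
    intro c hcK hcu
    have := Finset.ext_iff.1 heq c
    simpa [uniqueSet, hcK, hcu] using this
  constructor
  · refine hcard.trans (Finset.card_le_card fun b hb => ?_)
    obtain ⟨-, c, hcK, hcu, hPab, hQbc⟩ := (Finset.mem_filter.1 (hS' hb)).2
    exact Finset.mem_filter.2 ⟨Finset.mem_univ _, hPab, c, hcK, hcu, hQbc,
      (key c hcK hcu).2 ((rowOr_eq_true_iff Q S' c).2 ⟨b, hb, hQbc⟩)⟩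
  · intro b hb
    obtain ⟨hPab, c, hcK, hcu, hQbc, hrow⟩ := (Finset.mem_filter.1 hb).2
    obtain ⟨b', hb', hQ'⟩ := (rowOr_eq_true_iff Q S' c).1 ((key c hcK hcu).1 hrow)
    obtain ⟨hP', _, _, _, hPab', _⟩ := (Finset.mem_filter.1 (hS' hb')).2
    rwa [hcu.unique ⟨hPab, hQbc⟩ ⟨hPab', hQ'⟩]

/-- Among the subgraphs of `P`, those containing a given edge set `E` make up a fraction of
at most `2 ^ (-|E|)`. -/
lemma card_subgraphs_containing_mul_le {nA nB : ℕ} (P : Fin nA → Fin nB → Bool)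
    (E : Finset (Fin nA × Fin nB)) :
    (Finset.univ.filter fun P' : Fin nA → Fin nB → Bool =>
      (∀ a b, P' a b = true → P a b = true) ∧ ∀ e ∈ E, P' e.1 e.2 = true).card * 2 ^ E.card ≤
    (Finset.univ.filter fun P' : Fin nA → Fin nB → Bool =>
      ∀ a b, P' a b = true → P a b = true).card := by
  rw [← Finset.card_powerset, ← Finset.card_product]
  refine Finset.card_le_card_of_injOn
    (fun x => fun a b => if (a, b) ∈ x.2 then false else x.1 a b) ?_ ?_
  · rintro ⟨R, F⟩ h
    simp only [Finset.coe_product, Set.mem_prod, Finset.mem_coe, Finset.mem_filter,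
      Finset.mem_univ, true_and, Finset.mem_powerset] at h ⊢
    intro a b hab
    by_cases hF : (a, b) ∈ F
    · simp [hF] at hab
    · exact h.1.1 a b (by simpa [hF] using hab)
  · rintro ⟨R, F⟩ h ⟨R', F'⟩ h' heq
    simp only [Finset.coe_product, Set.mem_prod, Finset.mem_coe, Finset.mem_filter,
      Finset.mem_univ, true_and, Finset.mem_powerset] at h h'
    have hval : ∀ a b, (if (a, b) ∈ F then false else R a b) =
        (if (a, b) ∈ F' then false else R' a b) := fun a b => congrFun (congrFun heq a) b
    have hF : F = F' := by
      ext ⟨a, b⟩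
      have hv := hval a b
      constructor
      · intro hm
        by_contra hm'
        have := h'.1.2 _ (h.2 hm)
        simp_all
      · intro hm
        by_contra hm'
        have := h.1.2 _ (h'.2 hm)
        simp_all
    subst hF
    refine Prod.ext (funext fun a => funext fun b => ?_) rfl
    by_cases hm : (a, b) ∈ F
    · exact (h.1.2 _ (h.2 hm)).trans (h'.1.2 _ (h.2 hm)).symm
    · simpa [hm] using hval a b

lemma card_subgraphs_helpful_mul_le {nA nB nC : ℕ} (P : Fin nA → Fin nB → Bool)
    (Q : Fin nB → Fin nC → Bool) (K : Finset (Fin nC)) (S : Finset (Fin nB))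
    (T : Finset (Fin nA)) :
    (Finset.univ.filter fun P' : Fin nA → Fin nB → Bool =>
      (∀ a b, P' a b = true → P a b = true) ∧ ∀ a ∈ T, Helpful P P' Q a K S).card *
        2 ^ (T.card * S.card) ≤
    (Finset.univ.filter fun P' : Fin nA → Fin nB → Bool =>
      ∀ a b, P' a b = true → P a b = true).card := by
  by_cases hM : ∀ a ∈ T, S.card ≤ (middleSet P Q a K S).card
  · let E : Finset (Fin nA × Fin nB) :=
      Finset.univ.filter fun e => e.1 ∈ T ∧ e.2 ∈ middleSet P Q e.1 K S
    have hEcard : T.card * S.card ≤ E.card := by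
      have hE : E.card = ∑ a ∈ T, (middleSet P Q a K S).card := by
        rw [← Finset.card_sigma]
        refine Finset.card_bij' (fun e _ => ⟨e.1, e.2⟩) (fun e _ => (e.1, e.2)) ?_ ?_ ?_ ?_ <;>
          simp [E]
      rw [hE, ← smul_eq_mul]
      exact Finset.card_nsmul_le_sum _ _ _ hM
    refine le_trans (Nat.mul_le_mul (Finset.card_le_card fun P' hP' => ?_) (Nat.pow_le_pow_right two_pos hEcard))
      (card_subgraphs_containing_mul_le P E)
    simp only [Finset.mem_filter, Finset.mem_univ, true_and] at hP' ⊢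
    refine ⟨hP'.1, fun e he => ?_⟩
    have he' := (Finset.mem_filter.1 he).2
    exact (hP'.2 _ he'.1).middleSet_spec.2 _ he'.2
  · rw [Finset.filter_false_of_mem, Finset.card_empty, zero_mul]
    · exact Nat.zero_le _
    · intro P' _ h
      exact hM fun a ha => (h.2 a ha).middleSet_spec.1

/-- Union bound over the sets `S` of size at least `l` and the `k`-element sets of vertices for
which `S` is helpful. -/
lemma card_not_unhelpful_le {nA nB nC : ℕ} (P : Fin nA → Fin nB → Bool)
    (Q : Fin nB → Fin nC → Bool) (K : Finset (Fin nC)) (r l : ℝ) (k : ℕ)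
    (hk : ∀ m : ℕ, r < m → k ≤ m) :
    ((Finset.univ.filter fun P' : Fin nA → Fin nB → Bool =>
      (∀ a b, P' a b = true → P a b = true) ∧ ¬ Unhelpful P P' Q K r l).card : ℝ) ≤
    (∑ m ∈ Finset.range (nB + 1), (nB.choose m : ℝ) *
      (if l ≤ m then ((1 / 2 : ℝ) ^ k) ^ m else 0)) * (nA.choose k : ℝ) *
    ((Finset.univ.filter fun P' : Fin nA → Fin nB → Bool =>
      ∀ a b, P' a b = true → P a b = true).card : ℝ) := by
  set N : ℝ := ((Finset.univ.filter fun P' : Fin nA → Fin nB → Bool =>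
      ∀ a b, P' a b = true → P a b = true).card : ℝ) with hN
  let H : Finset (Fin nB) → Finset (Fin nA) → Finset (Fin nA → Fin nB → Bool) := fun S T =>
    Finset.univ.filter fun P' =>
      (∀ a b, P' a b = true → P a b = true) ∧ ∀ a ∈ T, Helpful P P' Q a K S
  have hH : ∀ S T, T.card = k → ((H S T).card : ℝ) ≤ ((1 / 2 : ℝ) ^ k) ^ S.card * N := by
    intro S T hT
    have h : ((H S T).card : ℝ) * 2 ^ (k * S.card) ≤ N := by
      have h' := card_subgraphs_helpful_mul_le P Q K S T
      rw [hT] at h'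
      have h'' := (Nat.cast_le (α := ℝ)).2 h'
      rw [Nat.cast_mul, Nat.cast_pow, Nat.cast_ofNat] at h''
      exact h''
    rw [← pow_mul, one_div, inv_pow, inv_mul_eq_div, le_div_iff₀ (by positivity)]
    exact h
  have hsub : (Finset.univ.filter fun P' : Fin nA → Fin nB → Bool =>
      (∀ a b, P' a b = true → P a b = true) ∧ ¬ Unhelpful P P' Q K r l) ⊆
      (Finset.univ.filter fun S : Finset (Fin nB) => l ≤ S.card).biUnion fun S =>
        (Finset.powersetCard k Finset.univ).biUnion fun T => H S T := by
    intro P' hP'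
    obtain ⟨hle, hun⟩ := (Finset.mem_filter.1 hP').2
    unfold Unhelpful at hun
    push Not at hun
    obtain ⟨S, hS, hcard⟩ := hun
    obtain ⟨T, hT, hTk⟩ := Finset.exists_subset_card_eq (hk _ hcard)
    simp only [Finset.mem_biUnion, Finset.mem_filter, Finset.mem_univ, true_and,
      Finset.mem_powersetCard, Finset.subset_univ, H]
    exact ⟨S, hS, T, hTk, hle, fun a ha => (Finset.mem_filter.1 (hT ha)).2⟩
  have hinner : ∀ S : Finset (Fin nB),
      (((Finset.powersetCard k Finset.univ).biUnion fun T => H S T).card : ℝ) ≤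
        (nA.choose k : ℝ) * (((1 / 2 : ℝ) ^ k) ^ S.card * N) := by
    intro S
    calc (((Finset.powersetCard k Finset.univ).biUnion fun T => H S T).card : ℝ)
        ≤ ∑ T ∈ Finset.powersetCard k Finset.univ, ((H S T).card : ℝ) := by
          exact_mod_cast Finset.card_biUnion_le
      _ ≤ (Finset.powersetCard k (Finset.univ : Finset (Fin nA))).card •
            (((1 / 2 : ℝ) ^ k) ^ S.card * N) :=
          Finset.sum_le_card_nsmul _ _ _ fun T hT => hH S T (Finset.mem_powersetCard.1 hT).2
      _ = _ := by simp [Finset.card_powersetCard]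
  calc _ ≤ (((Finset.univ.filter fun S : Finset (Fin nB) => l ≤ S.card).biUnion fun S =>
        (Finset.powersetCard k Finset.univ).biUnion fun T => H S T).card : ℝ) := by
        exact_mod_cast Finset.card_le_card hsub
    _ ≤ ∑ S ∈ Finset.univ.filter fun S : Finset (Fin nB) => l ≤ S.card,
        (((Finset.powersetCard k Finset.univ).biUnion fun T => H S T).card : ℝ) := by
        exact_mod_cast Finset.card_biUnion_le
    _ ≤ ∑ S ∈ Finset.univ.filter fun S : Finset (Fin nB) => l ≤ S.card,
        (nA.choose k : ℝ) * (((1 / 2 : ℝ) ^ k) ^ S.card * N) :=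
        Finset.sum_le_sum fun S _ => hinner S
    _ = (∑ S ∈ (Finset.univ : Finset (Fin nB)).powerset,
          (if l ≤ S.card then ((1 / 2 : ℝ) ^ k) ^ S.card else 0)) * (nA.choose k : ℝ) * N := by
        rw [Finset.powerset_univ, ← Finset.sum_filter, Finset.sum_mul, Finset.sum_mul]
        exact Finset.sum_congr rfl fun S _ => by ring
    _ = _ := by
        rw [Finset.sum_powerset_apply_card
          (fun m : ℕ => if l ≤ m then ((1 / 2 : ℝ) ^ k) ^ m else 0)]
        simp only [Finset.card_univ, Fintype.card_fin, nsmul_eq_mul]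

lemma sum_choose_mul_le {n nB k : ℕ} (hnB : nB ≤ n) (hn : 0 < n) {l : ℝ}
    (hx : (n : ℝ) * (1 / 2) ^ k ≤ 1) :
    ∑ m ∈ Finset.range (nB + 1), (nB.choose m : ℝ) *
      (if l ≤ m then ((1 / 2 : ℝ) ^ k) ^ m else 0) ≤
    (n + 1) * ((n : ℝ) * (1 / 2) ^ k) ^ l := by
  have hx0 : 0 < (n : ℝ) * (1 / 2) ^ k := by positivity
  have hterm : ∀ m ∈ Finset.range (nB + 1), (nB.choose m : ℝ) *
      (if l ≤ m then ((1 / 2 : ℝ) ^ k) ^ m else 0) ≤ ((n : ℝ) * (1 / 2) ^ k) ^ l := by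
    intro m _
    split_ifs with h
    · calc (nB.choose m : ℝ) * ((1 / 2 : ℝ) ^ k) ^ m
          ≤ (n : ℝ) ^ m * ((1 / 2 : ℝ) ^ k) ^ m := by
            gcongr
            exact_mod_cast (Nat.choose_le_pow nB m).trans (Nat.pow_le_pow_left hnB m)
        _ = ((n : ℝ) * (1 / 2) ^ k) ^ (m : ℝ) := by rw [Real.rpow_natCast, mul_pow]
        _ ≤ _ := Real.rpow_le_rpow_of_exponent_ge hx0 hx h
    · rw [mul_zero]; positivity
  refine (Finset.sum_le_card_nsmul _ _ _ hterm).trans ?_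
  rw [Finset.card_range, nsmul_eq_mul]
  gcongr
  exact_mod_cast Nat.succ_le_succ hnB

lemma union_bound_le {c d : ℕ} (hc : 4 ≤ c) (hd : 4 ≤ d) {n k : ℕ} (hn : 2 ≤ n)
    (hk : (c : ℝ) * Real.logb 2 n < k) :
    (n + 1) * ((n : ℝ) * (1 / 2) ^ k) ^ ((d : ℝ) * Real.logb 2 n) * (n.choose k : ℝ) ≤
      (n : ℝ) ^ (-(((c : ℝ) * d) / 2) * Real.logb 2 n) := by
  have hn0 : (0 : ℝ) < n := by positivity
  have hn2 : (2 : ℝ) ≤ n := by exact_mod_cast hn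
  have hc' : (4 : ℝ) ≤ c := by exact_mod_cast hc
  have hd' : (4 : ℝ) ≤ d := by exact_mod_cast hd
  set L := Real.logb 2 n with hL
  have hnL : (n : ℝ) = 2 ^ L := (Real.rpow_logb two_pos (by norm_num) hn0).symm
  have hL1 : 1 ≤ L := by
    rw [hL, Real.le_logb_iff_rpow_le (by norm_num) hn0]
    simpa using hn2
  have hfact : ((n : ℝ) + 1) ≤ (k.factorial : ℝ) := by
    have h1 : (n : ℝ) ^ 4 ≤ 2 ^ k := by
      rw [hnL, ← Real.rpow_mul_natCast two_pos.le, ← Real.rpow_natCast 2 k]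
      refine Real.rpow_le_rpow_of_exponent_le (by norm_num) ?_
      push_cast
      nlinarith
    have hk0 : k ≠ 0 := by
      rintro rfl
      norm_num at hk
      nlinarith
    obtain ⟨j, rfl⟩ := Nat.exists_eq_succ_of_ne_zero hk0
    have h2 : (2 : ℝ) ^ j ≤ ((j + 1).factorial : ℝ) := by
      have h := Nat.factorial_mul_pow_le_factorial (m := 1) (n := j)
      rw [Nat.factorial_one, one_mul, add_comm 1 j] at h
      exact_mod_cast h
    have h3 : (n : ℝ) ^ 4 ≤ 2 * 2 ^ j := by rw [← pow_succ']; exact h1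
    nlinarith [mul_le_mul hn2 hn2 (by norm_num) hn0.le, sq_nonneg ((n : ℝ) ^ 2 - 4)]
  have hchoose : ((n : ℝ) + 1) * (n.choose k : ℝ) ≤ (n : ℝ) ^ k := by
    have h := Nat.choose_le_pow_div (α := ℝ) k n
    rw [le_div_iff₀ (by positivity)] at h
    calc ((n : ℝ) + 1) * (n.choose k : ℝ) ≤ k.factorial * n.choose k := by gcongr
      _ ≤ _ := by rw [mul_comm]; exact h
  have hx : (n : ℝ) * (1 / 2) ^ k = 2 ^ (L - k) := by
    rw [Real.rpow_sub two_pos, ← hnL, Real.rpow_natCast, one_div, inv_pow, div_eq_mul_inv]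
  have hpow : (n : ℝ) ^ k = 2 ^ (L * k) := by
    rw [hnL, ← Real.rpow_mul_natCast two_pos.le]
  calc _ = (((n : ℝ) + 1) * (n.choose k : ℝ)) * ((n : ℝ) * (1 / 2) ^ k) ^ ((d : ℝ) * L) := by ring
    _ ≤ (n : ℝ) ^ k * ((n : ℝ) * (1 / 2) ^ k) ^ ((d : ℝ) * L) := by gcongr
    _ = 2 ^ (L * k + (L - k) * (d * L)) := by
        rw [hx, hpow, ← Real.rpow_mul two_pos.le, ← Real.rpow_add two_pos]
    _ ≤ 2 ^ (L * (-(((c : ℝ) * d) / 2) * L)) := by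
        refine Real.rpow_le_rpow_of_exponent_le (by norm_num) ?_
        have h1 : (d - 1) * L * (c * L) ≤ (d - 1) * L * k :=
          mul_le_mul_of_nonneg_left hk.le (by nlinarith)
        have h2 : 0 ≤ L ^ 2 * ((c - 4) * (d - 4) + 2 * (c - 4) + 2 * (d - 4) : ℝ) := by
          have h3 := sub_nonneg.2 hc'
          have h4 := sub_nonneg.2 hd'
          positivity
        nlinarith
    _ = _ := by
        rw [Real.rpow_mul two_pos.le, ← hnL]

/-- Let `c, d ≥ 4` and `n` sufficiently large.  Let `G` be a tripartite graph with parts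
`A, B, C`, `|A| = |C| = n`, `|B| ≤ n`, with matrices `P, Q`, and let `K` be any subinterval
of `C`.  Deleting each `A–B` edge independently with probability `1/2` (i.e., picking a
uniformly random `P' ≤ P`), the probability that the resulting graph is
`(c·log₂ n, d·log₂ n)`-unhelpful on `K` is at least `1 − n^{−(cd/2)·log₂ n}`. -/
theorem stmt6 (c d : ℕ) (hc : 4 ≤ c) (hd : 4 ≤ d) :
    ∀ᶠ n : ℕ in Filter.atTop, ∀ nB : ℕ, nB ≤ n →
      ∀ (P : Fin n → Fin nB → Bool) (Q : Fin nB → Fin n → Bool) (K : Finset (Fin n)),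
        (∃ i j : Fin n, i ≤ j ∧ K = Finset.Icc i j) →
        1 - (n : ℝ) ^ (-(((c : ℝ) * d) / 2) * Real.logb 2 n) ≤
          (((Finset.univ.filter fun P' : Fin n → Fin nB → Bool =>
                (∀ a b, P' a b = true → P a b = true) ∧
                Unhelpful P P' Q K ((c : ℝ) * Real.logb 2 n)
                  ((d : ℝ) * Real.logb 2 n)).card : ℝ) /
            ((Finset.univ.filter fun P' : Fin n → Fin nB → Bool =>
                ∀ a b, P' a b = true → P a b = true).card : ℝ)) := by
  filter_upwards [Filter.eventually_ge_atTop 2] with n hn nB hnB P Q K _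
  set L := Real.logb 2 (n : ℝ) with hL
  set k := ⌊(c : ℝ) * L⌋₊ + 1 with hk
  have hkL : (c : ℝ) * L < k := by
    rw [hk]; push_cast; exact Nat.lt_floor_add_one _
  have hn0 : (0 : ℝ) < n := by positivity
  have hL0 : 0 ≤ L := Real.logb_nonneg (by norm_num) (by exact_mod_cast (by omega : 1 ≤ n))
  have hx : (n : ℝ) * (1 / 2) ^ k ≤ 1 := by
    have h : (n : ℝ) ≤ 2 ^ k := by
      rw [← Real.rpow_natCast, ← Real.logb_le_iff_le_rpow (by norm_num) hn0]
      have hc' : (4 : ℝ) ≤ c := by exact_mod_cast hc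
      nlinarith
    rw [one_div, inv_pow, ← div_eq_mul_inv, div_le_one (by positivity)]
    exact h
  have hbad := card_not_unhelpful_le P Q K ((c : ℝ) * L) ((d : ℝ) * L) k fun m hm =>
    Nat.succ_le_of_lt ((Nat.floor_lt (by positivity)).2 hm)
  have hbound := (mul_le_mul_of_nonneg_right
    (sum_choose_mul_le (l := (d : ℝ) * L) hnB (by omega) hx)
    (Nat.cast_nonneg (α := ℝ) (n.choose k))).trans (union_bound_le hc hd hn hkL)
  have hsplit := Finset.card_filter_add_card_filter_not
    (s := Finset.univ.filter fun P' : Fin n → Fin nB → Bool =>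
      ∀ a b, P' a b = true → P a b = true)
    (fun P' => Unhelpful P P' Q K ((c : ℝ) * L) ((d : ℝ) * L))
  rw [Finset.filter_filter, Finset.filter_filter] at hsplit
  have hpos : 0 < (Finset.univ.filter fun P' : Fin n → Fin nB → Bool =>
      ∀ a b, P' a b = true → P a b = true).card :=
    Finset.card_pos.2 ⟨P, by simp⟩
  have hpos' := (Nat.cast_pos (α := ℝ)).2 hpos
  have hsplit' := congrArg (Nat.cast (R := ℝ)) hsplit
  push_cast at hsplit'
  rw [le_div_iff₀ hpos']
  have := hbad.trans (mul_le_mul_of_nonneg_right hbound hpos'.le)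
  linarith
end

section
/- There is a constant c > 0 such that for all sufficiently large integers n there exist Boolean matrices P ∈ {0,1}^{n × ⌊n/3⌋} and Q ∈ {0,1}^{⌊n/3⌋ × n} such that every correct witness for the Boolean matrix product P × Q has cost at least n^{7/3} / 2^{c·√(log₂ n)}. -/
open scoped Classical

/-- The value carried by a gate, as a bit string of length `ln g`: the restriction of
`row(Q_{wset g})` to the subinterval of columns starting at `st g`. -/
noncomputable def gval {nB nC : ℕ} (Q : Fin nB → Fin nC → Bool) (W : WitnessCircuit nB)
    (g : Fin W.N) : (k : ℕ) × (Fin k → Bool) :=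
  ⟨W.ln g, fun t =>
    if h : W.st g + t.val < nC then (W.wset g).sup fun b => Q b ⟨W.st g + t.val, h⟩
    else false⟩

/-- The row-class of a union gate with inputs `(S_L,K,v_L)`, `(S_R,K,v_R)` and output
`(S,K,v)` is `{v, v_L, v_R}`; non-union gates get the empty class. -/
noncomputable def uClass {nB nC : ℕ} (Q : Fin nB → Fin nC → Bool) (W : WitnessCircuit nB)
    (g : Fin W.N) : Finset ((k : ℕ) × (Fin k → Bool)) :=
  match W.kind g with
  | Gk.union x y => {gval Q W g, gval Q W x, gval Q W y}
  | _ => ∅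

/-- The number of ones of a bit string. -/
def sweight : (k : ℕ) × (Fin k → Bool) → ℕ :=
  fun p => (Finset.univ.filter fun t => p.2 t = true).card

/-- The cost of a witness circuit: its number of gates plus the sum, over all distinct
row-classes `{u,v,z}` of its union gates, of `min(|u|,|v|,|z|)`. -/
noncomputable def wCost {nB nC : ℕ} (Q : Fin nB → Fin nC → Bool)
    (W : WitnessCircuit nB) : ℝ :=
  (W.N : ℝ) +
    ∑ T ∈ (Finset.univ.filter fun g : Fin W.N =>
        ∃ x y : Fin W.N, W.kind g = Gk.union x y).image (uClass Q W),
      ((sInf (sweight '' (T : Set ((k : ℕ) × (Fin k → Bool)))) : ℕ) : ℝ)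

namespace WitnessCircuit

variable {nB nC : ℕ} {W : WitnessCircuit nB}

/-- The gate is not a concatenation gate. -/
def NonConcat (W : WitnessCircuit nB) (g : Fin W.N) : Prop :=
  ∀ x y, W.kind g ≠ Gk.concat x y

/-- The gate is a union gate. -/
def IsUnion (W : WitnessCircuit nB) (g : Fin W.N) : Prop :=
  ∃ x y, W.kind g = Gk.union x y

lemma lt_of_union {g x y : Fin W.N} (h : W.kind g = Gk.union x y) : x < g ∧ y < g := by
  constructor <;> apply W.hacyc g <;> simp [h, Gk.preds]

lemma lt_of_concat {g x y : Fin W.N} (h : W.kind g = Gk.concat x y) : x < g ∧ y < g := by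
  constructor <;> apply W.hacyc g <;> simp [h, Gk.preds]

lemma Defined.union_eq (hD : W.Defined nC) {g x y : Fin W.N} (h : W.kind g = Gk.union x y) :
    W.st x = W.st g ∧ W.st y = W.st g ∧ W.ln x = W.ln g ∧ W.ln y = W.ln g ∧
      W.wset g = W.wset x ∪ W.wset y := by
  have := hD.2 g
  rw [h] at this
  obtain ⟨h1, h2, h3, h4, h5⟩ := this
  exact ⟨h4.symm, by omega, h5.symm, by omega, h3⟩

lemma Structured.union_nonConcat (hS : W.Structured) {g x y : Fin W.N}
    (h : W.kind g = Gk.union x y) : W.NonConcat x ∧ W.NonConcat y := by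
  have := hS g
  rw [h] at this
  exact ⟨fun a b => (this a b).1, fun a b => (this a b).2⟩

lemma wset_nonempty (hD : W.Defined nC) (g : Fin W.N) : (W.wset g).Nonempty := by
  induction g using WellFoundedLT.induction with
  | ind g ih =>
    have h := hD.2 g
    have hlt := W.hacyc g
    cases hk : W.kind g with
    | input b => rw [hk] at h; simp [h.1]
    | partition p s l =>
      rw [hk] at h hlt; rw [h.2.2.2.1]; exact ih _ (hlt _ (by simp [Gk.preds]))
    | union x y =>
      rw [hk] at h hlt; rw [h.2.2.1]
      exact (ih _ (hlt x (by simp [Gk.preds]))).mono Finset.subset_union_left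
    | concat x y =>
      rw [hk] at h hlt; rw [h.2.2.2.2.1]
      exact ih _ (hlt x (by simp [Gk.preds]))

lemma card_wset_eq_one_s7 (hD : W.Defined nC) (hS : W.Structured) (g : Fin W.N)
    (hc : W.NonConcat g) (hu : ¬ W.IsUnion g) : (W.wset g).card = 1 := by
  induction g using WellFoundedLT.induction with
  | ind g ih =>
    have h := hD.2 g
    have h' := hS g
    have hlt := W.hacyc g
    cases hk : W.kind g with
    | input b => rw [hk] at h; simp [h.1]
    | partition p s l =>
      rw [hk] at h h' hlt; rw [h.2.2.2.1]
      exact ih _ (hlt _ (by simp [Gk.preds])) (fun x y => (h' x y).2)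
        (fun ⟨x, y, e⟩ => (h' x y).1 e)
    | union x y => exact absurd ⟨x, y, hk⟩ hu
    | concat x y => exact absurd hk (hc x y)

/-- Every column of a gate's interval lies in the interval of some gate with the same row set
that is not a concatenation gate. -/
lemma exists_nonConcat (hD : W.Defined nC) (g : Fin W.N) (c : ℕ) (h1 : W.st g ≤ c)
    (h2 : c < W.st g + W.ln g) :
    ∃ h, W.NonConcat h ∧ W.wset h = W.wset g ∧ W.st h ≤ c ∧ c < W.st h + W.ln h := by
  induction g using WellFoundedLT.induction with
  | ind g ih =>
    by_cases hc : W.NonConcat g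
    · exact ⟨g, hc, rfl, h1, h2⟩
    · simp only [NonConcat, not_forall, not_not] at hc
      obtain ⟨x, y, hk⟩ := hc
      have h := hD.2 g
      rw [hk] at h
      obtain ⟨e1, e2, e3, e4, e5, e6, e7⟩ := h
      obtain ⟨lx, ly⟩ := lt_of_concat hk
      by_cases hcx : c < W.st x + W.ln x
      · obtain ⟨h, a1, a2, a3⟩ := ih x lx (by omega) hcx
        exact ⟨h, a1, by rw [a2, e5], a3⟩
      · obtain ⟨h, a1, a2, a3⟩ := ih y ly (by omega) (by omega)
        exact ⟨h, a1, by rw [a2, e5, e1], a3⟩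

/-- Union gates on the interval `K = (start, length)` whose row set is contained in `Γ` and has
at least `s` elements in `X`. -/
noncomputable def bigUnions (W : WitnessCircuit nB) (K : ℕ × ℕ) (Γ X : Finset (Fin nB)) (s : ℕ) :
    Finset (Fin W.N) :=
  Finset.univ.filter fun g => W.IsUnion g ∧ (W.st g, W.ln g) = K ∧ W.wset g ⊆ Γ ∧
    s ≤ (W.wset g ∩ X).card

section Cover

variable {κ : Type*} [DecidableEq κ] {K : ℕ × ℕ} {Γ X : Finset (Fin nB)} {s : ℕ} {key : Fin W.N → κ}
  {E : κ → Finset (Fin nB)}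

lemma wset_inter_subset_biUnion (hD : W.Defined nC) (hS : W.Structured) (hs : 2 ≤ s)
    (hE : ∀ g x y, W.kind g = Gk.union x y → (W.st g, W.ln g) = K → ∀ h, h = x ∨ h = y →
      (W.wset h ∩ X).card < s → W.wset h ∩ X ⊆ E (key g))
    (g : Fin W.N) (hc : W.NonConcat g) (hK : (W.st g, W.ln g) = K) (hΓ : W.wset g ⊆ Γ)
    (hX : s ≤ (W.wset g ∩ X).card) :
    W.wset g ∩ X ⊆ ((W.bigUnions K Γ X s).image key).biUnion E := by
  induction g using WellFoundedLT.induction with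
  | ind g ih =>
    by_cases hu : W.IsUnion g
    · have hu' := hu
      obtain ⟨x, y, hk⟩ := hu
      obtain ⟨e1, e2, e3, e4, e5⟩ := hD.union_eq hk
      obtain ⟨lx, ly⟩ := lt_of_union hk
      obtain ⟨cx, cy⟩ := hS.union_nonConcat hk
      have hmem : key g ∈ (W.bigUnions K Γ X s).image key :=
        Finset.mem_image_of_mem _ (by simp [bigUnions, hu', hK, hΓ, hX])
      have key1 : ∀ h, h = x ∨ h = y → h < g → W.NonConcat h → (W.st h, W.ln h) = K →
          W.wset h ⊆ Γ →
          W.wset h ∩ X ⊆ ((W.bigUnions K Γ X s).image key).biUnion E := by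
        intro h hh hl hcc hKK hΓΓ
        by_cases hsm : (W.wset h ∩ X).card < s
        · exact (hE g x y hk hK h hh hsm).trans (Finset.subset_biUnion_of_mem E hmem)
        · exact ih h hl hcc hKK hΓΓ (not_lt.1 hsm)
      rw [e5] at hΓ ⊢
      rw [Finset.union_inter_distrib_right]
      exact Finset.union_subset
        (key1 x (Or.inl rfl) lx cx (by rw [e1, e3, hK]) (Finset.subset_union_left.trans hΓ))
        (key1 y (Or.inr rfl) ly cy (by rw [e2, e4, hK]) (Finset.subset_union_right.trans hΓ))
    · have h1 := card_wset_eq_one_s7 hD hS g hc hu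
      have h2 := Finset.card_le_card (Finset.inter_subset_left (s₁ := W.wset g) (s₂ := X))
      omega

lemma card_wset_inter_le (hD : W.Defined nC) (hS : W.Structured) (hs : 2 ≤ s)
    (hE : ∀ g x y, W.kind g = Gk.union x y → (W.st g, W.ln g) = K → ∀ h, h = x ∨ h = y →
      (W.wset h ∩ X).card < s → W.wset h ∩ X ⊆ E (key g))
    {e : ℕ} (he : ∀ g, (E (key g)).card ≤ e)
    (g : Fin W.N) (hc : W.NonConcat g) (hK : (W.st g, W.ln g) = K) (hΓ : W.wset g ⊆ Γ) :
    (W.wset g ∩ X).card ≤ s + ((W.bigUnions K Γ X s).image key).card * e := by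
  by_cases hX : s ≤ (W.wset g ∩ X).card
  · refine (Finset.card_le_card
      (wset_inter_subset_biUnion hD hS hs hE g hc hK hΓ hX)).trans ?_
    refine (Finset.card_biUnion_le_card_mul _ _ e ?_).trans (by omega)
    intro k hk
    obtain ⟨g', -, rfl⟩ := Finset.mem_image.1 hk
    exact he g'
  · omega

end Cover

/-- On any interval, building the row set of a gate takes many distinct union gates. -/
lemma card_wset_le_bigUnions (hD : W.Defined nC) (hS : W.Structured) {s : ℕ} (hs : 2 ≤ s)
    (g : Fin W.N) (hc : W.NonConcat g) :
    (W.wset g).card ≤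
      s + (W.bigUnions (W.st g, W.ln g) (W.wset g) Finset.univ s).card * (3 * s) := by
  let E : Fin W.N → Finset (Fin nB) := fun g => match W.kind g with
    | Gk.union x y => (if (W.wset x).card < s then W.wset x else ∅) ∪
        (if (W.wset y).card < s then W.wset y else ∅)
    | _ => ∅
  have := card_wset_inter_le (K := (W.st g, W.ln g)) (Γ := W.wset g) (X := Finset.univ)
    (key := id) (E := E) (e := 3 * s) hD hS hs ?_ ?_ g hc rfl subset_rfl
  · simpa using this
  · rintro g x y hk - h hh hsm
    simp only [Finset.inter_univ] at hsm ⊢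
    simp only [id, E, hk]
    rcases hh with rfl | rfl
    · rw [if_pos hsm]; exact Finset.subset_union_left
    · rw [if_pos hsm]; exact Finset.subset_union_right
  · intro g
    simp only [E]
    split
    · refine (Finset.card_union_le _ _).trans ?_
      split_ifs <;> (try simp only [Finset.card_empty]) <;> omega
    · simp

/-- The intervals of the gates with row set `Γ` that are not concatenation gates. -/
noncomputable def pieces (W : WitnessCircuit nB) (Γ : Finset (Fin nB)) : Finset (ℕ × ℕ) :=
  (Finset.univ.filter fun g => W.NonConcat g ∧ W.wset g = Γ).image fun g => (W.st g, W.ln g)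

lemma mem_pieces {Γ : Finset (Fin nB)} {K : ℕ × ℕ} :
    K ∈ W.pieces Γ ↔ ∃ g, W.NonConcat g ∧ W.wset g = Γ ∧ (W.st g, W.ln g) = K := by
  simp [pieces, and_assoc]

/-- The rows whose identifying column lies in the interval `K`. -/
def rowsOf (nB : ℕ) (K : ℕ × ℕ) : Finset (Fin nB) :=
  Finset.univ.filter fun b => K.1 ≤ 3 * b.val ∧ 3 * b.val < K.1 + K.2

lemma card_rowsOf_le (K : ℕ × ℕ) : (rowsOf nB K).card ≤ K.2 := by
  have : (rowsOf nB K).card ≤ (Finset.Ico K.1 (K.1 + K.2)).card := by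
    apply Finset.card_le_card_of_injOn (fun b => 3 * b.val)
    · intro b hb
      simpa [rowsOf] using hb
    · intro a _ b _ h
      exact Fin.ext (by simpa using h)
  simpa using this

/-- The pieces for `Γ` cover all columns, so `Γ` splits between long and short pieces. -/
lemma card_le_sum_pieces (hD : W.Defined nC) (hB : 3 * nB ≤ nC) {Γ : Finset (Fin nB)} (D : ℕ)
    (hfull : ∃ g, W.wset g = Γ ∧ W.st g = 0 ∧ W.ln g = nC) :
    Γ.card ≤ (∑ K ∈ (W.pieces Γ).filter fun K => D ≤ K.2, (Γ ∩ rowsOf nB K).card) +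
      (W.pieces Γ).card * D := by
  have hcov : Γ ⊆ (((W.pieces Γ).filter fun K => D ≤ K.2).biUnion fun K => Γ ∩ rowsOf nB K) ∪
      (((W.pieces Γ).filter fun K => ¬ D ≤ K.2).biUnion fun K => Γ ∩ rowsOf nB K) := by
    intro b hb
    obtain ⟨g, g1, g2, g3⟩ := hfull
    obtain ⟨h, h1, h2, h3, h4⟩ := exists_nonConcat hD g (3 * b.val) (by omega)
      (by have := b.2; omega)
    have hm : (W.st h, W.ln h) ∈ W.pieces Γ := mem_pieces.2 ⟨h, h1, h2.trans g1, rfl⟩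
    rw [← Finset.union_biUnion, Finset.filter_union_filter_not_eq]
    exact Finset.mem_biUnion.2 ⟨_, hm, Finset.mem_inter.2 ⟨hb, by simp [rowsOf, h3, h4]⟩⟩
  refine (Finset.card_le_card hcov).trans ((Finset.card_union_le _ _).trans
    (add_le_add Finset.card_biUnion_le (Finset.card_biUnion_le.trans ?_)))
  refine (Finset.sum_le_card_nsmul _ _ D ?_).trans ?_
  · intro K hK
    have h1 := card_rowsOf_le (nB := nB) K
    have h2 := Finset.card_le_card (Finset.inter_subset_right (s₁ := Γ) (s₂ := rowsOf nB K))
    have h3 := (Finset.mem_filter.1 hK).2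
    omega
  · rw [smul_eq_mul]
    exact Nat.mul_le_mul_right _ (Finset.card_filter_le _ _)

/-- Double counting of large union gates over a family of sets in which every large set of rows
is contained in few members. -/
lemma sum_pieces_le (hD : W.Defined nC) (hS : W.Structured) {ι : Type*} [Fintype ι]
    {Γ : ι → Finset (Fin nB)} {s t μ : ℕ} (hs : 2 ≤ s)
    (hfree : ∀ U : Finset (Fin nB), s ≤ U.card → (Finset.univ.filter fun a => U ⊆ Γ a).card ≤ t)
    (hμ : ∀ a, μ + s ≤ (Γ a).card) :
    (∑ a, (W.pieces (Γ a)).card) * μ ≤ W.N * t * (3 * s) := by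
  have h1 : ∀ a, (W.pieces (Γ a)).card * μ ≤
      (Finset.univ.filter fun g => s ≤ (W.wset g).card ∧ W.wset g ⊆ Γ a).card * (3 * s) := by
    intro a
    have h2 : ∑ K ∈ W.pieces (Γ a), (W.bigUnions K (Γ a) Finset.univ s).card ≤
        (Finset.univ.filter fun g => s ≤ (W.wset g).card ∧ W.wset g ⊆ Γ a).card := by
      rw [← Finset.card_biUnion]
      · apply Finset.card_le_card
        intro g hg
        simp only [Finset.mem_biUnion, bigUnions, Finset.mem_filter, Finset.inter_univ] at hg
        obtain ⟨K, -, -, -, -, h3, h4⟩ := hg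
        simp [h3, h4]
      · intro K _ K' _ hne
        rw [Function.onFun, Finset.disjoint_left]
        intro g hg hg'
        simp only [bigUnions, Finset.mem_filter] at hg hg'
        exact hne (hg.2.2.1.symm.trans hg'.2.2.1)
    refine le_trans ?_ (Nat.mul_le_mul_right _ h2)
    rw [Finset.sum_mul, ← smul_eq_mul (_ : ℕ)]
    refine Finset.card_nsmul_le_sum _ _ _ ?_
    intro K hK
    obtain ⟨g, g1, g2, rfl⟩ := mem_pieces.1 hK
    have h3 := card_wset_le_bigUnions hD hS hs g g1
    rw [g2] at h3
    have := hμ a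
    omega
  rw [Finset.sum_mul]
  refine (Finset.sum_le_sum fun a _ => h1 a).trans ?_
  rw [← Finset.sum_mul]
  refine Nat.mul_le_mul_right _ ?_
  simp only [Finset.card_filter]
  rw [Finset.sum_comm]
  refine (Finset.sum_le_card_nsmul _ _ t ?_).trans (by simp)
  intro g _
  by_cases hg : s ≤ (W.wset g).card
  · simpa [hg] using hfree _ hg
  · simp [hg]

end WitnessCircuit

/-- The bit of a string at a position, `false` beyond its end. -/
def bitAt (p : (k : ℕ) × (Fin k → Bool)) (t : ℕ) : Bool :=
  if h : t < p.1 then p.2 ⟨t, h⟩ else false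

/-- The hard matrix `Q`: column `3 * b` identifies row `b`, the columns `≡ 1 mod 3` are constantly
one, and the columns `≡ 2 mod 3` are zero except for a marker in each period `3 * L`. -/
def hardQ (nB nC L : ℕ) : Fin nB → Fin nC → Bool := fun b c =>
  decide (c.val = 3 * b.val ∨ c.val % 3 = 1 ∨ c.val % (3 * L) = 2)

lemma sup_bool_eq_true {α : Type*} (S : Finset α) (f : α → Bool) :
    S.sup f = true ↔ ∃ b ∈ S, f b = true := by
  induction S using Finset.induction with
  | empty => simp
  | insert a S _ ih => rw [Finset.sup_insert]; simp [ih]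

lemma exists_lt_add_mod_eq (D r c : ℕ) (hr : r < D) : ∃ t < D, (c + t) % D = r := by
  have hD : 0 < D := by omega
  have h1 := Nat.mod_lt c hD
  refine ⟨(D - c % D + r) % D, Nat.mod_lt _ hD, ?_⟩
  have h2 : c + (D - c % D + r) % D ≡ r [MOD D] := by
    calc c + (D - c % D + r) % D
        ≡ c % D + (D - c % D + r) [MOD D] :=
          Nat.ModEq.add (Nat.mod_modEq _ _).symm (Nat.mod_modEq _ _)
      _ = D + r := by omega
      _ ≡ r [MOD D] := by simp [Nat.ModEq]
  rwa [Nat.ModEq, Nat.mod_eq_of_lt hr] at h2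

/-- The marker columns determine the start of a window modulo `3 * L`. -/
lemma modEq_of_pattern {L : ℕ} (hL : 2 ≤ L) (S S' : ℕ → Prop) (σ σ' : ℕ)
    (h : ∀ t < 3 * L,
      ((∃ b, S b ∧ σ + t = 3 * b) ∨ (σ + t) % 3 = 1 ∨ (σ + t) % (3 * L) = 2) ↔
      ((∃ b, S' b ∧ σ' + t = 3 * b) ∨ (σ' + t) % 3 = 1 ∨ (σ' + t) % (3 * L) = 2)) :
    σ ≡ σ' [MOD 3 * L] := by
  have hmod : ∀ x r, x % (3 * L) = r → x % 3 = r % 3 := by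
    intro x r hx
    rw [← hx, Nat.mod_mul_right_mod]
  have hcase : σ % 3 = σ' % 3 ∨ (σ + 1) % 3 = σ' % 3 ∨ (σ' + 1) % 3 = σ % 3 := by omega
  rcases hcase with hc | hc | hc
  · obtain ⟨t, ht, e⟩ := exists_lt_add_mod_eq (3 * L) 2 σ (by omega)
    have e3 := hmod _ _ e
    rcases (h t ht).1 (Or.inr (Or.inr e)) with ⟨b, -, hb⟩ | h1 | h1
    · omega
    · omega
    · exact Nat.ModEq.add_right_cancel' t (e.trans h1.symm)
  · obtain ⟨t, ht, e⟩ := exists_lt_add_mod_eq (3 * L) 5 σ' (by omega)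
    have e3 := hmod _ _ e
    rcases (h t ht).1 (Or.inr (Or.inl (by omega))) with ⟨b, -, hb⟩ | h1 | h1 <;> omega
  · obtain ⟨t, ht, e⟩ := exists_lt_add_mod_eq (3 * L) 5 σ (by omega)
    have e3 := hmod _ _ e
    rcases (h t ht).2 (Or.inr (Or.inl (by omega))) with ⟨b, -, hb⟩ | h1 | h1 <;> omega

namespace WitnessCircuit

variable {nB nC L : ℕ} {W : WitnessCircuit nB}

lemma bitAt_gval (hD : W.Defined nC) (g : Fin W.N) {t : ℕ} (ht : t < W.ln g) :
    bitAt (gval (hardQ nB nC L) W g) t = true ↔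
      (∃ b ∈ W.wset g, W.st g + t = 3 * b.val) ∨ (W.st g + t) % 3 = 1 ∨
        (W.st g + t) % (3 * L) = 2 := by
  have h1 := (hD.1 g).2
  have h2 : W.st g + t < nC := by omega
  obtain ⟨b0, hb0⟩ := wset_nonempty hD g
  simp only [bitAt, gval, ht, h2, dite_true, sup_bool_eq_true, hardQ, decide_eq_true_eq]
  constructor
  · rintro ⟨b, hb, h | h | h⟩
    · exact Or.inl ⟨b, hb, h⟩
    · exact Or.inr (Or.inl h)
    · exact Or.inr (Or.inr h)
  · rintro (⟨b, hb, h⟩ | h)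
    · exact ⟨b, hb, Or.inl h⟩
    · exact ⟨b0, hb0, Or.inr h⟩

lemma bitAt_gval_of_le (Q : Fin nB → Fin nC → Bool) (g : Fin W.N) {t : ℕ} (ht : W.ln g ≤ t) :
    bitAt (gval Q W g) t = false := by
  simp [bitAt, gval, ht]

lemma le_sweight_gval (hD : W.Defined nC) (g : Fin W.N) (hg : 3 * L ≤ W.ln g) :
    L ≤ sweight (gval (hardQ nB nC L) W g) := by
  have hlt : ∀ j ∈ Finset.range L, 3 * j + (1 + 2 * W.st g) % 3 <
      (gval (hardQ nB nC L) W g).1 := by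
    intro j hj
    have := Finset.mem_range.1 hj
    change _ < W.ln g
    omega
  have : (Finset.range L).card ≤ sweight (gval (hardQ nB nC L) W g) := by
    refine Finset.card_le_card_of_injOn
      (fun j => if h : 3 * j + (1 + 2 * W.st g) % 3 < (gval (hardQ nB nC L) W g).1 then
        ⟨3 * j + (1 + 2 * W.st g) % 3, h⟩ else ⟨0, (hD.1 g).1⟩) ?_ ?_
    · intro j hj
      have h1 := hlt j hj
      have h2 := (bitAt_gval (L := L) hD g h1).2 (Or.inr (Or.inl (by omega)))
      rw [bitAt, dif_pos h1] at h2
      simp only [h1, dite_true]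
      exact Finset.mem_coe.2 (Finset.mem_filter.2 ⟨Finset.mem_univ _, h2⟩)
    · intro i hi j hj hij
      have h1 := hlt i hi
      have h2 := hlt j hj
      simp only [h1, h2, dite_true, Fin.mk.injEq] at hij
      omega
  simpa using this

/-- The rows whose identifying bit is set in the string `w` placed at column `σ`. -/
def rowsIn (nB : ℕ) (w : (k : ℕ) × (Fin k → Bool)) (σ : ℕ) : Finset (Fin nB) :=
  Finset.univ.filter fun b => σ ≤ 3 * b.val ∧ bitAt w (3 * b.val - σ) = true

lemma rowsIn_gval (hD : W.Defined nC) (g : Fin W.N) :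
    rowsIn nB (gval (hardQ nB nC L) W g) (W.st g) = W.wset g ∩ rowsOf nB (W.st g, W.ln g) := by
  ext b
  simp only [rowsIn, rowsOf, Finset.mem_filter, Finset.mem_univ, true_and, Finset.mem_inter]
  by_cases h1 : W.st g ≤ 3 * b.val
  · by_cases h2 : 3 * b.val - W.st g < W.ln g
    · rw [bitAt_gval hD g h2]
      have h3 : W.st g + (3 * b.val - W.st g) = 3 * b.val := by omega
      rw [h3]
      have h4 : 3 * b.val % (3 * L) ≠ 2 := by
        intro h
        have := Nat.mod_mul_right_mod (3 * b.val) 3 L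
        rw [h] at this
        omega
      have h5 : 3 * b.val % 3 ≠ 1 := by omega
      constructor
      · rintro ⟨-, ⟨b', hb', e⟩ | h | h⟩
        · have : b = b' := Fin.ext (by omega)
          exact ⟨this ▸ hb', h1, by omega⟩
        · exact absurd h h5
        · exact absurd h h4
      · rintro ⟨h, -⟩
        exact ⟨h1, Or.inl ⟨b, h, rfl⟩⟩
    · rw [bitAt_gval_of_le _ _ (not_lt.1 h2)]
      simp
      omega
  · simp [h1]

lemma modEq_of_gval_eq (hD : W.Defined nC) (hL : 2 ≤ L) {g h : Fin W.N}
    (e : gval (hardQ nB nC L) W g = gval (hardQ nB nC L) W h) (hg : 3 * L ≤ W.ln g) :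
    W.ln g = W.ln h ∧ W.st g ≡ W.st h [MOD 3 * L] := by
  have e1 : W.ln g = W.ln h := congrArg Sigma.fst e
  refine ⟨e1, modEq_of_pattern hL (fun b => ∃ b' ∈ W.wset g, b'.val = b)
    (fun b => ∃ b' ∈ W.wset h, b'.val = b) _ _ fun t ht => ?_⟩
  have a1 := bitAt_gval (L := L) hD g (t := t) (by omega)
  have a2 := bitAt_gval (L := L) hD h (t := t) (by omega)
  rw [e] at a1
  have a3 := a1.symm.trans a2
  simpa using a3

lemma uClass_of_union (Q : Fin nB → Fin nC → Bool) {g x y : Fin W.N}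
    (hk : W.kind g = Gk.union x y) :
    uClass Q W g = {gval Q W g, gval Q W x, gval Q W y} := by
  simp only [uClass, hk]

lemma card_uClass_le (Q : Fin nB → Fin nC → Bool) (g : Fin W.N) : (uClass Q W g).card ≤ 3 := by
  unfold uClass
  split
  · exact Finset.card_le_three
  · simp

/-- Each member of a row-class is the value of a gate with the same interval whose row set is
contained in that of the union gate. -/
lemma exists_of_mem_uClass (hD : W.Defined nC) {Q : Fin nB → Fin nC → Bool} {g : Fin W.N}
    {w : (k : ℕ) × (Fin k → Bool)} (hw : w ∈ uClass Q W g) :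
    ∃ h, w = gval Q W h ∧ W.st h = W.st g ∧ W.ln h = W.ln g ∧ W.wset h ⊆ W.wset g := by
  unfold uClass at hw
  split at hw
  · rename_i x y hk
    obtain ⟨e1, e2, e3, e4, e5⟩ := hD.union_eq hk
    simp only [Finset.mem_insert, Finset.mem_singleton] at hw
    rcases hw with rfl | rfl | rfl
    · exact ⟨g, rfl, rfl, rfl, subset_rfl⟩
    · exact ⟨x, rfl, e1, e3, e5 ▸ Finset.subset_union_left⟩
    · exact ⟨y, rfl, e2, e4, e5 ▸ Finset.subset_union_right⟩
  · simp at hw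

lemma gval_mem_uClass (Q : Fin nB → Fin nC → Bool) {g : Fin W.N} (hu : W.IsUnion g) :
    gval Q W g ∈ uClass Q W g := by
  obtain ⟨x, y, hk⟩ := hu
  simp [uClass_of_union Q hk]

lemma biUnion_rowsIn (hD : W.Defined nC) {g : Fin W.N} (hu : W.IsUnion g) :
    (uClass (hardQ nB nC L) W g).biUnion (fun w => rowsIn nB w (W.st g)) =
      W.wset g ∩ rowsOf nB (W.st g, W.ln g) := by
  apply subset_antisymm
  · refine Finset.biUnion_subset.2 fun w hw => ?_
    obtain ⟨h, rfl, h1, h2, h3⟩ := exists_of_mem_uClass hD hw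
    rw [← h1, rowsIn_gval hD h, h1, h2]
    exact Finset.inter_subset_inter_right h3
  · rw [← rowsIn_gval (L := L) hD g]
    exact Finset.subset_biUnion_of_mem (fun w => rowsIn nB w (W.st g)) (gval_mem_uClass _ hu)

lemma modEq_of_uClass_eq (hD : W.Defined nC) (hL : 2 ≤ L) {g h : Fin W.N} (hu : W.IsUnion g)
    (e : uClass (hardQ nB nC L) W g = uClass (hardQ nB nC L) W h) (hg : 3 * L ≤ W.ln g) :
    W.ln g = W.ln h ∧ W.st g ≡ W.st h [MOD 3 * L] := by
  have h1 := gval_mem_uClass (hardQ nB nC L) hu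
  rw [e] at h1
  obtain ⟨h', e1, e2, e3, -⟩ := exists_of_mem_uClass hD h1
  rw [← e2, ← e3]
  exact modEq_of_gval_eq hD hL e1 hg

/-- The distinct row-classes of union gates on long intervals. -/
noncomputable def longClasses (W : WitnessCircuit nB) (nC L : ℕ) :
    Finset (Finset ((k : ℕ) × (Fin k → Bool))) :=
  (Finset.univ.filter fun g => W.IsUnion g ∧ 3 * L ≤ W.ln g).image (uClass (hardQ nB nC L) W)

lemma card_longClasses_mul_le (hD : W.Defined nC) :
    (W.N : ℝ) + (W.longClasses nC L).card * L ≤ wCost (hardQ nB nC L) W := by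
  unfold wCost
  refine add_le_add le_rfl ?_
  have hsub : W.longClasses nC L ⊆ (Finset.univ.filter fun g : Fin W.N =>
        ∃ x y : Fin W.N, W.kind g = Gk.union x y).image (uClass (hardQ nB nC L) W) := by
    refine Finset.image_subset_image fun g hg => ?_
    simp only [Finset.mem_filter] at hg ⊢
    exact ⟨hg.1, hg.2.1⟩
  refine le_trans ?_ (Finset.sum_le_sum_of_subset_of_nonneg hsub fun _ _ _ => Nat.cast_nonneg _)
  rw [← nsmul_eq_mul]
  refine Finset.card_nsmul_le_sum _ _ _ fun T hT => ?_
  obtain ⟨g, hg, rfl⟩ := Finset.mem_image.1 hT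
  obtain ⟨-, hu, hl⟩ := Finset.mem_filter.1 hg
  rw [Nat.cast_le]
  have hne : (sweight '' (uClass (hardQ nB nC L) W g : Set ((k : ℕ) × (Fin k → Bool)))).Nonempty :=
    ⟨_, _, gval_mem_uClass _ hu, rfl⟩
  obtain ⟨w, hw, e⟩ := Nat.sInf_mem hne
  rw [← e]
  obtain ⟨h, rfl, -, h2, -⟩ := exists_of_mem_uClass hD hw
  exact le_sweight_gval hD h (by omega)

/-- The row-classes of the union gates counted for `Γ` on the interval `K`. -/
noncomputable def classesOn (W : WitnessCircuit nB) (nC L : ℕ) (Γ : Finset (Fin nB)) (s : ℕ)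
    (K : ℕ × ℕ) : Finset (Finset ((k : ℕ) × (Fin k → Bool))) :=
  (W.bigUnions K Γ (rowsOf nB K) s).image (uClass (hardQ nB nC L) W)

lemma card_inter_rowsOf_le (hD : W.Defined nC) (hS : W.Structured) {s : ℕ} (hs : 2 ≤ s)
    {Γ : Finset (Fin nB)} {K : ℕ × ℕ} (hK : K ∈ W.pieces Γ) :
    (Γ ∩ rowsOf nB K).card ≤ s + (W.classesOn nC L Γ s K).card * (3 * s) := by
  obtain ⟨g, hc, rfl, hgK⟩ := mem_pieces.1 hK
  refine card_wset_inter_le hD hS hs (X := rowsOf nB K) (e := 3 * s)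
    (key := uClass (hardQ nB nC L) W)
    (E := fun T => T.biUnion fun w =>
      if (rowsIn nB w K.1).card < s then rowsIn nB w K.1 else ∅) ?_ ?_ g hc hgK subset_rfl
  · rintro g' x y hk hK' h hh hsm
    obtain ⟨e1, e2, e3, e4, -⟩ := hD.union_eq hk
    have h1 : W.st h = K.1 ∧ W.ln h = K.2 := by
      rw [← hK']
      rcases hh with rfl | rfl
      · exact ⟨e1, e3⟩
      · exact ⟨e2, e4⟩
    have h2 := rowsIn_gval (L := L) hD h
    rw [h1.1, h1.2] at h2
    have hm : gval (hardQ nB nC L) W h ∈ uClass (hardQ nB nC L) W g' := by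
      rw [uClass_of_union _ hk]
      rcases hh with rfl | rfl <;> simp
    refine subset_trans ?_ (Finset.subset_biUnion_of_mem _ hm)
    simp only [h2, Prod.mk.eta, hsm, if_true, subset_rfl]
  · intro g'
    refine (Finset.card_biUnion_le_card_mul _ _ s ?_).trans
      (Nat.mul_le_mul_right _ (card_uClass_le _ _))
    intro w _
    split_ifs with h
    · exact h.le
    · simp

/-- Double counting of row-classes over a family of sets in which every large set of rows is
contained in few members. -/
lemma sum_classesOn_le (hD : W.Defined nC) (hL : 2 ≤ L) {ι : Type*} [Fintype ι]
    {Γ : ι → Finset (Fin nB)} {s t : ℕ}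
    (hfree : ∀ U : Finset (Fin nB), s ≤ U.card → (Finset.univ.filter fun a => U ⊆ Γ a).card ≤ t)
    (I : ι → Finset (ℕ × ℕ)) (hI : ∀ a, ∀ K ∈ I a, 3 * L ≤ K.2) :
    ∑ a, ∑ K ∈ I a, (W.classesOn nC L (Γ a) s K).card ≤
      (W.longClasses nC L).card * (t * (nC / (3 * L) + 1)) := by
  have key : ∀ a, ∀ K ∈ I a, ∀ T ∈ W.classesOn nC L (Γ a) s K, ∃ g, W.IsUnion g ∧
      (W.st g, W.ln g) = K ∧ uClass (hardQ nB nC L) W g = T ∧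
      s ≤ (T.biUnion fun w => rowsIn nB w K.1).card ∧
      (T.biUnion fun w => rowsIn nB w K.1) ⊆ Γ a := by
    intro a K _ T hT
    obtain ⟨g, hg, rfl⟩ := Finset.mem_image.1 hT
    obtain ⟨-, hu, rfl, h3, h4⟩ := Finset.mem_filter.1 hg
    refine ⟨g, hu, rfl, rfl, ?_⟩
    rw [biUnion_rowsIn hD hu]
    exact ⟨h4, Finset.inter_subset_left.trans h3⟩
  rw [Finset.sum_sigma']
  have hswap : ∑ i ∈ Finset.univ.sigma I, (W.classesOn nC L (Γ i.1) s i.2).card =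
      ∑ T ∈ W.longClasses nC L,
        ((Finset.univ.sigma I).filter fun i => T ∈ W.classesOn nC L (Γ i.1) s i.2).card := by
    refine Eq.trans (Finset.sum_congr rfl fun i hi => ?_)
      (Finset.sum_card_bipartiteAbove_eq_sum_card_bipartiteBelow
        fun (i : (_ : ι) × ℕ × ℕ) T => T ∈ W.classesOn nC L (Γ i.1) s i.2)
    congr 1
    ext T
    simp only [Finset.bipartiteAbove, Finset.mem_filter]
    refine ⟨fun hT => ⟨?_, hT⟩, fun h => h.2⟩
    have hi2 := (Finset.mem_sigma.1 hi).2
    obtain ⟨g, h1, h2, h3, -⟩ := key i.1 i.2 hi2 T hT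
    have := hI _ _ hi2
    rw [← h2] at this
    exact Finset.mem_image.2 ⟨g, by simp [h1, this], h3⟩
  rw [hswap, ← smul_eq_mul]
  refine Finset.sum_le_card_nsmul _ _ _ fun T _ => ?_
  set Z := (Finset.univ.sigma I).filter fun i => T ∈ W.classesOn nC L (Γ i.1) s i.2 with hZ
  have hZk : ∀ i ∈ Z, ∃ g, W.IsUnion g ∧ 3 * L ≤ W.ln g ∧
      (W.st g, W.ln g) = i.2 ∧ uClass (hardQ nB nC L) W g = T ∧
      s ≤ (T.biUnion fun w => rowsIn nB w i.2.1).card ∧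
      (T.biUnion fun w => rowsIn nB w i.2.1) ⊆ Γ i.1 := by
    intro i hi
    obtain ⟨hi1, hi2⟩ := Finset.mem_filter.1 hi
    have hi3 := (Finset.mem_sigma.1 hi1).2
    obtain ⟨g, h1, h2, h3⟩ := key i.1 i.2 hi3 T hi2
    have := hI _ _ hi3
    rw [← h2] at this
    exact ⟨g, h1, this, h2, h3⟩
  have hpair : ∀ i ∈ Z, ∀ j ∈ Z, i.2.2 = j.2.2 ∧ i.2.1 ≡ j.2.1 [MOD 3 * L] := by
    intro i hi j hj
    obtain ⟨g, h1, h2, h3, h4, -⟩ := hZk i hi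
    obtain ⟨g', h1', h2', h3', h4', -⟩ := hZk j hj
    rw [← h3, ← h3']
    exact modEq_of_uClass_eq hD hL h1 (h4.trans h4'.symm) h2
  have hfib : ∀ σ ∈ Z.image fun i => i.2.1, (Z.filter fun i => i.2.1 = σ).card ≤ t := by
    intro σ hσ
    obtain ⟨i, hi, rfl⟩ := Finset.mem_image.1 hσ
    obtain ⟨-, -, -, -, -, hs, -⟩ := hZk i hi
    refine le_trans ?_ (hfree _ hs)
    refine Finset.card_le_card_of_injOn (fun j => j.1) ?_ ?_
    · intro j hj
      obtain ⟨hj1, hj2⟩ := Finset.mem_filter.1 hj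
      obtain ⟨-, -, -, -, -, -, h⟩ := hZk j hj1
      rw [hj2] at h
      exact Finset.mem_coe.2 (Finset.mem_filter.2 ⟨Finset.mem_univ _, h⟩)
    · intro j hj k hk hjk
      obtain ⟨hj1, hj2⟩ := Finset.mem_filter.1 hj
      obtain ⟨hk1, hk2⟩ := Finset.mem_filter.1 hk
      obtain ⟨ja, jσ, jk⟩ := j
      obtain ⟨ka, kσ, kk⟩ := k
      have := (hpair _ hj1 _ hk1).1
      simp only at hjk hj2 hk2 this
      rw [hjk, hj2, hk2, this]
  refine (Finset.card_le_mul_card_image Z t hfib).trans (Nat.mul_le_mul_left _ ?_)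
  rw [← Finset.card_range (nC / (3 * L) + 1)]
  refine Finset.card_le_card_of_injOn (fun σ => σ / (3 * L)) ?_ ?_
  · intro σ hσ
    obtain ⟨i, hi, rfl⟩ := Finset.mem_image.1 hσ
    obtain ⟨g, -, -, h3, -⟩ := hZk i hi
    rw [← h3]
    have := hD.1 g
    exact Finset.mem_coe.2 (Finset.mem_range.2 (Nat.lt_succ_of_le
      (Nat.div_le_div_right (by omega))))
  · intro σ hσ τ hτ h
    obtain ⟨i, hi, rfl⟩ := Finset.mem_image.1 hσ
    obtain ⟨j, hj, rfl⟩ := Finset.mem_image.1 hτ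
    have h1 : i.2.1 % (3 * L) = j.2.1 % (3 * L) := (hpair i hi j hj).2
    simp only at h
    rw [← Nat.div_add_mod i.2.1 (3 * L), ← Nat.div_add_mod j.2.1 (3 * L), h, h1]

end WitnessCircuit

section Family

/-- The index of the pair of rows `{2 * i, 2 * i + 1}` containing `b`. -/
def halfIdx {m : ℕ} (b : Fin m) : Fin m := ⟨b.val / 2, by have := b.2; omega⟩

/-- From each pair of rows `{2 * i, 2 * i + 1}`, row `a` picks the one given by the bit
`f (a, i)`. -/
def pick {n m : ℕ} (f : Fin n × Fin m → Bool) (a : Fin n) (b : Fin m) : Bool :=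
  f (a, halfIdx b) == decide (b.val % 2 = 1)

lemma pick_eq_true {n m : ℕ} {f : Fin n × Fin m → Bool} {a : Fin n} {b : Fin m} :
    pick f a b = true ↔ f (a, halfIdx b) = decide (b.val % 2 = 1) := by
  simp [pick]

lemma half_le_card_pick {n m : ℕ} (f : Fin n × Fin m → Bool) (a : Fin n) :
    m / 2 ≤ (Finset.univ.filter fun b => pick f a b = true).card := by
  have h : ∀ i : Fin (m / 2), i.val < m := fun i => by have := i.2; omega
  have h' : ∀ i : Fin (m / 2), 2 * i.val + (f (a, ⟨i.val, h i⟩)).toNat < m := fun i => by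
    have := i.2
    have := Bool.toNat_le (f (a, ⟨i.val, h i⟩))
    omega
  have := Finset.card_le_card_of_injOn (s := (Finset.univ : Finset (Fin (m / 2))))
    (t := Finset.univ.filter fun b => pick f a b = true)
    (fun i => ⟨2 * i.val + (f (a, ⟨i.val, h i⟩)).toNat, h' i⟩) ?_ ?_
  · simpa using this
  · intro i _
    rw [Finset.mem_coe, Finset.mem_filter, pick_eq_true]
    refine ⟨Finset.mem_univ _, ?_⟩
    have h1 : halfIdx ⟨2 * i.val + (f (a, ⟨i.val, h i⟩)).toNat, h' i⟩ = ⟨i.val, h i⟩ := by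
      have := Bool.toNat_le (f (a, ⟨i.val, h i⟩))
      simp only [halfIdx, Fin.mk.injEq]
      omega
    rw [h1]
    cases hfi : f (a, ⟨i.val, h i⟩) <;> simp [hfi]
  · intro i _ j _ hij
    simp only [Fin.mk.injEq] at hij
    have h1 := Bool.toNat_le (f (a, ⟨i.val, h i⟩))
    have h2 := Bool.toNat_le (f (a, ⟨j.val, h j⟩))
    exact Fin.ext (by omega)

lemma card_le_two_mul_card_image_halfIdx {m : ℕ} (U : Finset (Fin m)) :
    U.card ≤ 2 * (U.image halfIdx).card := by
  refine Finset.card_le_mul_card_image U 2 fun i _ => ?_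
  refine (Finset.card_le_card_of_injOn (t := Finset.range 2) (fun b => b.val % 2) ?_ ?_).trans
    (Finset.card_range 2).le
  · intro b _
    simpa using Nat.mod_lt _ two_pos
  · intro b hb c hc h
    have h1 := (Finset.mem_filter.1 hb).2
    have h2 := (Finset.mem_filter.1 hc).2
    have h3 : b.val / 2 = c.val / 2 := congrArg Fin.val (h1.trans h2.symm)
    simp only at h
    exact Fin.ext (by omega)

lemma card_pick_all_mul_le {n m u : ℕ} (U : Finset (Fin m)) (A : Finset (Fin n))
    (hU : 2 * u ≤ U.card) :
    (Finset.univ.filter fun f : Fin n × Fin m → Bool =>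
      ∀ a ∈ A, ∀ b ∈ U, pick f a b = true).card * 2 ^ (u * A.card) ≤ 2 ^ (n * m) := by
  set V := U.image halfIdx with hV
  have hVc : u ≤ V.card := by
    have h : U.card ≤ 2 * V.card := by convert card_le_two_mul_card_image_halfIdx U
    omega
  let v : Fin m → Bool := fun i => decide (∃ b ∈ U, halfIdx b = i ∧ b.val % 2 = 1)
  have hsub : (Finset.univ.filter fun f : Fin n × Fin m → Bool =>
      ∀ a ∈ A, ∀ b ∈ U, pick f a b = true) ⊆
      Fintype.piFinset fun p => if p ∈ A ×ˢ V then {v p.2} else Finset.univ := by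
    intro f hf
    have hf := (Finset.mem_filter.1 hf).2
    rw [Fintype.mem_piFinset]
    rintro ⟨a, i⟩
    split_ifs with hp
    · obtain ⟨ha, hi⟩ := Finset.mem_product.1 hp
      obtain ⟨b, hb, rfl⟩ := Finset.mem_image.1 hi
      have hfb := pick_eq_true.1 (hf a ha b hb)
      rw [Finset.mem_singleton]
      by_cases hv : ∃ b' ∈ U, halfIdx b' = halfIdx b ∧ b'.val % 2 = 1
      · obtain ⟨b', hb', e1, e2⟩ := hv
        have hfb' := pick_eq_true.1 (hf a ha b' hb')
        rw [e1] at hfb'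
        rw [hfb', decide_eq_true e2]
        exact (decide_eq_true ⟨b', hb', e1, e2⟩).symm
      · have : ¬ b.val % 2 = 1 := fun h => hv ⟨b, hb, rfl, h⟩
        rw [hfb, decide_eq_false this]
        exact (decide_eq_false hv).symm
    · exact Finset.mem_univ _
  have hcard : (Fintype.piFinset fun p : Fin n × Fin m =>
      if p ∈ A ×ˢ V then {v p.2} else (Finset.univ : Finset Bool)).card =
      2 ^ (Finset.univ \ (A ×ˢ V)).card := by
    rw [Fintype.card_piFinset, ← Finset.prod_sdiff (Finset.subset_univ (A ×ˢ V)),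
      Finset.prod_eq_one (s := A ×ˢ V), mul_one, Finset.prod_eq_pow_card (b := 2)]
    · intro p hp
      simp [(Finset.mem_sdiff.1 hp).2]
    · intro p hp
      simp [hp]
  have h1 := Finset.card_sdiff_add_card_eq_card (Finset.subset_univ (A ×ˢ V))
  rw [Finset.card_univ, Fintype.card_prod, Fintype.card_fin, Fintype.card_fin,
    Finset.card_product] at h1
  calc _ ≤ 2 ^ (Finset.univ \ (A ×ˢ V)).card * 2 ^ (u * A.card) :=
        Nat.mul_le_mul_right _ ((Finset.card_le_card hsub).trans hcard.le)
    _ ≤ 2 ^ (Finset.univ \ (A ×ˢ V)).card * 2 ^ (A.card * V.card) := by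
        refine Nat.mul_le_mul_left _ (Nat.pow_le_pow_right two_pos ?_)
        rw [mul_comm]
        exact Nat.mul_le_mul_left _ hVc
    _ = 2 ^ (n * m) := by rw [← pow_add, h1]

/-- A choice of bits for which no large set of rows is picked by many indices at once. -/
lemma exists_pick_sparse {n m u t : ℕ} (h : m ^ (2 * u) * n ^ t < 2 ^ (u * t)) :
    ∃ f : Fin n × Fin m → Bool, ∀ U : Finset (Fin m), 2 * u ≤ U.card →
      (Finset.univ.filter fun a => U ⊆ Finset.univ.filter fun b => pick f a b = true).card ≤ t := by
  by_contra! hcon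
  let bad : Finset (Fin m) × Finset (Fin n) → Finset (Fin n × Fin m → Bool) := fun q =>
    Finset.univ.filter fun f => ∀ a ∈ q.2, ∀ b ∈ q.1, pick f a b = true
  let index := Finset.powersetCard (2 * u) (Finset.univ : Finset (Fin m)) ×ˢ
    Finset.powersetCard t (Finset.univ : Finset (Fin n))
  have hcov : (Finset.univ : Finset (Fin n × Fin m → Bool)) ⊆ index.biUnion bad := by
    intro f _
    obtain ⟨U, hU, hA⟩ := hcon f
    obtain ⟨U', hU', cU⟩ := Finset.exists_subset_card_eq hU
    obtain ⟨A', hA', cA⟩ := Finset.exists_subset_card_eq hA.le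
    refine Finset.mem_biUnion.2 ⟨(U', A'), ?_, ?_⟩
    · simp [index, Finset.mem_powersetCard, cU, cA]
    · refine Finset.mem_filter.2 ⟨Finset.mem_univ _, fun a ha b hb => ?_⟩
      exact (Finset.mem_filter.1 ((Finset.mem_filter.1 (hA' ha)).2 (hU' hb))).2
  have h1 : 2 ^ (n * m) ≤ ∑ q ∈ index, (bad q).card := by
    have := (Finset.card_le_card hcov).trans Finset.card_biUnion_le
    simpa using this
  have h2 : (∑ q ∈ index, (bad q).card) * 2 ^ (u * t) ≤ index.card * 2 ^ (n * m) := by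
    rw [Finset.sum_mul, ← smul_eq_mul (index.card)]
    refine Finset.sum_le_card_nsmul _ _ _ fun q hq => ?_
    obtain ⟨q1, q2⟩ := Finset.mem_product.1 hq
    have := card_pick_all_mul_le q.1 q.2 (Finset.mem_powersetCard.1 q1).2.ge
    rwa [(Finset.mem_powersetCard.1 q2).2] at this
  have h3 : index.card ≤ m ^ (2 * u) * n ^ t := by
    simp only [index, Finset.card_product, Finset.card_powersetCard, Finset.card_univ,
      Fintype.card_fin]
    exact Nat.mul_le_mul (Nat.choose_le_pow _ _) (Nat.choose_le_pow _ _)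
  have h4 : 2 ^ (n * m) * 2 ^ (u * t) ≤ 2 ^ (n * m) * (m ^ (2 * u) * n ^ t) := by
    calc _ ≤ _ := Nat.mul_le_mul_right _ h1
      _ ≤ _ := h2
      _ ≤ (m ^ (2 * u) * n ^ t) * 2 ^ (n * m) := Nat.mul_le_mul_right _ h3
      _ = _ := mul_comm _ _
  exact absurd (Nat.le_of_mul_le_mul_left h4 (by positivity)) (not_le.2 h)

end Family

/-- The counting argument: both the number of gates and the number of row-classes on long
intervals are bounded below through the total number `S` of pieces. -/
lemma WitnessCircuit.exists_counting_bounds {nB nC L s t μ : ℕ} {W : WitnessCircuit nB}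
    (hD : W.Defined nC) (hS : W.Structured) (hB : 3 * nB ≤ nC) (hL : 2 ≤ L) (hs : 2 ≤ s)
    {n : ℕ} {Γ : Fin n → Finset (Fin nB)}
    (hfull : ∀ a, ∃ g, W.wset g = Γ a ∧ W.st g = 0 ∧ W.ln g = nC)
    (hfree : ∀ U : Finset (Fin nB), s ≤ U.card → (Finset.univ.filter fun a => U ⊆ Γ a).card ≤ t)
    (hμ : ∀ a, μ + s ≤ (Γ a).card) :
    ∃ S : ℕ, S * μ ≤ W.N * t * (3 * s) ∧
      n * (μ + s) ≤ S * (s + 3 * L) +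
        (W.longClasses nC L).card * (t * (nC / (3 * L) + 1)) * (3 * s) := by
  refine ⟨∑ a, (W.pieces (Γ a)).card, sum_pieces_le hD hS hs hfree hμ, ?_⟩
  let I : Fin n → Finset (ℕ × ℕ) := fun a => (W.pieces (Γ a)).filter fun K => 3 * L ≤ K.2
  have h1 := sum_classesOn_le (W := W) hD hL hfree I fun a K hK => (Finset.mem_filter.1 hK).2
  have h2 : ∀ a, μ + s ≤ (W.pieces (Γ a)).card * (s + 3 * L) +
      (∑ K ∈ I a, (W.classesOn nC L (Γ a) s K).card) * (3 * s) := by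
    intro a
    have h3 := (hμ a).trans (card_le_sum_pieces hD hB (3 * L) (hfull a))
    have h4 : ∑ K ∈ I a, (Γ a ∩ rowsOf nB K).card ≤
        ∑ K ∈ I a, (s + (W.classesOn nC L (Γ a) s K).card * (3 * s)) :=
      Finset.sum_le_sum fun K hK => card_inter_rowsOf_le hD hS hs (Finset.mem_filter.1 hK).1
    rw [Finset.sum_add_distrib, Finset.sum_const, smul_eq_mul, ← Finset.sum_mul] at h4
    have h5 : (I a).card * s ≤ (W.pieces (Γ a)).card * s :=
      Nat.mul_le_mul_right _ (Finset.card_filter_le _ _)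
    rw [mul_add]
    change _ ≤ (∑ K ∈ I a, _) + _ at h3
    omega
  calc n * (μ + s) = ∑ _a : Fin n, (μ + s) := by simp
    _ ≤ _ := Finset.sum_le_sum fun a _ => h2 a
    _ = (∑ a, (W.pieces (Γ a)).card) * (s + 3 * L) +
        (∑ a, ∑ K ∈ I a, (W.classesOn nC L (Γ a) s K).card) * (3 * s) := by
      rw [Finset.sum_add_distrib, Finset.sum_mul, Finset.sum_mul]
    _ ≤ _ := Nat.add_le_add_left (Nat.mul_le_mul_right _ h1) _

lemma pow_seven_le_of_counting {y L N τ S ρ : ℝ} (hy : 0 < y) (hL : 0 < L) (hτ : 0 ≤ τ)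
    (h1 : S * (y ^ 3 / 14) ≤ 54 * ρ ^ 2 * N)
    (h2 : y ^ 3 * (y ^ 3 / 7) ≤ 4 * L * S + 54 * ρ ^ 2 * τ * (y ^ 3 / L)) (hS : 0 ≤ S)
    (hLy : L ≤ y ^ 2) (hyL : y ^ 2 ≤ 2 * L) :
    y ^ 7 ≤ 21168 * ρ ^ 2 * (N + τ * L) := by
  have a1 : L * S * y ≤ 756 * ρ ^ 2 * N := by
    calc L * S * y ≤ y ^ 2 * S * y := by gcongr
      _ = 14 * (S * (y ^ 3 / 14)) := by ring
      _ ≤ 14 * (54 * ρ ^ 2 * N) := by gcongr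
      _ = _ := by ring
  have a2 : y ^ 3 / L * y ≤ 4 * L := by
    rw [div_mul_eq_mul_div, div_le_iff₀ hL]
    nlinarith [sq_nonneg y]
  have a3 : 0 ≤ ρ ^ 2 * τ := by positivity
  have a4 : y ^ 7 = 7 * (y ^ 3 * (y ^ 3 / 7)) * y := by ring
  have a5 := mul_le_mul_of_nonneg_right h2 hy.le
  have a6 := mul_le_mul_of_nonneg_left a2 a3
  have a7 : 0 ≤ ρ ^ 2 * τ * L := by positivity
  nlinarith

lemma eventually_poly_le_two_pow_sqrt_logb :
    ∀ᶠ n : ℕ in Filter.atTop,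
      21168 * (Real.logb 2 n + 1) ^ 2 ≤ (2 : ℝ) ^ Real.sqrt (Real.logb 2 n) ∧
        9 ≤ Real.logb 2 n := by
  have hlog : Filter.Tendsto (fun n : ℕ => Real.logb 2 (n : ℝ)) Filter.atTop Filter.atTop :=
    (Real.tendsto_logb_atTop one_lt_two).comp tendsto_natCast_atTop_atTop
  have hsq : Filter.Tendsto (fun n : ℕ => Real.sqrt (Real.logb 2 (n : ℝ)))
      Filter.atTop Filter.atTop := Real.tendsto_sqrt_atTop.comp hlog
  have hx : ∀ᶠ x : ℝ in Filter.atTop, 21168 * (x ^ 2 + 1) ^ 2 ≤ (2 : ℝ) ^ x := by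
    have h1 : Filter.Tendsto (fun x : ℝ => x ^ (4 : ℝ) * Real.exp (-Real.log 2 * x))
        Filter.atTop (nhds 0) :=
      tendsto_rpow_mul_exp_neg_mul_atTop_nhds_zero 4 _ (Real.log_pos one_lt_two)
    filter_upwards [h1.eventually (gt_mem_nhds (show (0 : ℝ) < 1 / 84672 by norm_num)),
      Filter.eventually_ge_atTop 1] with x hx hx1
    have h2 : (2 : ℝ) ^ x = Real.exp (Real.log 2 * x) := Real.rpow_def_of_pos two_pos x
    rw [neg_mul, Real.exp_neg, ← h2, ← div_eq_mul_inv, div_lt_iff₀ (by positivity)] at hx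
    have h3 : x ^ (4 : ℝ) = x ^ 4 := by exact_mod_cast Real.rpow_natCast x 4
    rw [h3] at hx
    nlinarith [sq_nonneg x, mul_self_nonneg (x ^ 2 - 1), one_le_pow₀ hx1 (n := 2)]
  filter_upwards [hsq.eventually hx, hlog.eventually_ge_atTop 9] with n h1 h2
  rw [Real.sq_sqrt (by linarith)] at h1
  exact ⟨h1, h2⟩

/-- **Main theorem.**  There is a constant `c > 0` such that for all sufficiently large `n`
there are matrices `P ∈ {0,1}^{n×⌊n/3⌋}` and `Q ∈ {0,1}^{⌊n/3⌋×n}` such that every correct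
witness for `P × Q` has cost at least `n^{7/3} / 2^{c·√(log₂ n)}`. -/
theorem stmt7 :
    ∃ c : ℝ, 0 < c ∧ ∀ᶠ n : ℕ in Filter.atTop,
      ∃ (P : Fin n → Fin (n / 3) → Bool) (Q : Fin (n / 3) → Fin n → Bool),
        ∀ W : WitnessCircuit (n / 3), W.Correct n P →
          (n : ℝ) ^ ((7 : ℝ) / 3) / 2 ^ (c * Real.sqrt (Real.logb 2 n)) ≤ wCost Q W := by
  refine ⟨1, one_pos, ?_⟩
  filter_upwards [eventually_poly_le_two_pow_sqrt_logb, Filter.eventually_gt_atTop 0] with n hn hn0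
  obtain ⟨hpoly, hlog9⟩ := hn
  have hnR : (0 : ℝ) < n := by exact_mod_cast hn0
  set x := Real.sqrt (Real.logb 2 n) with hx
  have hxsq : x ^ 2 = Real.logb 2 n := Real.sq_sqrt (by linarith)
  have hx3 : 3 ≤ x := Real.le_sqrt_of_sq_le (by norm_num; exact hlog9)
  set y : ℝ := (n : ℝ) ^ ((1 : ℝ) / 3) with hy
  have hy0 : 0 < y := by positivity
  have hy3 : y ^ 3 = n := by
    rw [hy, ← Real.rpow_natCast, ← Real.rpow_mul hnR.le]; norm_num
  have hy7 : y ^ 7 = (n : ℝ) ^ ((7 : ℝ) / 3) := by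
    rw [hy, ← Real.rpow_natCast, ← Real.rpow_mul hnR.le]; norm_num
  have h2y : (2 : ℝ) ^ x ≤ y := by
    have h1 : y = (2 : ℝ) ^ (x ^ 2 / 3) := by
      rw [hy, hxsq, div_eq_mul_one_div (Real.logb 2 (n : ℝ)) 3, Real.rpow_mul two_pos.le,
        Real.rpow_logb two_pos (by norm_num) hnR]
    rw [h1]
    exact Real.rpow_le_rpow_of_exponent_le one_le_two (by nlinarith)
  set r := Nat.log 2 n + 1 with hr
  have hr1 : (1 : ℝ) ≤ r := by simp [hr]
  have hrlog : (r : ℝ) ≤ Real.logb 2 n + 1 := by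
    have := Real.natLog_le_logb n 2
    push_cast [hr] at this ⊢
    linarith
  have hrpoly : 21168 * (r : ℝ) ^ 2 ≤ 2 ^ x :=
    le_trans (by gcongr) hpoly
  have hry : 21168 * (r : ℝ) ≤ y := by nlinarith
  have hnr : n < 2 ^ r := Nat.lt_pow_succ_log_self one_lt_two n
  obtain ⟨f, hf⟩ : ∃ f : Fin n × Fin (n / 3) → Bool, ∀ U : Finset (Fin (n / 3)),
      2 * (3 * r) ≤ U.card → (Finset.univ.filter fun a =>
        U ⊆ Finset.univ.filter fun b => pick f a b = true).card ≤ 3 * r := by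
    apply exists_pick_sparse
    have h1 : (n / 3) ^ (2 * (3 * r)) ≤ n ^ (2 * (3 * r)) :=
      Nat.pow_le_pow_left (Nat.div_le_self _ _) _
    calc (n / 3) ^ (2 * (3 * r)) * n ^ (3 * r) ≤ n ^ (2 * (3 * r)) * n ^ (3 * r) :=
          Nat.mul_le_mul_right _ h1
      _ = n ^ (9 * r) := by rw [← pow_add]; congr 1; ring
      _ < (2 ^ r) ^ (9 * r) := Nat.pow_lt_pow_left hnr (by omega)
      _ = 2 ^ (3 * r * (3 * r)) := by rw [← pow_mul]; congr 1; ring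
  set L := ⌊y ^ 2⌋₊ with hLdef
  have hLy : (L : ℝ) ≤ y ^ 2 := Nat.floor_le (by positivity)
  have hL1 : y ^ 2 < L + 1 := Nat.lt_floor_add_one _
  have hybig : 21168 ≤ y := by nlinarith
  have hyy : 21168 * y ≤ y ^ 2 := by nlinarith
  have hyyy : 21168 * y ^ 2 ≤ y ^ 3 := by nlinarith [sq_nonneg y]
  have hrL : 6 * (r : ℝ) ≤ L := by nlinarith
  have hL2 : 2 ≤ L := by
    have : (2 : ℝ) ≤ L := by linarith
    exact_mod_cast this
  have hL0 : (0 : ℝ) < L := by linarith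
  have hm : (n : ℝ) / 6 - 1 ≤ ((n / 3 / 2 : ℕ) : ℝ) := by
    have h1 : n < 6 * (n / 3 / 2) + 6 := by omega
    have h2 : (n : ℝ) < 6 * ((n / 3 / 2 : ℕ) : ℝ) + 6 := by exact_mod_cast h1
    linarith
  have hsm : 2 * (3 * r) ≤ n / 3 / 2 := by
    have : ((2 * (3 * r) : ℕ) : ℝ) ≤ ((n / 3 / 2 : ℕ) : ℝ) := by
      push_cast at hm ⊢
      linarith
    exact_mod_cast this
  refine ⟨pick f, hardQ _ _ L, fun W hW => ?_⟩
  obtain ⟨hD, hS, hfull⟩ := hW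
  obtain ⟨S, c1, c2⟩ := W.exists_counting_bounds hD hS (by omega) hL2
    (s := 2 * (3 * r)) (t := 3 * r) (μ := n / 3 / 2 - 2 * (3 * r)) (by omega) hfull hf
    (fun a => by have := half_le_card_pick f a; omega)
  rw [Nat.sub_add_cancel hsm] at c2
  have d1 : (S : ℝ) * (((n / 3 / 2 : ℕ) : ℝ) - 6 * r) ≤ W.N * (3 * r) * (3 * (6 * r)) := by
    have : ((S * (n / 3 / 2 - 2 * (3 * r)) : ℕ) : ℝ) ≤
      ((W.N * (3 * r) * (3 * (2 * (3 * r))) : ℕ) : ℝ) := by exact_mod_cast c1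
    rw [Nat.cast_mul, Nat.cast_sub hsm] at this
    push_cast at this ⊢
    linarith
  have d2 : (n : ℝ) * ((n / 3 / 2 : ℕ) : ℝ) ≤ S * (6 * r + 3 * L) +
      (W.longClasses n L).card * (3 * r * (((n / (3 * L) : ℕ) : ℝ) + 1)) * (3 * (6 * r)) := by
    have : ((n * (n / 3 / 2) : ℕ) : ℝ) ≤ _ := Nat.cast_le.2 c2
    push_cast at this ⊢
    linarith
  have hdiv : ((n / (3 * L) : ℕ) : ℝ) + 1 ≤ y ^ 3 / L := by
    have h1 : ((n / (3 * L) : ℕ) : ℝ) ≤ (n : ℝ) / ((3 * L : ℕ) : ℝ) := Nat.cast_div_le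
    have h2 : (n : ℝ) / ((3 * L : ℕ) : ℝ) = (y ^ 3 / L) / 3 := by
      rw [hy3]; push_cast; field_simp
    have h3 : 3 ≤ y ^ 3 / L := by
      rw [le_div_iff₀ hL0]; nlinarith
    linarith
  have hfinal := pow_seven_le_of_counting (y := y) (L := L) (N := W.N)
    (τ := (W.longClasses n L).card) (S := S) (ρ := r) hy0 hL0 (Nat.cast_nonneg _) ?_ ?_
    (Nat.cast_nonneg _) hLy (by linarith)
  · have hcost := WitnessCircuit.card_longClasses_mul_le (L := L) hD
    have hW0 : (0 : ℝ) ≤ W.N + (W.longClasses n L).card * L := by positivity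
    rw [one_mul, ← hy7, div_le_iff₀ (by positivity)]
    calc y ^ 7 ≤ 21168 * (r : ℝ) ^ 2 * (W.N + (W.longClasses n L).card * L) := hfinal
      _ ≤ 2 ^ x * (W.N + (W.longClasses n L).card * L) := by gcongr
      _ ≤ 2 ^ x * wCost (hardQ (n / 3) n L) W := by gcongr
      _ = _ := mul_comm _ _
  · have h1 : y ^ 3 / 14 ≤ ((n / 3 / 2 : ℕ) : ℝ) - 6 * r := by rw [hy3]; linarith
    calc (S : ℝ) * (y ^ 3 / 14) ≤ S * (((n / 3 / 2 : ℕ) : ℝ) - 6 * r) := by gcongr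
      _ ≤ _ := d1
      _ = _ := by ring
  · have h1 : (n : ℝ) / 7 ≤ ((n / 3 / 2 : ℕ) : ℝ) := by linarith
    have h2 : S * (6 * (r : ℝ) + 3 * L) ≤ S * (L + 3 * L) :=
      mul_le_mul_of_nonneg_left (by linarith) (Nat.cast_nonneg _)
    have h3 : (W.longClasses n L).card * (3 * r * (((n / (3 * L) : ℕ) : ℝ) + 1)) * (3 * (6 * r)) ≤
        (W.longClasses n L).card * (3 * r * (y ^ 3 / L)) * (3 * (6 * r)) :=
      mul_le_mul_of_nonneg_right (mul_le_mul_of_nonneg_left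
        (mul_le_mul_of_nonneg_left hdiv (by positivity)) (Nat.cast_nonneg _)) (by positivity)
    calc y ^ 3 * (y ^ 3 / 7) = n * ((n : ℝ) / 7) := by rw [hy3]
      _ ≤ n * ((n / 3 / 2 : ℕ) : ℝ) := mul_le_mul_of_nonneg_left h1 hnR.le
      _ ≤ _ := d2
      _ ≤ _ := add_le_add h2 h3
      _ = _ := by ring
end

section
/- Let c₀ ≥ 5 be a constant and n ≥ 2 an integer. Let G be a tripartite graph with parts A, B, C where |A| = |C| = n and |B| ≤ n, with matrices P and Q, and let G̃ be the random graph obtained from G by deleting each A–B edge independently with probability 1/2. Let 1 ≤ m, ℓ ≤ n be integers, let W' be an arbitrary resultant circuit over {0,1}^ℓ with at most n³ gates, let a ∈ A and let K be a subinterval of C with |K| = ℓ. Let E_m be the event that there exists a union witness W for (a,K) in G̃, together with a trimming of W, such that at least m gates of W are (a,K)-chargeable (with respect to c₀) and compatible with some gate of W'. Then there exists an event E'_m with E_m ⊆ E'_m such that E'_m is determined only by the presence or absence in G̃ of the edges between a and the set of middle vertices of the vertices of K ∩ C[a]_G, and Pr[E_m] ≤ Pr[E'_m] ≤ 2^{−m−(c₀−5)·log₂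 n}. -/
open scoped Classical

/-- The subinterval of `C = Fin nC` of length `l` starting at `s`, as a set of columns. -/
def Kfin (nC s l : ℕ) : Finset (Fin nC) :=
  Finset.univ.filter fun c => s ≤ c.val ∧ c.val < s + l

/-- The restriction `row(Q_S)|_K` of `row(Q_S) = ⋁_{b∈S} Q_b` to the subinterval `K` of
length `l` starting at column `s`, as a bit string of length `l`. -/
noncomputable def strvec {nB nC : ℕ} (Q : Fin nB → Fin nC → Bool) (S : Finset (Fin nB))
    (s l : ℕ) : (k : ℕ) × (Fin k → Bool) :=
  ⟨l, fun t =>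
    if h : s + t.val < nC then S.sup fun b => Q b ⟨s + t.val, h⟩ else false⟩

/-- A resultant circuit over `{0,1}^l`: a finite DAG of gates of in-degree `0` or `2`, each
gate `g` carrying a vector `res g ∈ {0,1}^l`, with `res g = res (left g) ∨ res (right g)`
for binary gates. -/
structure ResCircuit (l : ℕ) where
  N : ℕ
  inp : Fin N → Bool
  left : Fin N → Fin N
  right : Fin N → Fin N
  res : Fin N → Fin l → Bool
  hacyc : ∀ g, inp g = false → left g < g ∧ right g < g
  hres : ∀ g, inp g = false → ∀ t, res g t = (res (left g) t || res (right g) t)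

/-- A resultant circuit over `{0,1}^l` is consistent with `Q` if there is a subinterval
`K₀` of `C` of size `l` such that every input gate carries `Q_b|_{K₀}` for some `b ∈ B`. -/
def Consistent {l nB nC : ℕ} (Q : Fin nB → Fin nC → Bool) (W' : ResCircuit l) : Prop :=
  ∃ s : ℕ, s + l ≤ nC ∧ ∀ g, W'.inp g = true → ∃ b : Fin nB,
    (⟨l, W'.res g⟩ : (k : ℕ) × (Fin k → Bool)) = strvec Q ({b} : Finset (Fin nB)) s l

/-- `W` with output gate `gout` is a union witness for `a` in `G̃` (adjacency matrix `P'`):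
`gout` is the unique gate of out-degree `0`, `wset gout` is the set of `B`-neighbours of
`a` in `G̃`, and every input gate carries `{b}` for some `b` adjacent to `a` in `G̃`. -/
def IsUnionWitness {nA nB : ℕ} (P' : Fin nA → Fin nB → Bool) (a : Fin nA)
    (W : UnionCircuit nB) (gout : Fin W.N) : Prop :=
  (∀ h, W.inp h = false → W.left h ≠ gout ∧ W.right h ≠ gout) ∧
  (∀ g, (∀ h, W.inp h = false → W.left h ≠ g ∧ W.right h ≠ g) → g = gout) ∧
  W.wset gout = (Finset.univ.filter fun b => P' a b = true) ∧
  (∀ g, W.inp g = true → ∃ b, P' a b = true ∧ W.wset g = {b})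

/-- A trimming of a union circuit with output gate `gout`: `trim g ⊆ wset g`,
`trim gout = wset gout`, and for every binary gate the trim is the disjoint union of the
trims of its children. -/
def IsTrimming {nB : ℕ} (W : UnionCircuit nB) (gout : Fin W.N)
    (trim : Fin W.N → Finset (Fin nB)) : Prop :=
  (∀ g, trim g ⊆ W.wset g) ∧ trim gout = W.wset gout ∧
  ∀ g, W.inp g = false →
    trim g = trim (W.left g) ∪ trim (W.right g) ∧
      Disjoint (trim (W.left g)) (trim (W.right g))

/-- A binary gate `g` is `(a,K)`-chargeable (with respect to `c₀`, for a circuit with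
trimming `trim`, where `βK = β'_{a,G̃}(K)`): `|trim g ∩ βK| ≥ c₀·log₂ n` and both
`trim (left g) ∩ βK` and `trim (right g) ∩ βK` differ from `trim g ∩ βK`. -/
def Chargeable (n : ℕ) (c₀ : ℝ) {nB : ℕ} (W : UnionCircuit nB)
    (trim : Fin W.N → Finset (Fin nB)) (βK : Finset (Fin nB)) (g : Fin W.N) : Prop :=
  W.inp g = false ∧ c₀ * Real.logb 2 n ≤ ((trim g ∩ βK).card : ℝ) ∧
  trim (W.left g) ∩ βK ≠ trim g ∩ βK ∧ trim (W.right g) ∩ βK ≠ trim g ∩ βK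

/-- The probability of the event `E` when each `A–B` edge of `G` (adjacency matrix `P`) is
deleted independently with probability `1/2`, i.e., under the uniform distribution on
subgraphs `P' ≤ P`. -/
noncomputable def prOmega {nA nB : ℕ} (P : Fin nA → Fin nB → Bool)
    (E : (Fin nA → Fin nB → Bool) → Prop) : ℝ :=
  ((Finset.univ.filter fun P' : Fin nA → Fin nB → Bool =>
      (∀ a b, P' a b = true → P a b = true) ∧ E P').card : ℝ) /
  ((Finset.univ.filter fun P' : Fin nA → Fin nB → Bool =>
      ∀ a b, P' a b = true → P a b = true).card : ℝ)

/-- The event `E_m`: there exists a union witness `W` for `(a, K)` in `G̃` (where `K` is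
the subinterval of length `l` starting at `s`), together with a trimming, such that at
least `m` gates of `W` are `(a,K)`-chargeable and compatible with some gate of `W'`. -/
def Em {n nB : ℕ} (c₀ : ℝ) (P : Fin n → Fin nB → Bool) (Q : Fin nB → Fin n → Bool)
    {l : ℕ} (W' : ResCircuit l) (a : Fin n) (s m : ℕ)
    (P' : Fin n → Fin nB → Bool) : Prop :=
  ∃ (W : UnionCircuit nB) (gout : Fin W.N) (trim : Fin W.N → Finset (Fin nB)),
    IsUnionWitness P' a W gout ∧ IsTrimming W gout trim ∧
    m ≤ (Finset.univ.filter fun g : Fin W.N =>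
      Chargeable n c₀ W trim (beta' P P' Q a (Kfin n s l)) g ∧
      ∃ g' : Fin W'.N,
        strvec Q (W.wset g) s l = (⟨l, W'.res g'⟩ : (k : ℕ) × (Fin k → Bool))).card

/-- The parent-to-child relation of a union circuit. -/
def UnionCircuit.Child {nB : ℕ} (W : UnionCircuit nB) (g h : Fin W.N) : Prop :=
  W.inp g = false ∧ (h = W.left g ∨ h = W.right g)

/-- The members of `X` reachable from `g` by descending in the circuit. -/
noncomputable def UnionCircuit.below {nB : ℕ} (W : UnionCircuit nB) (X : Finset (Fin W.N))
    (g : Fin W.N) : Finset (Fin W.N) :=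
  X.filter fun x => Relation.ReflTransGen W.Child g x

/-- The middle vertices in `B` of vertices `c ∈ K` unique for `a` at which the gate `g'` of the
resultant circuit carries a one. -/
noncomputable def resSet {n nB l : ℕ} (P : Fin n → Fin nB → Bool) (Q : Fin nB → Fin n → Bool)
    (W' : ResCircuit l) (a : Fin n) (s : ℕ) (g' : Fin W'.N) : Finset (Fin nB) :=
  Finset.univ.filter fun b => ∃ (t : Fin l) (h : s + t.val < n),
    W'.res g' t = true ∧ UniqueFor P Q a ⟨s + t.val, h⟩ ∧ P a b = true ∧
      Q b ⟨s + t.val, h⟩ = true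

theorem Finset.sup_bool_eq_true_iff {ι : Type*} (S : Finset ι) (f : ι → Bool) :
    S.sup f = true ↔ ∃ i ∈ S, f i = true := by
  induction S using Finset.induction with
  | empty => simp
  | insert i S _ ih => simp [Finset.sup_insert, ih]

namespace UnionCircuit

variable {nB : ℕ} (W : UnionCircuit nB)

theorem induction_children {p : Fin W.N → Prop}
    (hinp : ∀ g, W.inp g = true → p g)
    (hbin : ∀ g, W.inp g = false → p (W.left g) → p (W.right g) → p g) (g : Fin W.N) : p g := by
  induction g using WellFoundedLT.induction with
  | ind g ih =>
    cases hg : W.inp g with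
    | true => exact hinp g hg
    | false => exact hbin g hg (ih _ (W.hacyc g hg).1) (ih _ (W.hacyc g hg).2)

theorem reachable_of_unique_output {gout : Fin W.N}
    (h : ∀ g, (∀ h, W.inp h = false → W.left h ≠ g ∧ W.right h ≠ g) → g = gout)
    (g : Fin W.N) : Relation.ReflTransGen W.Child gout g := by
  induction g using WellFoundedGT.induction with
  | ind g ih =>
    by_cases hg : g = gout
    · rw [hg]
    · have : ∃ p, W.Child p g := by
        by_contra! hc
        refine hg (h g fun p hp => ⟨fun e => hc p ⟨hp, Or.inl e.symm⟩,
          fun e => hc p ⟨hp, Or.inr e.symm⟩⟩)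
      obtain ⟨p, hp⟩ := this
      have hlt : g < p := by
        rcases hp with ⟨hp, rfl | rfl⟩
        · exact (W.hacyc p hp).1
        · exact (W.hacyc p hp).2
      exact (ih p hlt).tail hp

variable {W}

theorem below_subset (X : Finset (Fin W.N)) {g : Fin W.N} :
    W.below X g ⊆ insert g (W.below X (W.left g) ∪ W.below X (W.right g)) := by
  intro x hx
  simp only [below, Finset.mem_filter, Finset.mem_insert, Finset.mem_union] at hx ⊢
  rcases hx with ⟨hxX, hx⟩
  rcases hx.cases_head with rfl | ⟨c, ⟨_, rfl | rfl⟩, hc⟩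
  · exact Or.inl rfl
  · exact Or.inr (Or.inl ⟨hxX, hc⟩)
  · exact Or.inr (Or.inr ⟨hxX, hc⟩)

theorem below_subset_of_notMem {X : Finset (Fin W.N)} {g : Fin W.N} (hg : g ∉ X) :
    W.below X g ⊆ W.below X (W.left g) ∪ W.below X (W.right g) := by
  intro x hx
  rcases Finset.mem_insert.1 (below_subset X hx) with rfl | h
  · exact absurd (Finset.mem_filter.1 hx).1 hg
  · exact h

theorem below_input {X : Finset (Fin W.N)} (hX : ∀ x ∈ X, W.inp x = false) {g : Fin W.N}
    (hg : W.inp g = true) : W.below X g = ∅ := by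
  refine Finset.eq_empty_of_forall_notMem fun x hx => ?_
  obtain ⟨hxX, hx⟩ := Finset.mem_filter.1 hx
  rcases hx.cases_head with rfl | ⟨c, hc, -⟩
  · simp [hX _ hxX] at hg
  · simp [hc.1] at hg

section Counting

variable {trim : Fin W.N → Finset (Fin nB)} {β : Finset (Fin nB)} {X : Finset (Fin W.N)} {L : ℕ}

theorem card_trim_inter
    (htrim : ∀ g, W.inp g = false →
      trim g = trim (W.left g) ∪ trim (W.right g) ∧ Disjoint (trim (W.left g)) (trim (W.right g)))
    {g : Fin W.N} (hg : W.inp g = false) :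
    (trim g ∩ β).card = (trim (W.left g) ∩ β).card + (trim (W.right g) ∩ β).card := by
  rw [(htrim g hg).1, Finset.union_inter_distrib_right, Finset.card_union_of_disjoint]
  exact (htrim g hg).2.mono Finset.inter_subset_left Finset.inter_subset_left

theorem card_below_le (hL : 2 ≤ L)
    (htrim : ∀ g, W.inp g = false →
      trim g = trim (W.left g) ∪ trim (W.right g) ∧ Disjoint (trim (W.left g)) (trim (W.right g)))
    (hX : ∀ x ∈ X, W.inp x = false ∧ L ≤ (trim x ∩ β).card ∧
      trim (W.left x) ∩ β ≠ trim x ∩ β ∧ trim (W.right x) ∩ β ≠ trim x ∩ β) (g : Fin W.N) :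
    (W.below X g).card ≤ (trim g ∩ β).card + 1 - L := by
  induction g using W.induction_children with
  | hinp g hg => simp [below_input (fun x hx => (hX x hx).1) hg]
  | hbin g hg ihl ihr =>
    have ht := card_trim_inter (β := β) htrim hg
    by_cases hgX : g ∈ X
    · obtain ⟨-, hLg, hl, hr⟩ := hX g hgX
      have hl' : (trim (W.left g) ∩ β).card ≠ (trim g ∩ β).card := fun h =>
        hl (Finset.eq_of_subset_of_card_le (Finset.inter_subset_inter_right
          ((htrim g hg).1 ▸ Finset.subset_union_left)) h.ge)
      have hr' : (trim (W.right g) ∩ β).card ≠ (trim g ∩ β).card := fun h =>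
        hr (Finset.eq_of_subset_of_card_le (Finset.inter_subset_inter_right
          ((htrim g hg).1 ▸ Finset.subset_union_right)) h.ge)
      have h1 := (Finset.card_le_card (below_subset X (g := g))).trans (Finset.card_insert_le _ _)
      have h2 := Finset.card_union_le (W.below X (W.left g)) (W.below X (W.right g))
      omega
    · have h1 := Finset.card_le_card (below_subset_of_notMem hgX)
      have h2 := Finset.card_union_le (W.below X (W.left g)) (W.below X (W.right g))
      omega

theorem exists_top_gates (hL : 2 ≤ L)
    (htrim : ∀ g, W.inp g = false →
      trim g = trim (W.left g) ∪ trim (W.right g) ∧ Disjoint (trim (W.left g)) (trim (W.right g)))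
    (hX : ∀ x ∈ X, W.inp x = false ∧ L ≤ (trim x ∩ β).card ∧
      trim (W.left x) ∩ β ≠ trim x ∩ β ∧ trim (W.right x) ∩ β ≠ trim x ∩ β) (g : Fin W.N) :
    ∃ M ⊆ X, (∀ x ∈ M, trim x ⊆ trim g) ∧
      (W.below X g).card + M.card * (L - 1) ≤ (M.biUnion fun x => trim x ∩ β).card := by
  induction g using W.induction_children with
  | hinp g hg => exact ⟨∅, by simp [below_input (fun x hx => (hX x hx).1) hg]⟩
  | hbin g hg ihl ihr =>
    by_cases hgX : g ∈ X
    · refine ⟨{g}, by simpa using hgX, by simp, ?_⟩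
      have h1 := card_below_le hL htrim hX g
      have h2 := (hX g hgX).2.1
      simp only [Finset.card_singleton, Finset.singleton_biUnion]
      omega
    · obtain ⟨M₁, h₁X, h₁, hc₁⟩ := ihl
      obtain ⟨M₂, h₂X, h₂, hc₂⟩ := ihr
      obtain ⟨hu, hd⟩ := htrim g hg
      refine ⟨M₁ ∪ M₂, Finset.union_subset h₁X h₂X, ?_, ?_⟩
      · intro x hx
        rw [hu]
        rcases Finset.mem_union.1 hx with hx | hx
        · exact (h₁ x hx).trans Finset.subset_union_left
        · exact (h₂ x hx).trans Finset.subset_union_right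
      · have hdis : Disjoint (M₁.biUnion fun x => trim x ∩ β) (M₂.biUnion fun x => trim x ∩ β) := by
          refine hd.mono ?_ ?_
          · exact Finset.biUnion_subset.2 fun x hx => Finset.inter_subset_left.trans (h₁ x hx)
          · exact Finset.biUnion_subset.2 fun x hx => Finset.inter_subset_left.trans (h₂ x hx)
        rw [Finset.union_biUnion, Finset.card_union_of_disjoint hdis]
        have h3 := Finset.card_le_card (below_subset_of_notMem hgX)
        have h4 := Finset.card_union_le (W.below X (W.left g)) (W.below X (W.right g))
        have h5 := Nat.mul_le_mul_right (L - 1) (Finset.card_union_le M₁ M₂)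
        rw [Nat.add_mul] at h5
        omega

end Counting

end UnionCircuit

theorem IsUnionWitness.wset_adj {nA nB : ℕ} {P' : Fin nA → Fin nB → Bool} {a : Fin nA}
    {W : UnionCircuit nB} {gout : Fin W.N} (h : IsUnionWitness P' a W gout) (g : Fin W.N) :
    ∀ b ∈ W.wset g, P' a b = true := by
  induction g using W.induction_children with
  | hinp g hg =>
    obtain ⟨b, hb, hw⟩ := h.2.2.2 g hg
    simpa [hw] using hb
  | hbin g hg ihl ihr =>
    intro b hb
    rw [W.hwset g hg, Finset.mem_union] at hb
    exact hb.elim (ihl b) (ihr b)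

section Compatible

variable {n nB l : ℕ} {P P' : Fin n → Fin nB → Bool} {Q : Fin nB → Fin n → Bool}
  {W' : ResCircuit l} {a : Fin n} {s : ℕ}

theorem resSet_subset (g' : Fin W'.N) : resSet P Q W' a s g' ⊆ beta' P P Q a (Kfin n s l) := by
  intro b hb
  simp only [resSet, beta', Kfin, Finset.mem_filter, Finset.mem_univ, true_and] at hb ⊢
  obtain ⟨t, ht, -, hu, hP, hQ⟩ := hb
  exact ⟨hP, _, ⟨by simp, by simp⟩, hu, hP, hQ⟩

theorem res_eq_true_iff {S : Finset (Fin nB)} {g' : Fin W'.N}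
    (h : strvec Q S s l = (⟨l, W'.res g'⟩ : (k : ℕ) × (Fin k → Bool))) (t : Fin l)
    (ht : s + t.val < n) :
    W'.res g' t = true ↔ ∃ b ∈ S, Q b ⟨s + t.val, ht⟩ = true := by
  have h' := congrFun (eq_of_heq (Sigma.mk.inj_iff.1 h).2) t
  rw [← h', dif_pos ht, Finset.sup_bool_eq_true_iff]

theorem inter_beta'_subset_resSet {S : Finset (Fin nB)} {g' : Fin W'.N}
    (h : strvec Q S s l = (⟨l, W'.res g'⟩ : (k : ℕ) × (Fin k → Bool))) :
    S ∩ beta' P P' Q a (Kfin n s l) ⊆ resSet P Q W' a s g' := by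
  intro b hb
  simp only [resSet, beta', Kfin, Finset.mem_inter, Finset.mem_filter, Finset.mem_univ,
    true_and] at hb ⊢
  obtain ⟨hbS, -, c, ⟨hc1, hc2⟩, hu, hP, hQ⟩ := hb
  have e : s + (c.val - s) = c.val := by omega
  have ht : s + (c.val - s) < n := e.trans_lt c.2
  have ec : (⟨s + (c.val - s), ht⟩ : Fin n) = c := Fin.ext e
  refine ⟨⟨c.val - s, by omega⟩, ht, (res_eq_true_iff h _ ht).2 ⟨b, hbS, ?_⟩, ?_, hP, ?_⟩
  all_goals simpa only [ec]

theorem adj_of_mem_resSet (hP' : ∀ a b, P' a b = true → P a b = true) {S : Finset (Fin nB)}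
    (hS : ∀ b ∈ S, P' a b = true) {g' : Fin W'.N}
    (h : strvec Q S s l = (⟨l, W'.res g'⟩ : (k : ℕ) × (Fin k → Bool))) :
    ∀ b ∈ resSet P Q W' a s g', P' a b = true := by
  intro b hb
  obtain ⟨t, ht, hr, hu, hP, hQ⟩ := (Finset.mem_filter.1 hb).2
  obtain ⟨b', hb', hQ'⟩ := (res_eq_true_iff h t ht).1 hr
  rw [hu.unique ⟨hP, hQ⟩ ⟨hP' _ _ (hS b' hb'), hQ'⟩]
  exact hS b' hb'

/-- The randomization event: for some nonempty set `T` of gates of `W'`, the vertices of `B`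
forced by `T` number at least `m + |T|·(L - 1)` and all remain adjacent to `a`. -/
def ForcedEvent (P : Fin n → Fin nB → Bool) (Q : Fin nB → Fin n → Bool)
    (W' : ResCircuit l) (a : Fin n) (s m L : ℕ) (P' : Fin n → Fin nB → Bool) : Prop :=
  ∃ T : Finset (Fin W'.N), T.Nonempty ∧
    m + T.card * (L - 1) ≤ (T.biUnion (resSet P Q W' a s)).card ∧
    ∀ b ∈ T.biUnion (resSet P Q W' a s), P' a b = true

theorem Em.forcedEvent {c₀ : ℝ} {m L : ℕ} (hm : 1 ≤ m) (hL : 2 ≤ L)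
    (hL' : L = ⌈c₀ * Real.logb 2 n⌉₊)
    (hP' : ∀ a b, P' a b = true → P a b = true) (h : Em c₀ P Q W' a s m P') :
    ForcedEvent P Q W' a s m L P' := by
  obtain ⟨W, gout, trim, hW, ⟨htw, -, htrim⟩, hcard⟩ := h
  set β := beta' P P' Q a (Kfin n s l)
  set X := Finset.univ.filter fun g : Fin W.N => Chargeable n c₀ W trim β g ∧
      ∃ g' : Fin W'.N,
        strvec Q (W.wset g) s l = (⟨l, W'.res g'⟩ : (k : ℕ) × (Fin k → Bool))
  have hX : ∀ x ∈ X, W.inp x = false ∧ L ≤ (trim x ∩ β).card ∧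
      trim (W.left x) ∩ β ≠ trim x ∩ β ∧ trim (W.right x) ∩ β ≠ trim x ∩ β := by
    intro x hx
    obtain ⟨h1, h2, h3⟩ := (Finset.mem_filter.1 hx).2.1
    exact ⟨h1, hL' ▸ Nat.ceil_le.2 h2, h3⟩
  have hcomp : ∀ x ∈ X, ∃ g' : Fin W'.N,
      strvec Q (W.wset x) s l = (⟨l, W'.res g'⟩ : (k : ℕ) × (Fin k → Bool)) :=
    fun x hx => (Finset.mem_filter.1 hx).2.2
  obtain ⟨M, hMX, -, hM⟩ := UnionCircuit.exists_top_gates hL htrim hX gout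
  have hbelow : W.below X gout = X :=
    Finset.filter_true_of_mem fun x _ => W.reachable_of_unique_output hW.2.1 x
  rw [hbelow] at hM
  obtain ⟨x₀, hx₀⟩ : X.Nonempty := Finset.card_pos.1 (by omega)
  have : Nonempty (Fin W'.N) := (hcomp x₀ hx₀).nonempty
  choose! f hf using hcomp
  have hsub : (M.biUnion fun x => trim x ∩ β) ⊆ (M.image f).biUnion (resSet P Q W' a s) := by
    rw [Finset.image_biUnion]
    refine Finset.biUnion_mono fun x hx => ?_
    exact (Finset.inter_subset_inter_right (htw x)).trans
      (inter_beta'_subset_resSet (hf x (hMX hx)))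
  refine ⟨M.image f, ?_, ?_, ?_⟩
  · refine Finset.Nonempty.image (Finset.nonempty_iff_ne_empty.2 ?_) f
    rintro rfl
    simp only [Finset.biUnion_empty, Finset.card_empty] at hM
    omega
  · have h1 := Finset.card_le_card hsub
    have h2 := Nat.mul_le_mul_right (L - 1) (Finset.card_image_le (s := M) (f := f))
    omega
  · intro b hb
    rw [Finset.image_biUnion, Finset.mem_biUnion] at hb
    obtain ⟨x, hx, hb⟩ := hb
    exact adj_of_mem_resSet hP' (hW.wset_adj x) (hf x (hMX hx)) b hb

end Compatible

section Probability

variable {nA nB : ℕ} {P : Fin nA → Fin nB → Bool}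

theorem prOmega_mono {E F : (Fin nA → Fin nB → Bool) → Prop}
    (h : ∀ P', (∀ a b, P' a b = true → P a b = true) → E P' → F P') :
    prOmega P E ≤ prOmega P F := by
  unfold prOmega
  gcongr with P' hP'
  exact fun hE => h P' ‹_› hE

theorem prOmega_exists_le {ι : Type*} (I : Finset ι) (E : ι → (Fin nA → Fin nB → Bool) → Prop) :
    prOmega P (fun P' => ∃ i ∈ I, E i P') ≤ ∑ i ∈ I, prOmega P (E i) := by
  unfold prOmega
  rw [← Finset.sum_div]
  gcongr
  rw [← Nat.cast_sum]
  refine Nat.cast_le.2 (le_trans (Finset.card_le_card ?_) Finset.card_biUnion_le)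
  intro P' hP'
  simp only [Finset.mem_filter, Finset.mem_univ, true_and, Finset.mem_biUnion] at hP' ⊢
  obtain ⟨h, i, hi, hE⟩ := hP'
  exact ⟨i, hi, h, hE⟩

theorem prOmega_forall_adj_le (a : Fin nA) (S : Finset (Fin nB)) :
    prOmega P (fun P' => ∀ b ∈ S, P' a b = true) ≤ (1 / 2 : ℝ) ^ S.card := by
  unfold prOmega
  set good := Finset.univ.filter fun P' : Fin nA → Fin nB → Bool =>
      (∀ a b, P' a b = true → P a b = true) ∧ ∀ b ∈ S, P' a b = true
  set all := Finset.univ.filter fun P' : Fin nA → Fin nB → Bool =>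
      ∀ a b, P' a b = true → P a b = true
  have hpos : 0 < all.card := Finset.card_pos.2 ⟨fun _ _ => false, by simp [all]⟩
  have key : (S.powerset ×ˢ good).card ≤ all.card := by
    refine Finset.card_le_card_of_injOn
      (fun p a' b => if a' = a ∧ b ∈ p.1 then false else p.2 a' b) ?_ ?_
    · rintro ⟨R, P'⟩ hp
      simp only [Finset.coe_product, Set.mem_prod, Finset.mem_coe, good, all,
        Finset.mem_filter, Finset.mem_univ, true_and] at hp ⊢
      intro a' b hb
      split_ifs at hb
      exact hp.2.1 a' b hb
    · rintro ⟨R₁, P₁⟩ h₁ ⟨R₂, P₂⟩ h₂ h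
      simp only [Finset.coe_product, Set.mem_prod, Finset.mem_coe, good, Finset.mem_powerset,
        Finset.mem_filter, Finset.mem_univ, true_and] at h₁ h₂
      have hv : ∀ a' b, (if a' = a ∧ b ∈ R₁ then false else P₁ a' b) =
          if a' = a ∧ b ∈ R₂ then false else P₂ a' b := fun a' b => congrFun (congrFun h a') b
      have hR : R₁ = R₂ := by
        ext b
        have hb := hv a b
        constructor
        · intro hb₁
          by_contra hb₂
          simp [hb₁, hb₂, h₂.2.2 b (h₁.1 hb₁)] at hb
        · intro hb₂
          by_contra hb₁
          simp [hb₁, hb₂, h₁.2.2 b (h₂.1 hb₂)] at hb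
      subst hR
      refine Prod.ext rfl (funext fun a' => funext fun b => ?_)
      by_cases hab : a' = a ∧ b ∈ R₁
      · rw [hab.1]
        exact (h₁.2.2 b (h₁.1 hab.2)).trans (h₂.2.2 b (h₁.1 hab.2)).symm
      · simpa [hab] using hv a' b
  rw [Finset.card_product, Finset.card_powerset] at key
  have key' : (2 : ℝ) ^ S.card * good.card ≤ all.card := by exact_mod_cast key
  rw [div_le_iff₀ (by exact_mod_cast hpos), one_div, inv_pow, inv_mul_eq_div,
    le_div_iff₀ (by positivity), mul_comm]
  refine le_trans (le_of_eq ?_) key'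
  congr!

end Probability

theorem Finset.sum_nonempty_pow_card_le {ι : Type*} [Fintype ι] {y : ℝ} (hy : 0 ≤ y)
    (hy1 : Fintype.card ι * y ≤ 1) :
    ∑ T ∈ (Finset.univ : Finset (Finset ι)) with T.Nonempty, y ^ T.card ≤
      2 * (Fintype.card ι * y) := by
  have h1 : ∑ T : Finset ι, y ^ T.card = (y + 1) ^ Fintype.card ι := by
    simpa using Fintype.sum_pow_mul_eq_add_pow ι y 1
  have h2 : ∑ T ∈ (Finset.univ : Finset (Finset ι)) with T.Nonempty, y ^ T.card
      = (∑ T : Finset ι, y ^ T.card) - 1 := by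
    have : ((Finset.univ : Finset (Finset ι)).filter fun T => T.Nonempty) =
        Finset.univ.erase ∅ := by
      ext T
      simp [Finset.nonempty_iff_ne_empty]
    rw [this, ← Finset.sum_erase_add _ _ (Finset.mem_univ (∅ : Finset ι))]
    simp
  have h3 : (y + 1) ^ Fintype.card ι ≤ Real.exp (Fintype.card ι * y) := by
    rw [Real.exp_nat_mul]
    gcongr
    exact Real.add_one_le_exp y
  have h4 := Real.abs_exp_sub_one_le (x := Fintype.card ι * y)
    (by rwa [abs_of_nonneg (by positivity)])
  rw [abs_of_nonneg (a := (Fintype.card ι * y : ℝ)) (by positivity)] at h4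
  linarith [le_abs_self (Real.exp (Fintype.card ι * y) - 1)]

theorem prOmega_forcedEvent_le {n nB l : ℕ} (P : Fin n → Fin nB → Bool)
    (Q : Fin nB → Fin n → Bool) (W' : ResCircuit l) (a : Fin n) (s m L : ℕ)
    (hN : (W'.N : ℝ) * (1 / 2 : ℝ) ^ (L - 1) ≤ 1) :
    prOmega P (ForcedEvent P Q W' a s m L) ≤
      (1 / 2 : ℝ) ^ m * (2 * (W'.N * (1 / 2 : ℝ) ^ (L - 1))) := by
  set I := (Finset.univ : Finset (Finset (Fin W'.N))).filter fun T => T.Nonempty ∧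
    m + T.card * (L - 1) ≤ (T.biUnion (resSet P Q W' a s)).card
  calc prOmega P (ForcedEvent P Q W' a s m L)
      ≤ prOmega P (fun P' => ∃ T ∈ I, ∀ b ∈ T.biUnion (resSet P Q W' a s), P' a b = true) := by
        refine prOmega_mono fun P' _ ⟨T, h1, h2, h3⟩ => ⟨T, ?_, h3⟩
        exact Finset.mem_filter.2 ⟨Finset.mem_univ _, h1, h2⟩
    _ ≤ ∑ T ∈ I, prOmega P (fun P' => ∀ b ∈ T.biUnion (resSet P Q W' a s), P' a b = true) :=
        prOmega_exists_le I _
    _ ≤ ∑ T ∈ I, (1 / 2 : ℝ) ^ m * ((1 / 2 : ℝ) ^ (L - 1)) ^ T.card := by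
        refine Finset.sum_le_sum fun T hT => (prOmega_forall_adj_le a _).trans ?_
        rw [← pow_mul, ← pow_add, mul_comm (L - 1)]
        exact pow_le_pow_of_le_one (by norm_num) (by norm_num) (Finset.mem_filter.1 hT).2.2
    _ ≤ ∑ T ∈ (Finset.univ : Finset (Finset (Fin W'.N))) with T.Nonempty,
          (1 / 2 : ℝ) ^ m * ((1 / 2 : ℝ) ^ (L - 1)) ^ T.card := by
        refine Finset.sum_le_sum_of_subset_of_nonneg ?_ fun _ _ _ => by positivity
        intro T hT
        exact Finset.mem_filter.2 ⟨Finset.mem_univ _, (Finset.mem_filter.1 hT).2.1⟩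
    _ ≤ _ := by
        rw [← Finset.mul_sum]
        gcongr
        simpa using Finset.sum_nonempty_pow_card_le (ι := Fin W'.N)
          (y := (1 / 2 : ℝ) ^ (L - 1)) (by positivity) (by simpa using hN)

/-- **Lemma (randomization).**  Let `c₀ ≥ 5`, `n ≥ 2`, `G` tripartite with
`|A| = |C| = n`, `|B| ≤ n`, matrices `P, Q`, and let `G̃` be the random graph obtained by
deleting each `A–B` edge independently with probability `1/2`.  Let `1 ≤ m, l ≤ n`, let
`W'` be a resultant circuit over `{0,1}^l` with at most `n³` gates, `a ∈ A` and `K` the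
subinterval of `C` of length `l` starting at `s`.  Then there is an event `E'_m ⊇ E_m`,
determined only by the presence of the edges between `a` and the set of middle vertices of
the vertices of `K ∩ C[a]_G`, with `Pr[E_m] ≤ Pr[E'_m] ≤ 2^{−m−(c₀−5)·log₂ n}`. -/
theorem stmt9 (c₀ : ℝ) (hc₀ : 5 ≤ c₀) (n : ℕ) (hn : 2 ≤ n) (nB : ℕ) (hnB : nB ≤ n)
    (P : Fin n → Fin nB → Bool) (Q : Fin nB → Fin n → Bool)
    (m l : ℕ) (hm1 : 1 ≤ m) (hmn : m ≤ n) (hl1 : 1 ≤ l) (hln : l ≤ n)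
    (W' : ResCircuit l) (hW' : W'.N ≤ n ^ 3)
    (a : Fin n) (s : ℕ) (hK : s + l ≤ n) :
    ∃ E' : (Fin n → Fin nB → Bool) → Prop,
      (∀ P', (∀ a' b, P' a' b = true → P a' b = true) →
        Em c₀ P Q W' a s m P' → E' P') ∧
      (∀ P₁ P₂ : Fin n → Fin nB → Bool,
        (∀ b ∈ beta' P P Q a (Kfin n s l), P₁ a b = P₂ a b) → (E' P₁ ↔ E' P₂)) ∧
      prOmega P (Em c₀ P Q W' a s m) ≤ prOmega P E' ∧
      prOmega P E' ≤ (2 : ℝ) ^ (-(m : ℝ) - (c₀ - 5) * Real.logb 2 n) := by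
  have hn0 : (0 : ℝ) < n := by positivity
  have hlog : 1 ≤ Real.logb 2 n := by
    rw [Real.le_logb_iff_rpow_le (by norm_num) hn0]
    simpa using (by exact_mod_cast hn : (2 : ℝ) ≤ n)
  set lg := Real.logb 2 n with hlg
  have hnlg : (2 : ℝ) ^ lg = n := Real.rpow_logb (by norm_num) (by norm_num) hn0
  have hc : 5 ≤ c₀ * lg := by nlinarith
  obtain ⟨L, hL'⟩ : ∃ L, L = ⌈c₀ * lg⌉₊ := ⟨_, rfl⟩
  have hLc : c₀ * lg ≤ L := hL' ▸ Nat.le_ceil _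
  have hL : 2 ≤ L := by
    have : (2 : ℝ) ≤ L := by linarith
    exact_mod_cast this
  have hN : (W'.N : ℝ) * (1 / 2 : ℝ) ^ (L - 1) ≤ (2 : ℝ) ^ (-1 - (c₀ - 5) * lg) := by
    have h1 : (W'.N : ℝ) ≤ (2 : ℝ) ^ (3 * lg) := by
      rw [mul_comm, Real.rpow_mul (by norm_num), hnlg]
      exact_mod_cast hW'
    have h2 : (1 / 2 : ℝ) ^ (L - 1) = (2 : ℝ) ^ (1 - (L : ℝ)) := by
      rw [one_div, inv_pow, ← Real.rpow_natCast, ← Real.rpow_neg (by norm_num),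
        Nat.cast_sub (by omega)]
      congr 1
      push_cast
      ring
    calc (W'.N : ℝ) * (1 / 2 : ℝ) ^ (L - 1)
        ≤ (2 : ℝ) ^ (3 * lg) * (2 : ℝ) ^ (1 - (L : ℝ)) := by rw [h2]; gcongr
      _ = (2 : ℝ) ^ (3 * lg + (1 - (L : ℝ))) := (Real.rpow_add (by norm_num) _ _).symm
      _ ≤ (2 : ℝ) ^ (-1 - (c₀ - 5) * lg) :=
        Real.rpow_le_rpow_of_exponent_le (by norm_num) (by linarith)
  have hN1 : (W'.N : ℝ) * (1 / 2 : ℝ) ^ (L - 1) ≤ 1 :=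
    hN.trans (Real.rpow_le_one_of_one_le_of_nonpos (by norm_num) (by nlinarith))
  have hsub : ∀ P', (∀ a' b, P' a' b = true → P a' b = true) →
      Em c₀ P Q W' a s m P' → ForcedEvent P Q W' a s m L P' :=
    fun P' hP' h => h.forcedEvent hm1 hL hL' hP'
  refine ⟨ForcedEvent P Q W' a s m L, hsub, ?_, prOmega_mono hsub, ?_⟩
  · intro P₁ P₂ h
    refine exists_congr fun T => and_congr_right fun _ => and_congr_right fun _ =>
      forall₂_congr fun b hb => ?_
    obtain ⟨g', -, hb⟩ := Finset.mem_biUnion.1 hb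
    rw [h b (resSet_subset g' hb)]
  · calc prOmega P (ForcedEvent P Q W' a s m L)
        ≤ (1 / 2 : ℝ) ^ m * (2 * (W'.N * (1 / 2 : ℝ) ^ (L - 1))) :=
          prOmega_forcedEvent_le P Q W' a s m L hN1
      _ ≤ (1 / 2 : ℝ) ^ m * (2 * (2 : ℝ) ^ (-1 - (c₀ - 5) * lg)) := by gcongr
      _ = (2 : ℝ) ^ (-(m : ℝ) - (c₀ - 5) * lg) := by
        have h2 : (1 / 2 : ℝ) ^ m = (2 : ℝ) ^ (-(m : ℝ)) := by
          rw [one_div, inv_pow, ← Real.rpow_natCast, ← Real.rpow_neg (by norm_num)]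
        nth_rw 2 [← Real.rpow_one 2]
        rw [h2, ← Real.rpow_add (by norm_num), ← Real.rpow_add (by norm_num)]
        congr 1
        ring
end

section
/- Let n, r ≥ 1 be integers, let K_1, …, K_r be (not necessarily distinct) subintervals of [n], and let u_1 ∈ K_1, u_2 ∈ K_2, …, u_r ∈ K_r be pairwise distinct elements; set U = {u_1,…,u_r}. Then there are at least r/2 indices i ∈ [r] such that |K_i ∩ U| ≥ |K_i|·r/(4n). -/
/-- A finite family of integer intervals has a subfamily with the same union that covers
every point at most twice. -/
theorem exists_subcover_card_le_two {ι : Type*} [DecidableEq ι] (a b : ι → ℕ) (B : Finset ι) :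
    ∃ S ⊆ B, (∀ i ∈ B, ∀ x ∈ Finset.Icc (a i) (b i), ∃ j ∈ S, x ∈ Finset.Icc (a j) (b j)) ∧
      ∀ x, (S.filter fun i => x ∈ Finset.Icc (a i) (b i)).card ≤ 2 := by
  induction B using Finset.strongInduction with
  | H B ih =>
    by_cases h : ∀ x, (B.filter fun i => x ∈ Finset.Icc (a i) (b i)).card ≤ 2
    · exact ⟨B, subset_rfl, fun i hi x hx => ⟨i, hi, hx⟩, h⟩
    push Not at h
    obtain ⟨x, hx⟩ := h
    set T := B.filter fun i => x ∈ Finset.Icc (a i) (b i) with hT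
    have hTne : T.Nonempty := Finset.card_pos.mp (by omega)
    obtain ⟨p, hp, hpmin⟩ := T.exists_min_image a hTne
    obtain ⟨q, hq, hqmax⟩ := T.exists_max_image b hTne
    obtain ⟨j, hj, hjpq⟩ := Finset.exists_mem_notMem_of_card_lt_card
      (lt_of_le_of_lt (Finset.card_le_two (a := p) (b := q)) hx)
    have hjp : p ≠ j := by rintro rfl; simp at hjpq
    have hjq : q ≠ j := by rintro rfl; simp at hjpq
    have hpj := hpmin j hj
    have hqj := hqmax j hj
    simp only [hT, Finset.mem_filter, Finset.mem_Icc] at hp hq hj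
    obtain ⟨S, hSB, hcov, hS⟩ := ih (B.erase j) (Finset.erase_ssubset hj.1)
    refine ⟨S, hSB.trans (Finset.erase_subset _ _), fun i hi y hy => ?_, hS⟩
    by_cases hij : i = j
    · subst hij
      rw [Finset.mem_Icc] at hy
      rcases le_total y x with hyx | hyx
      · exact hcov p (Finset.mem_erase.mpr ⟨hjp, hp.1⟩) y (Finset.mem_Icc.mpr (by omega))
      · exact hcov q (Finset.mem_erase.mpr ⟨hjq, hq.1⟩) y (Finset.mem_Icc.mpr (by omega))
    · exact hcov i (Finset.mem_erase.mpr ⟨hij, hi⟩) y hy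

/-- **Density lemma.** Let `n, r ≥ 1`, let `K 1, …, K r` be (not necessarily distinct)
subintervals of `[n] = {1,…,n}` and let `u i ∈ K i` be pairwise distinct elements, with
`U = {u 1, …, u r}`.  Then at least `r/2` of the indices `i` satisfy
`|K i ∩ U| ≥ |K i|·r/(4n)`. -/
theorem stmt11 (n r : ℕ) (hn : 1 ≤ n) (hr : 1 ≤ r)
    (K : Fin r → Finset ℕ)
    (hK : ∀ i, ∃ a b : ℕ, 1 ≤ a ∧ a ≤ b ∧ b ≤ n ∧ K i = Finset.Icc a b)
    (u : Fin r → ℕ) (hu : ∀ i, u i ∈ K i) (huinj : Function.Injective u) :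
    (r : ℝ) / 2 ≤
      ((Finset.univ.filter fun i : Fin r =>
        ((K i).card : ℝ) * r / (4 * n) ≤ ((K i ∩ Finset.univ.image u).card : ℝ)).card : ℝ) := by
  classical
  choose a b ha _ hb hab using hK
  set G := Finset.univ.filter fun i : Fin r =>
    ((K i).card : ℝ) * r / (4 * n) ≤ ((K i ∩ Finset.univ.image u).card : ℝ) with hG
  obtain ⟨S, hSB, hcov, hS⟩ := exists_subcover_card_le_two a b Gᶜ
  simp only [← hab] at hcov hS
  have hbad : ∀ i ∈ S, ((K i ∩ Finset.univ.image u).card : ℝ) ≤ (K i).card * (r / (4 * n)) := by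
    intro i hi
    have h := hSB hi
    simp only [hG, Finset.mem_compl, Finset.mem_filter, Finset.mem_univ, true_and, not_le] at h
    rw [← mul_div_assoc]
    exact h.le
  have hcount : Gᶜ.card ≤ ∑ i ∈ S, (K i ∩ Finset.univ.image u).card := by
    rw [← Finset.card_image_of_injective _ huinj]
    refine (Finset.card_le_card fun y hy => ?_).trans Finset.card_biUnion_le
    obtain ⟨i, hi, rfl⟩ := Finset.mem_image.mp hy
    obtain ⟨j, hj, hij⟩ := hcov i hi (u i) (hu i)
    exact Finset.mem_biUnion.mpr ⟨j, hj, Finset.mem_inter.mpr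
      ⟨hij, Finset.mem_image_of_mem u (Finset.mem_univ i)⟩⟩
  have hlen : ∑ i ∈ S, (K i).card ≤ 2 * n := by
    calc ∑ i ∈ S, (K i).card
        = ∑ i ∈ S, ((Finset.Icc 1 n).filter fun x => x ∈ K i).card := by
          refine Finset.sum_congr rfl fun i _ => congrArg Finset.card ?_
          ext x
          have := ha i
          have := hb i
          simp only [hab, Finset.mem_filter, Finset.mem_Icc]
          omega
      _ = ∑ x ∈ Finset.Icc 1 n, (S.filter fun i => x ∈ K i).card :=
          Finset.sum_card_bipartiteAbove_eq_sum_card_bipartiteBelow fun i x => x ∈ K i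
      _ ≤ ∑ _x ∈ Finset.Icc 1 n, 2 := Finset.sum_le_sum fun x _ => hS x
      _ = 2 * n := by simp [mul_comm]
  have hn0 : (0 : ℝ) < n := by exact_mod_cast hn
  have hhalf : (Gᶜ.card : ℝ) ≤ r / 2 := by
    calc (Gᶜ.card : ℝ) ≤ ∑ i ∈ S, ((K i ∩ Finset.univ.image u).card : ℝ) := by
          exact_mod_cast hcount
      _ ≤ ∑ i ∈ S, ((K i).card : ℝ) * (r / (4 * n)) := Finset.sum_le_sum hbad
      _ = (∑ i ∈ S, ((K i).card : ℝ)) * (r / (4 * n)) := by rw [Finset.sum_mul]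
      _ ≤ (2 * n) * (r / (4 * n)) := by
          gcongr
          exact_mod_cast hlen
      _ = r / 2 := by
          field_simp
          norm_num
  have htotal : (G.card : ℝ) + Gᶜ.card = r := by
    have h := Finset.card_add_card_compl G
    rw [Fintype.card_fin] at h
    exact_mod_cast h
  linarith
end

section
/- Let C be a finite linearly ordered set, let K_1, …, K_m be subintervals of C, and let T be a finite subset of K_1 ∪ … ∪ K_m. Then there exists a set of indices I ⊆ [m] such that the subintervals {K_i : i ∈ I} are pairwise disjoint and |T ∩ ∪_{i∈I} K_i| ≥ |T|/2. -/
/-- A finite set covered by finitely many closed intervals is covered by two families, each made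
of pairwise disjoint intervals.  The last two conclusions make the greedy induction work. -/
theorem exists_two_pairwiseDisjoint_Icc_cover {ι α : Type*} [Finite ι] [LinearOrder α]
    (a b : ι → α) (T : Finset α) (hT : ∀ t ∈ T, ∃ i, t ∈ Set.Icc (a i) (b i)) :
    ∃ A B : Finset ι,
      (A : Set ι).PairwiseDisjoint (fun i => Set.Icc (a i) (b i)) ∧
      (B : Set ι).PairwiseDisjoint (fun i => Set.Icc (a i) (b i)) ∧
      (∀ t ∈ T, (∃ i ∈ A, t ∈ Set.Icc (a i) (b i)) ∨ ∃ i ∈ B, t ∈ Set.Icc (a i) (b i)) ∧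
      (∀ i, i ∈ A ∨ i ∈ B → ∃ t ∈ T, t ∈ Set.Icc (a i) (b i)) ∧
      ∀ i ∈ B, ∃ t ∈ T, b i < t := by
  classical
  induction T using Finset.strongInduction with
  | H T ih =>
    rcases T.eq_empty_or_nonempty with rfl | hne
    · exact ⟨∅, ∅, by simp⟩
    obtain ⟨t, htT, htmax⟩ := T.exists_max_image id hne
    obtain ⟨i, hti, himin⟩ := Set.exists_min_image {i | t ∈ Set.Icc (a i) (b i)} a
      (Set.toFinite _) (hT t htT)
    obtain ⟨A, B, hA, hB, hcov, hmeet, hlt⟩ := ih (T.filter (· < a i))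
      (Finset.filter_ssubset.2 ⟨t, htT, not_lt.2 hti.1⟩)
      (fun s hs => hT s (Finset.mem_filter.1 hs).1)
    refine ⟨insert i B, A, ?_, hA, ?_, ?_, ?_⟩
    · rw [Finset.coe_insert]
      refine hB.insert fun j hj _ => Set.disjoint_left.2 fun s hsi hsj => ?_
      obtain ⟨u, hu, hju⟩ := hlt j hj
      exact (hsj.2.trans_lt (hju.trans (Finset.mem_filter.1 hu).2)).not_ge hsi.1
    · intro s hs
      by_cases hsi : s < a i
      · rcases hcov s (Finset.mem_filter.2 ⟨hs, hsi⟩) with h | ⟨j, hj, hsj⟩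
        · exact Or.inr h
        · exact Or.inl ⟨j, Finset.mem_insert_of_mem hj, hsj⟩
      · exact Or.inl ⟨i, Finset.mem_insert_self i B, not_lt.1 hsi, (htmax s hs).trans hti.2⟩
    · intro j hj
      rw [Finset.mem_insert, or_assoc] at hj
      rcases hj with rfl | hj
      · exact ⟨t, htT, hti⟩
      · obtain ⟨s, hs, hsj⟩ := hmeet j hj.symm
        exact ⟨s, (Finset.mem_filter.1 hs).1, hsj⟩
    · intro j hj
      obtain ⟨s, hs, hsj⟩ := hmeet j (Or.inl hj)
      have hji : a j < a i := hsj.1.trans_lt (Finset.mem_filter.1 hs).2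
      refine ⟨t, htT, lt_of_not_ge fun htj => ?_⟩
      exact (himin j ⟨hji.le.trans hti.1, htj⟩).not_gt hji


/-- Let `C` be a finite linearly ordered set, `K 1, …, K m` subintervals of `C` and `T` a
finite subset of their union.  Then one can select a set `I` of indices whose subintervals
are pairwise disjoint and which together cover at least half of `T`. -/
theorem stmt12 (C : Type*) [Fintype C] [LinearOrder C]
    (m : ℕ) (K : Fin m → Finset C)
    (hK : ∀ i, ∃ x y : C, ∀ z : C, z ∈ K i ↔ x ≤ z ∧ z ≤ y)
    (T : Finset C) (hT : T ⊆ Finset.univ.biUnion K) :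
    ∃ I : Finset (Fin m),
      (∀ i ∈ I, ∀ j ∈ I, i ≠ j → Disjoint (K i) (K j)) ∧
      (T.card : ℝ) / 2 ≤ ((T ∩ I.biUnion K).card : ℝ) := by
  choose a b hab using hK
  have hmem : ∀ i z, z ∈ K i ↔ z ∈ Set.Icc (a i) (b i) := hab
  obtain ⟨A, B, hA, hB, hcov, -, -⟩ := exists_two_pairwiseDisjoint_Icc_cover a b T fun t ht => by
    obtain ⟨i, -, hi⟩ := Finset.mem_biUnion.1 (hT ht)
    exact ⟨i, (hmem i t).1 hi⟩
  have hdisj : ∀ I : Finset (Fin m),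
      (I : Set (Fin m)).PairwiseDisjoint (fun i => Set.Icc (a i) (b i)) →
      ∀ i ∈ I, ∀ j ∈ I, i ≠ j → Disjoint (K i) (K j) := fun I hI i hi j hj hij =>
    Finset.disjoint_left.2 fun z hzi hzj =>
      Set.disjoint_left.1 (hI hi hj hij) ((hmem i z).1 hzi) ((hmem j z).1 hzj)
  have hsub : T ⊆ (T ∩ A.biUnion K) ∪ (T ∩ B.biUnion K) := fun t ht => by
    simpa [ht, hmem] using hcov t ht
  have hcard : (T.card : ℝ) ≤ (T ∩ A.biUnion K).card + (T ∩ B.biUnion K).card := by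
    exact_mod_cast (Finset.card_le_card hsub).trans (Finset.card_union_le _ _)
  rcases le_total (T ∩ A.biUnion K).card (T ∩ B.biUnion K).card with h | h
  · have h' : ((T ∩ A.biUnion K).card : ℝ) ≤ (T ∩ B.biUnion K).card := by exact_mod_cast h
    exact ⟨B, hdisj B hB, by linarith⟩
  · have h' : ((T ∩ B.biUnion K).card : ℝ) ≤ (T ∩ A.biUnion K).card := by exact_mod_cast h
    exact ⟨A, hdisj A hA, by linarith⟩
end

section
/- Let W be a union circuit over a finite set B in which every input gate has a singleton wset, let ℓ ≥ 2 be an integer, and let g_out be a gate of W with |wset(g_out)| ≥ ℓ. Let D be a set of binary gates of W, each a predecessor of g_out (where every gate counts as a predecessor of itself), such that every g ∈ D satisfies |wset(g)| ≥ ℓ and min(|wset(left(g))|, |wset(right(g))|) < ℓ, such that distinct gates g ≠ g' in D have distinct triples {wset(g), wset(left(g)), wset(right(g))} ≠ {wset(g'), wset(left(g')), wset(right(g'))}, and such that D is maximal with these properties. Then |wset(g_out)| ≤ 2ℓ·|D|. -/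
/-- `h` is a predecessor of `g`: there is a directed (possibly empty) path from `h` to `g`. -/
def UnionCircuit.Pred {nB : ℕ} (W : UnionCircuit nB) (h g : Fin W.N) : Prop :=
  Relation.ReflTransGen (fun x y => W.inp y = false ∧ (x = W.left y ∨ x = W.right y)) h g

/-- The union of the members of a family that have fewer than `ℓ` elements. -/
def smallUnion {nB : ℕ} (ℓ : ℕ) (t : Finset (Finset (Fin nB))) : Finset (Fin nB) :=
  (t.filter fun s => s.card < ℓ).biUnion id

theorem subset_smallUnion {nB ℓ : ℕ} {t : Finset (Finset (Fin nB))} {s : Finset (Fin nB)}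
    (hs : s ∈ t) (h : s.card < ℓ) : s ⊆ smallUnion ℓ t :=
  Finset.subset_biUnion_of_mem id (Finset.mem_filter.2 ⟨hs, h⟩)

theorem card_smallUnion_triple_le {nB ℓ : ℕ} {a b c : Finset (Fin nB)} (ha : ℓ ≤ a.card) :
    (smallUnion ℓ {a, b, c}).card ≤ 2 * ℓ := by
  have hsub : ({a, b, c} : Finset (Finset (Fin nB))).filter (fun s => s.card < ℓ) ⊆ {b, c} := by
    intro s hs
    simp only [Finset.mem_filter, Finset.mem_insert, Finset.mem_singleton] at hs ⊢
    obtain ⟨rfl | h, hlt⟩ := hs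
    · omega
    · exact h
  calc (smallUnion ℓ {a, b, c}).card
      ≤ (({a, b, c} : Finset (Finset (Fin nB))).filter fun s => s.card < ℓ).card * ℓ :=
        Finset.card_biUnion_le_card_mul _ _ _ fun s hs => (Finset.mem_filter.1 hs).2.le
    _ ≤ 2 * ℓ := Nat.mul_le_mul_right _ ((Finset.card_le_card hsub).trans Finset.card_le_two)

/-- Let `W` be a union circuit over `B` whose input gates carry singleton `wset`s, let
`ℓ ≥ 2` and let `g_out` be a gate with `|wset g_out| ≥ ℓ`.  If `D` is a maximal set of
binary predecessors of `g_out`, each with `|wset g| ≥ ℓ` and `min(|wset (left g)|,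
|wset (right g)|) < ℓ`, with pairwise distinct triples
`{wset g, wset (left g), wset (right g)}`, then `|wset g_out| ≤ 2ℓ·|D|`. -/
theorem stmt14 (nB : ℕ) (W : UnionCircuit nB)
    (hinp : ∀ g, W.inp g = true → ∃ b, W.wset g = {b})
    (ℓ : ℕ) (hl : 2 ≤ ℓ) (gout : Fin W.N) (hgout : ℓ ≤ (W.wset gout).card)
    (D : Finset (Fin W.N))
    (hDbin : ∀ g ∈ D, W.inp g = false)
    (hDpred : ∀ g ∈ D, W.Pred g gout)
    (hDl : ∀ g ∈ D, ℓ ≤ (W.wset g).card ∧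
      min (W.wset (W.left g)).card (W.wset (W.right g)).card < ℓ)
    (hDdist : ∀ g ∈ D, ∀ g' ∈ D, g ≠ g' →
      ({W.wset g, W.wset (W.left g), W.wset (W.right g)} : Finset (Finset (Fin nB))) ≠
        {W.wset g', W.wset (W.left g'), W.wset (W.right g')})
    (hmax : ∀ g', W.inp g' = false → W.Pred g' gout →
      ℓ ≤ (W.wset g').card →
      min (W.wset (W.left g')).card (W.wset (W.right g')).card < ℓ →
      g' ∉ D → ∃ g ∈ D,
        ({W.wset g', W.wset (W.left g'), W.wset (W.right g')} : Finset (Finset (Fin nB))) =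
          {W.wset g, W.wset (W.left g), W.wset (W.right g)}) :
    (W.wset gout).card ≤ 2 * ℓ * D.card := by
  have cover : ∀ g : Fin W.N, W.Pred g gout → ℓ ≤ (W.wset g).card → W.wset g ⊆
      D.biUnion fun d => smallUnion ℓ {W.wset d, W.wset (W.left d), W.wset (W.right d)} := by
    intro g
    induction g using WellFoundedLT.induction with
    | ind g ih =>
      intro hpred hcard
      have hbin : W.inp g = false := by
        by_contra h
        obtain ⟨b, hb⟩ := hinp g (by simpa using h)
        rw [hb, Finset.card_singleton] at hcard
        omega
      have hpl : W.Pred (W.left g) gout := Relation.ReflTransGen.head ⟨hbin, Or.inl rfl⟩ hpred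
      have hpr : W.Pred (W.right g) gout := Relation.ReflTransGen.head ⟨hbin, Or.inr rfl⟩ hpred
      have small : min (W.wset (W.left g)).card (W.wset (W.right g)).card < ℓ →
          smallUnion ℓ {W.wset g, W.wset (W.left g), W.wset (W.right g)} ⊆ D.biUnion
            fun d => smallUnion ℓ {W.wset d, W.wset (W.left d), W.wset (W.right d)} := by
        intro hmin
        obtain ⟨d, hd, heq⟩ : ∃ d ∈ D,
            ({W.wset g, W.wset (W.left g), W.wset (W.right g)} : Finset (Finset (Fin nB))) =
              {W.wset d, W.wset (W.left d), W.wset (W.right d)} := by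
          by_cases hg : g ∈ D
          · exact ⟨g, hg, rfl⟩
          · exact hmax g hbin hpred hcard hmin hg
        rw [heq]
        exact Finset.subset_biUnion_of_mem
          (fun d => smallUnion ℓ {W.wset d, W.wset (W.left d), W.wset (W.right d)}) hd
      conv_lhs => rw [W.hwset g hbin]
      refine Finset.union_subset ?_ ?_
      · rcases lt_or_ge (W.wset (W.left g)).card ℓ with h | h
        · exact (subset_smallUnion (by simp) h).trans (small (min_lt_of_left_lt h))
        · exact ih _ (W.hacyc g hbin).1 hpl h
      · rcases lt_or_ge (W.wset (W.right g)).card ℓ with h | h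
        · exact (subset_smallUnion (by simp) h).trans (small (min_lt_of_right_lt h))
        · exact ih _ (W.hacyc g hbin).2 hpr h
  refine (Finset.card_le_card (cover gout Relation.ReflTransGen.refl hgout)).trans ?_
  rw [mul_comm]
  exact Finset.card_biUnion_le_card_mul _ _ _ fun d hd => card_smallUnion_triple_le (hDl d hd).1
end

section
/- Let W be a structured witness circuit for P × Q in which every gate's output is defined. If g and g' are union gates of W whose outputs (S, K, v) and (S', K', v') satisfy K ≠ K', then no union gate of W is simultaneously a predecessor of g and a predecessor of g' (where every gate counts as a predecessor of itself). -/
open scoped Classical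

/-- `h` is a predecessor of `g`: there is a directed (possibly empty) path from `h` to `g`. -/
def WitnessCircuit.Pred {nB : ℕ} (W : WitnessCircuit nB) (h g : Fin W.N) : Prop :=
  Relation.ReflTransGen (fun x y => x ∈ (W.kind y).preds) h g

/-- In a structured circuit all of whose gates are defined, a gate with a union gate as a
predecessor is a concatenation gate, or a union gate carrying the same subinterval. -/
theorem WitnessCircuit.Pred.union_or_concat {nB nC : ℕ} {W : WitnessCircuit nB}
    (hdef : W.Defined nC) (hstr : W.Structured) {h g : Fin W.N}
    (hh : ∃ x y : Fin W.N, W.kind h = Gk.union x y) (hp : W.Pred h g) :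
    ((∃ x y : Fin W.N, W.kind g = Gk.union x y) ∧ W.st g = W.st h ∧ W.ln g = W.ln h) ∨
      ∃ x y : Fin W.N, W.kind g = Gk.concat x y := by
  induction hp with
  | refl => exact Or.inl ⟨hh, rfl, rfl⟩
  | @tail p q _ hpq ih =>
    have hd := hdef.2 q
    have hs := hstr q
    cases hk : W.kind q with
    | input b => simp [hk, Gk.preds] at hpq
    | partition r s l =>
      simp only [hk] at hs
      obtain rfl : p = r := by simpa [hk, Gk.preds] using hpq
      rcases ih with ⟨⟨x, y, hu⟩, -⟩ | ⟨x, y, hc⟩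
      · exact absurd hu (hs x y).1
      · exact absurd hc (hs x y).2
    | union l r =>
      simp only [hk] at hs hd
      obtain ⟨hst, hln, -, hst', hln'⟩ := hd
      have hlr : p = l ∨ p = r := by simpa [hk, Gk.preds] using hpq
      rcases ih with ⟨-, ihst, ihln⟩ | ⟨x, y, hc⟩
      · refine Or.inl ⟨⟨l, r, rfl⟩, ?_⟩
        rcases hlr with rfl | rfl <;> omega
      · rcases hlr with rfl | rfl
        · exact absurd hc (hs x y).1
        · exact absurd hc (hs x y).2
    | concat l r => exact Or.inr ⟨l, r, rfl⟩

/-- In a structured witness circuit all of whose gates are defined, if `g` and `g'` are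
union gates whose output subintervals differ, then no union gate is simultaneously a
predecessor of `g` and of `g'`. -/
theorem stmt15 (nB nC : ℕ) (W : WitnessCircuit nB)
    (hdef : W.Defined nC) (hstr : W.Structured)
    (g g' : Fin W.N)
    (hg : ∃ x y : Fin W.N, W.kind g = Gk.union x y)
    (hg' : ∃ x y : Fin W.N, W.kind g' = Gk.union x y)
    (hK : W.st g ≠ W.st g' ∨ W.ln g ≠ W.ln g') :
    ¬ ∃ h : Fin W.N, (∃ x y : Fin W.N, W.kind h = Gk.union x y) ∧
        W.Pred h g ∧ W.Pred h g' := by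
  rintro ⟨h, hh, hp, hp'⟩
  obtain ⟨x, y, hg⟩ := hg
  obtain ⟨x', y', hg'⟩ := hg'
  have key := hp.union_or_concat hdef hstr hh
  have key' := hp'.union_or_concat hdef hstr hh
  simp only [hg, reduceCtorEq, exists_false, or_false] at key
  simp only [hg', reduceCtorEq, exists_false, or_false] at key'
  omega
end
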